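/- arXiv:2208.04064 — 6 statements merged into one kernel-verified Lean document; each statement's English description precedes it below -/
import Mathlib

section
/- Let G be a finite group with d(G) = 2. Then G satisfies the rank-independence property if and only if one of the following holds: (i) G is isomorphic to C_p × C_p for some prime p; (ii) G is isomorphic to the quaternion group Q_8 of order 8; (iii) G is isomorphic to a semidirect product C_p ⋊ C_{q^m}, where p and q are distinct primes, m is a positive integer, and the kernel of the action of C_{q^m} on C_p is the (unique) subgroup of C_{q^m} of order q^{m-1} (so the induced action on C_p is non-trivial of order q). -/
/-- `minGen G` is `d(G)`: the smallest cardinality of a generating set for `G`. -/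
noncomputable def minGen (G : Type*) [Group G] : ℕ :=
  sInf {n | ∃ S : Finset G, S.card = n ∧ Subgroup.closure (S : Set G) = ⊤}

/-- A non-cyclic group `G` satisfies the *rank-independence property* if for all `x, y ∈ G`
generating a non-cyclic subgroup, there is a generating set for `G` of cardinality `d(G)`
containing both `x` and `y`. -/
def RankIndependenceProperty (G : Type*) [Group G] : Prop :=
  ¬ IsCyclic G ∧
    ∀ x y : G, ¬ IsCyclic ↥(Subgroup.closure ({x, y} : Set G)) →
      ∃ S : Finset G, S.card = minGen G ∧ x ∈ S ∧ y ∈ S ∧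
        Subgroup.closure (S : Set G) = ⊤

/-- All proper subgroups are cyclic. -/
def ProperCyclic (G : Type*) [Group G] : Prop := ∀ H : Subgroup G, H ≠ ⊤ → IsCyclic H

lemma not_cyclic_of_minGen {G : Type*} [Group G] (hd : minGen G = 2) : ¬ IsCyclic G := by
  intro h
  obtain ⟨g, hg⟩ := isCyclic_iff_exists_zpowers_eq_top.mp h
  have : minGen G ≤ 1 := Nat.sInf_le ⟨{g}, by simp, by
    rw [← hg, Subgroup.zpowers_eq_closure]; simp⟩
  omega

lemma isCyclic_of_two_gen {G : Type*} [Group G] [Finite G] (H : Subgroup G)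
    (h : ∀ x ∈ H, ∀ y ∈ H, IsCyclic (Subgroup.closure ({x, y} : Set G))) : IsCyclic H := by
  obtain ⟨g, hg⟩ := Finite.exists_max (fun g : H => orderOf (g : G))
  rw [Subgroup.isCyclic_iff_exists_zpowers_eq_top]
  refine ⟨g, le_antisymm (by simp) fun x hx => ?_⟩
  obtain ⟨k, hk⟩ := (Subgroup.isCyclic_iff_exists_zpowers_eq_top _).mp (h g g.2 x hx)
  have hgk : (g : G) ∈ Subgroup.zpowers k := hk ▸ Subgroup.subset_closure (by simp)
  have hxk : x ∈ Subgroup.zpowers k := hk ▸ Subgroup.subset_closure (by simp)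
  have hkH : k ∈ H := by
    have : Subgroup.closure ({(g : G), x} : Set G) ≤ H := by
      rw [Subgroup.closure_le]; rintro z (rfl | rfl)
      · exact g.2
      · exact hx
    exact this (hk ▸ Subgroup.mem_zpowers k)
  have : Subgroup.zpowers (g : G) = Subgroup.zpowers k :=
    Subgroup.eq_of_le_of_card_ge (by simpa using hgk) (by
      rw [Nat.card_zpowers, Nat.card_zpowers]; exact hg ⟨k, hkH⟩)
  rw [this]; exact hxk

lemma rip_iff {G : Type*} [Group G] [Finite G] (hd : minGen G = 2) :
    RankIndependenceProperty G ↔ ProperCyclic G := by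
  classical
  constructor
  · rintro ⟨-, h⟩ H hH
    apply isCyclic_of_two_gen
    intro x hx y hy
    by_contra hc
    obtain ⟨S, hS, hxS, hyS, hcl⟩ := h x y hc
    have hxy : x ≠ y := by
      rintro rfl
      apply hc
      rw [Subgroup.isCyclic_iff_exists_zpowers_eq_top]
      exact ⟨x, by rw [Subgroup.zpowers_eq_closure]; simp⟩
    have : ({x, y} : Finset G) = S := Finset.eq_of_subset_of_card_le
      (by intro z; simp; rintro (rfl | rfl) <;> assumption)
      (by rw [hS, hd, Finset.card_pair hxy])
    apply hH
    rw [eq_top_iff, ← hcl, ← this, Subgroup.closure_le]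
    intro z; simp; rintro (rfl | rfl) <;> assumption
  · intro h
    refine ⟨not_cyclic_of_minGen hd, fun x y hc => ⟨{x, y}, ?_, by simp, by simp, ?_⟩⟩
    · rw [hd]
      apply Finset.card_pair
      rintro rfl
      apply hc
      rw [Subgroup.isCyclic_iff_exists_zpowers_eq_top]
      exact ⟨x, by rw [Subgroup.zpowers_eq_closure]; simp⟩
    · rw [Finset.coe_pair]
      by_contra h1
      exact hc (h _ h1)

lemma ProperCyclic.of_equiv {G K : Type*} [Group G] [Group K] (e : G ≃* K)
    (h : ProperCyclic K) : ProperCyclic G := by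
  intro H hH
  have h1 : H.map e.toMonoidHom ≠ ⊤ := by
    intro h1
    apply hH
    apply Subgroup.map_injective (f := e.toMonoidHom) e.injective
    rw [h1, eq_comm, ← MonoidHom.range_eq_map, MonoidHom.range_eq_top]
    exact e.surjective
  have := h _ h1
  exact (e.subgroupMap H).isCyclic.mpr this

lemma properCyclic_CpCp {p : ℕ} (hp : p.Prime) :
    ProperCyclic (Multiplicative (ZMod p × ZMod p)) := by
  intro H hH
  have := Fact.mk hp
  have hc : Nat.card (Multiplicative (ZMod p × ZMod p)) = p ^ 2 := by
    rw [Nat.card_congr Multiplicative.toAdd, Nat.card_prod, Nat.card_zmod, sq]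
  have h1 := H.card_subgroup_dvd_card
  rw [hc] at h1
  obtain ⟨k, hk, h2⟩ := (Nat.dvd_prime_pow hp).mp h1
  have : k ≠ 2 := by
    rintro rfl
    exact hH (Subgroup.eq_top_of_card_eq _ (by rw [h2, hc]))
  apply isCyclic_of_card_dvd_prime (p := p)
  rw [h2]
  calc p ^ k ∣ p ^ 1 := pow_dvd_pow _ (by omega)
    _ = p := pow_one p

lemma properCyclic_Q8 : ProperCyclic (QuaternionGroup 2) := by
  intro H hH
  have hc : Nat.card (QuaternionGroup 2) = 2 ^ 3 := by
    rw [Nat.card_eq_fintype_card, QuaternionGroup.card]; norm_num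
  have h1 := H.card_subgroup_dvd_card
  rw [hc] at h1
  obtain ⟨k, hk, h2⟩ := (Nat.dvd_prime_pow Nat.prime_two).mp h1
  have : k ≠ 3 := by
    rintro rfl
    exact hH (Subgroup.eq_top_of_card_eq _ (by rw [h2, hc]))
  by_cases hk2 : k = 2
  · subst hk2
    have hex : ∃ x : H, (x : QuaternionGroup 2) ^ 2 ≠ 1 := by
      by_contra! hall
      have hd : ∀ x : QuaternionGroup 2, x ^ 2 = 1 → x ∈ ({1, .a 2} : Finset (QuaternionGroup 2)) := by
        decide
      have : (H : Set (QuaternionGroup 2)).ncard ≤ ((({1, .a 2} : Finset (QuaternionGroup 2)) : Set (QuaternionGroup 2))).ncard :=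
        Set.ncard_le_ncard (fun x hx => hd x (hall ⟨x, hx⟩)) (Finset.finite_toSet _)
      rw [Set.ncard_coe_finset] at this
      have h3 : ({1, .a 2} : Finset (QuaternionGroup 2)).card ≤ 2 := Finset.card_le_two
      have h4 : (H : Set (QuaternionGroup 2)).ncard = Nat.card H := rfl
      omega
    obtain ⟨x, hx⟩ := hex
    apply isCyclic_of_orderOf_eq_card x
    have : orderOf x ∣ 2 ^ 2 := h2 ▸ orderOf_dvd_natCard x
    obtain ⟨j, hj, h5⟩ := (Nat.dvd_prime_pow Nat.prime_two).mp this
    have : j = 2 := by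
      by_contra hne
      apply hx
      have : x ^ 2 = 1 := by
        rw [← orderOf_dvd_iff_pow_eq_one, h5]
        calc 2 ^ j ∣ 2 ^ 1 := pow_dvd_pow _ (by omega)
          _ = 2 := rfl
      exact_mod_cast congrArg Subtype.val this
    rw [h5, h2, this]
  · have := Fact.mk Nat.prime_two
    apply isCyclic_of_card_dvd_prime (p := 2)
    rw [h2]
    calc 2 ^ k ∣ 2 ^ 1 := pow_dvd_pow _ (by omega)
      _ = 2 := pow_one 2

lemma properCyclic_semi {N H : Type*} [Group N] [Group H] [IsCyclic H]
    (φ : H →* MulAut N) {p q m : ℕ} (hp : p.Prime) (hq : q.Prime) (hpq : p ≠ q) (hm : 0 < m)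
    (hN : Nat.card N = p) (hH : Nat.card H = q ^ m) (hk : Nat.card φ.ker = q ^ (m - 1)) :
    ProperCyclic (SemidirectProduct N H φ) := by
  intro K hK
  have := Fact.mk hp
  have := Fact.mk hq
  have hfH : Finite H := Nat.finite_of_card_ne_zero (by rw [hH]; exact pow_ne_zero _ hq.ne_zero)
  have hfN : Finite N := Nat.finite_of_card_ne_zero (by rw [hN]; exact hp.ne_zero)
  have hcN : IsCyclic N := isCyclic_of_prime_card hN
  let f : K →* H := (SemidirectProduct.rightHom (φ := φ)).comp K.subtype
  have hf : ∀ x : K, f x = x.1.right := fun x => rfl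
  by_cases hr : f.range = ⊤
  · have hsur : Function.Surjective f := MonoidHom.range_eq_top.mp hr
    have hpr : (Nat.card N).Prime := hN ▸ hp
    have := Fact.mk hpr
    rcases (K.comap (SemidirectProduct.inl (φ := φ))).eq_bot_or_eq_top_of_prime_card with h1 | h1
    · apply isCyclic_of_injective f
      rw [injective_iff_map_eq_one]
      intro a ha
      rw [hf] at ha
      have e : SemidirectProduct.inl a.1.left = a.1 := by
        ext <;> simp [ha]
      have : a.1.left ∈ K.comap (SemidirectProduct.inl (φ := φ)) := by
        rw [Subgroup.mem_comap, e]; exact a.2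
      rw [h1, Subgroup.mem_bot] at this
      ext <;> simp [ha, this]
    · exfalso
      apply hK
      rw [eq_top_iff]
      intro g _
      obtain ⟨k, hk⟩ := hsur g.right
      rw [hf] at hk
      have e : g = SemidirectProduct.inl (g.left * k.1.left⁻¹) * k.1 := by
        ext <;> simp [hk]
      rw [e]
      refine K.mul_mem ?_ k.2
      have : g.left * k.1.left⁻¹ ∈ K.comap (SemidirectProduct.inl (φ := φ)) := by rw [h1]; trivial
      exact this
  · have hker : ∀ x : K, φ x.1.right = 1 := by
      obtain ⟨h, hh⟩ := isCyclic_iff_exists_zpowers_eq_top.mp ‹IsCyclic H›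
      have ho : orderOf h = q ^ m := by rw [← Nat.card_zpowers, hh, Subgroup.card_top, hH]
      have hidx : φ.ker.index = q := by
        have := φ.ker.card_mul_index
        rw [hk, hH, ← Nat.sub_add_cancel hm, pow_add, pow_one, Nat.add_sub_cancel] at this
        exact Nat.eq_of_mul_eq_mul_left (pow_pos hq.pos _) this
      have hhq : h ^ q ∈ φ.ker := hidx ▸ φ.ker.pow_index_mem h
      obtain ⟨n, hn⟩ := (Subgroup.le_zpowers_iff h f.range).mp (hh ▸ le_top)
      have hqn : q ∣ n := by
        by_contra hc
        apply hr
        apply Subgroup.eq_top_of_card_eq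
        rw [hn, Nat.card_zpowers, orderOf_pow, ho, hH]
        rw [Nat.Coprime.gcd_eq_one, Nat.div_one]
        exact Nat.Coprime.pow_left _ ((Nat.Prime.coprime_iff_not_dvd hq).mpr hc)
      intro x
      have hx : f x ∈ Subgroup.zpowers (h ^ n) := hn ▸ ⟨x, rfl⟩
      obtain ⟨c, rfl⟩ := hqn
      have : Subgroup.zpowers (h ^ (q * c)) ≤ φ.ker := by
        rw [Subgroup.zpowers_le, pow_mul]
        exact φ.ker.pow_mem hhq c
      exact this hx
    let _ : CommGroup N := IsCyclic.commGroup
    let _ : CommGroup H := IsCyclic.commGroup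
    let _ : CommGroup K := { (inferInstance : Group K) with
      mul_comm := by
        intro a b
        ext
        · simp [hker, mul_comm]
        · simp [mul_comm] }
    let g : f.ker →* N :=
      { toFun := fun x => x.1.1.left
        map_one' := by simp
        map_mul' := by intro x y; simp [hker] }
    have hg : Function.Injective g := by
      rw [injective_iff_map_eq_one]
      intro a ha
      have h1 : a.1.1.left = 1 := ha
      have h2 : a.1.1.right = 1 := a.2
      ext <;> simp [h1, h2]
    have : IsCyclic f.ker := isCyclic_of_injective g hg
    have h1 : Nat.card f.ker ∣ p := hN ▸ Subgroup.card_dvd_of_injective g hg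
    have h2 : Nat.card f.range ∣ q ^ m := hH ▸ f.range.card_subgroup_dvd_card
    apply Group.isCyclic_of_coprime_card_range_card_ker f
    exact Nat.Coprime.of_dvd h1 h2 (Nat.Coprime.pow_right _ ((Nat.coprime_primes hp hq).mpr hpq))

lemma semi_key {N H : Type*} [Group N] [IsCyclic N] [Group H] (φ : H →* MulAut N)
    (hL : ProperCyclic (SemidirectProduct N H φ)) (x : N) (h : H) (hx : φ h x ≠ x) :
    Subgroup.zpowers x = ⊤ ∧ Subgroup.zpowers h = ⊤ := by
  have hinv : ∀ k : H, ∀ y ∈ Subgroup.zpowers x, φ k y ∈ Subgroup.zpowers x := by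
    intro k y hy
    obtain ⟨r, hr⟩ := MonoidHom.map_cyclic (φ k).toMonoidHom
    have : φ k y = y ^ r := hr y
    rw [this]
    exact Subgroup.zpow_mem _ hy r
  let T : Subgroup (SemidirectProduct N H φ) :=
    { carrier := {g | g.left ∈ Subgroup.zpowers x ∧ g.right ∈ Subgroup.zpowers h}
      one_mem' := ⟨Subgroup.one_mem _, Subgroup.one_mem _⟩
      mul_mem' := by
        rintro a b ⟨h1, h2⟩ ⟨h3, h4⟩
        exact ⟨Subgroup.mul_mem _ h1 (hinv _ _ h3), Subgroup.mul_mem _ h2 h4⟩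
      inv_mem' := by
        rintro a ⟨h1, h2⟩
        exact ⟨hinv _ _ (Subgroup.inv_mem _ h1), Subgroup.inv_mem _ h2⟩ }
  have hT : T = ⊤ := by
    by_contra hc
    have := hL T hc
    let _ : CommGroup T := IsCyclic.commGroup
    have h1 : SemidirectProduct.inl x ∈ T := ⟨Subgroup.mem_zpowers x, Subgroup.one_mem _⟩
    have h2 : SemidirectProduct.inr h ∈ T := ⟨Subgroup.one_mem _, Subgroup.mem_zpowers h⟩
    have h3 := congrArg Subtype.val (mul_comm (⟨_, h1⟩ : T) ⟨_, h2⟩)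
    have h4 : (SemidirectProduct.inl x * SemidirectProduct.inr h : SemidirectProduct N H φ) =
      SemidirectProduct.inr h * SemidirectProduct.inl x := h3
    have h5 := congrArg SemidirectProduct.left h4
    simp at h5
    exact hx h5.symm
  constructor
  · rw [eq_top_iff]
    intro y _
    have : SemidirectProduct.inl y ∈ T := hT ▸ Subgroup.mem_top _
    exact this.1
  · rw [eq_top_iff]
    intro y _
    have : SemidirectProduct.inr y ∈ T := hT ▸ Subgroup.mem_top _
    exact this.2

lemma pow_not_gen {N : Type*} [Group N] [Finite N] (x : N) {p : ℕ} (hp : p.Prime)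
    (hd : p ∣ Nat.card N) : Subgroup.zpowers (x ^ p) ≠ ⊤ := by
  intro h
  have h1 : orderOf (x ^ p) = Nat.card N := by rw [← Nat.card_zpowers, h, Subgroup.card_top]
  have h2 : (x ^ p) ^ (Nat.card N / p) = 1 := by
    rw [← pow_mul, Nat.mul_div_cancel' hd, pow_card_eq_one']
  have h3 := orderOf_dvd_of_pow_eq_one h2
  rw [h1] at h3
  have h4 := Nat.le_of_dvd (Nat.div_pos (Nat.le_of_dvd Nat.card_pos hd) hp.pos) h3
  have := Nat.div_lt_self (Nat.card_pos (α := N)) hp.one_lt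
  omega

lemma eq_of_pow_coprime {N : Type*} [Group N] {x : N} (S : Subgroup N) {a b : ℕ}
    (ha : x ^ a ∈ S) (hb : x ^ b ∈ S) (hab : a.Coprime b) : x ∈ S := by
  have := Nat.gcd_eq_gcd_ab a b
  rw [hab.gcd_eq_one] at this
  have h2 : x = (x ^ a) ^ (a.gcdA b) * (x ^ b) ^ (a.gcdB b) := by
    rw [← zpow_natCast, ← zpow_natCast, ← zpow_mul, ← zpow_mul, ← zpow_add, ← this]; simp
  rw [h2]
  exact S.mul_mem (S.zpow_mem ha _) (S.zpow_mem hb _)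

lemma semi_classify {N H : Type*} [Group N] [Finite N] [IsCyclic N] [Group H] [Finite H]
    [IsCyclic H] (φ : H →* MulAut N) (hcop : (Nat.card N).Coprime (Nat.card H))
    (hL : ProperCyclic (SemidirectProduct N H φ)) (hnc : ¬ IsCyclic (SemidirectProduct N H φ)) :
    ∃ p q m : ℕ, p.Prime ∧ q.Prime ∧ p ≠ q ∧ 0 < m ∧ Nat.card N = p ∧ Nat.card H = q ^ m ∧
      Nat.card φ.ker = q ^ (m - 1) := by
  have hex : ∃ h x, φ h x ≠ x := by
    by_contra! hc
    apply hnc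
    let _ : CommGroup N := IsCyclic.commGroup
    let _ : CommGroup H := IsCyclic.commGroup
    let _ : CommGroup (SemidirectProduct N H φ) :=
      { (inferInstance : Group (SemidirectProduct N H φ)) with
        mul_comm := by
          intro a b
          ext
          · simp [hc, mul_comm]
          · simp [mul_comm] }
    let f : SemidirectProduct N H φ →* H := SemidirectProduct.rightHom
    have hfk : f.ker = (SemidirectProduct.inl (φ := φ)).range :=
      SemidirectProduct.range_inl_eq_ker_rightHom.symm
    let e : N ≃* f.ker := (MonoidHom.ofInjective (f := SemidirectProduct.inl (φ := φ))
      SemidirectProduct.inl_injective).trans (MulEquiv.subgroupCongr hfk.symm)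
    have : IsCyclic f.ker := e.isCyclic.mp inferInstance
    have h2 : Nat.card f.ker = Nat.card N := Nat.card_congr e.symm.toEquiv
    exact Group.isCyclic_of_coprime_card_ker f (by rw [h2]; exact hcop)
      SemidirectProduct.rightHom_surjective
  obtain ⟨h, x, hx⟩ := hex
  obtain ⟨gx, gh⟩ := semi_key φ hL x h hx
  have hH1 : ∀ q : ℕ, q.Prime → q ∣ Nat.card H → h ^ q ∈ φ.ker := by
    intro q hq hd
    rw [MonoidHom.mem_ker]
    ext y
    by_contra hc
    exact pow_not_gen h hq hd (semi_key φ hL y _ hc).2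
  have hN1 : ∀ p : ℕ, p.Prime → p ∣ Nat.card N → ∀ k, ∀ y, φ k (y ^ p) = y ^ p := by
    intro p hp hd k y
    by_contra hc
    exact pow_not_gen y hp hd (semi_key φ hL _ k hc).1
  have hhk : h ∉ φ.ker := by
    intro hc
    rw [MonoidHom.mem_ker] at hc
    exact hx (by rw [hc]; rfl)
  have hH2 : Nat.card H ≠ 1 := by
    intro hc
    have : Subsingleton H := (Nat.card_eq_one_iff_unique.mp hc).1
    exact hhk (by rw [Subsingleton.elim h 1]; exact Subgroup.one_mem _)
  have hN2 : Nat.card N ≠ 1 := by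
    intro hc
    have : Subsingleton N := (Nat.card_eq_one_iff_unique.mp hc).1
    exact hx (Subsingleton.elim _ _)
  obtain ⟨q, hq, hqd⟩ := Nat.exists_prime_and_dvd hH2
  obtain ⟨p, hp, hpd⟩ := Nat.exists_prime_and_dvd hN2
  have hHpp : IsPrimePow (Nat.card H) := by
    rw [isPrimePow_iff_unique_prime_dvd]
    refine ⟨q, ⟨hq, hqd⟩, ?_⟩
    rintro r ⟨hr, hrd⟩
    by_contra hne
    exact hhk (eq_of_pow_coprime _ (hH1 r hr hrd) (hH1 q hq hqd) ((Nat.coprime_primes hr hq).mpr hne))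
  obtain ⟨q', m, hq', hm, hqm⟩ := (isPrimePow_nat_iff _).mp hHpp
  have : q' = q := by
    rw [← hqm] at hqd
    exact ((Nat.prime_dvd_prime_iff_eq hq hq').mp (hq.dvd_of_dvd_pow hqd)).symm
  subst this
  have hpq : p ≠ q' := by
    rintro rfl
    have := Nat.dvd_gcd hpd hqd
    rw [hcop.gcd_eq_one] at this
    exact hp.one_lt.ne' (Nat.dvd_one.mp this)
  have hox : orderOf x = Nat.card N := by rw [← Nat.card_zpowers, gx, Subgroup.card_top]
  have hoh : orderOf h = Nat.card H := by rw [← Nat.card_zpowers, gh, Subgroup.card_top]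
  refine ⟨p, q', m, hp, hq', hpq, hm, ?_, hqm.symm, ?_⟩
  · -- the order of `N` is `p`
    have hwp : (φ h x * x⁻¹) ^ p = 1 := by
      let _ : CommGroup N := IsCyclic.commGroup
      rw [mul_pow, ← map_pow, hN1 p hp hpd, inv_pow, mul_inv_cancel]
    obtain ⟨n, hn⟩ : ∃ n, Nat.card N = p * n := hpd
    by_contra hne
    -- every prime divisor of `n` gives that `w` is fixed
    have hn1 : n ≠ 1 := by rintro rfl; exact hne (by simpa using hn)
    obtain ⟨r, hr, hrd⟩ := Nat.exists_prime_and_dvd hn1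
    obtain ⟨j, hj⟩ : φ h x * x⁻¹ ∈ Subgroup.zpowers x := gx ▸ Subgroup.mem_top _
    have hj' : x ^ j = φ h x * x⁻¹ := hj
    rw [← hj', ← zpow_natCast, ← zpow_mul, ← orderOf_dvd_iff_zpow_eq_one, hox, hn] at hwp
    have hnj : (n : ℤ) ∣ j := by
      push_cast at hwp
      rw [mul_comm] at hwp
      exact Int.dvd_of_mul_dvd_mul_right (by exact_mod_cast hp.ne_zero) hwp
    obtain ⟨i, hi⟩ : (r : ℤ) ∣ j := (Int.natCast_dvd_natCast.mpr hrd).trans hnj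
    have hw : x ^ j = (x ^ i) ^ r := by
      rw [hi, ← zpow_natCast, ← zpow_mul, mul_comm]
    have hwfix : ∀ k, φ k (x ^ j) = x ^ j := by
      intro k
      rw [hw]
      exact hN1 r hr (hrd.trans ⟨p, by rw [hn, mul_comm]⟩) k _
    have hpow : ∀ t : ℕ, φ (h ^ t) x = (x ^ j) ^ t * x := by
      intro t
      induction t with
      | zero => simp
      | succ t ih =>
        rw [pow_succ', map_mul, MulAut.mul_apply, ih, map_mul, map_pow, hwfix, pow_succ, mul_assoc,
          hj']
        simp
    have h1 : (x ^ j) ^ (Nat.card H) = 1 := by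
      have := hpow (Nat.card H)
      rw [pow_card_eq_one', map_one, MulAut.one_apply] at this
      exact right_eq_mul.mp this
    have h2 : (x ^ j) ^ (Nat.card N) = 1 := pow_card_eq_one'
    have h3 : x ^ j ∈ (⊥ : Subgroup N) := eq_of_pow_coprime ⊥ h2 h1 hcop
    rw [Subgroup.mem_bot, hj'] at h3
    exact hx (mul_inv_eq_one.mp h3)
  · have h1 : Nat.card φ.ker ∣ q' ^ m := hqm ▸ φ.ker.card_subgroup_dvd_card
    obtain ⟨k, hk, hk2⟩ := (Nat.dvd_prime_pow hq').mp h1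
    have h2 : k ≠ m := by
      rintro rfl
      have : φ.ker = ⊤ := Subgroup.eq_top_of_card_eq _ (by rw [hk2, hqm])
      exact hhk (this ▸ Subgroup.mem_top _)
    have h3 : Subgroup.zpowers (h ^ q') ≤ φ.ker := by
      rw [Subgroup.zpowers_le]; exact hH1 q' hq' hqd
    have h4 := Subgroup.card_dvd_of_le h3
    rw [Nat.card_zpowers, orderOf_pow, hoh, Nat.gcd_eq_right hqd, ← hqm, hk2] at h4
    have h5 : q' ^ m / q' = q' ^ (m - 1) := by
      conv_lhs => rw [← Nat.sub_add_cancel hm, pow_add, pow_one]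
      exact Nat.mul_div_cancel _ hq'.pos
    rw [h5] at h4
    have h6 := (Nat.pow_dvd_pow_iff_le_right hq'.one_lt).mp h4
    rw [hk2, show k = m - 1 by omega]

/-- Two maximal subgroups of a noncyclic `p`-group meet in a central subgroup of index `p ^ 2`. -/
lemma pgroup_struct {G : Type*} [Group G] [Finite G] {p : ℕ} [hp : Fact p.Prime]
    (hG : IsPGroup p G) (hL : ProperCyclic G) (hnc : ¬ IsCyclic G) :
    ∃ A Z : Subgroup G, IsCyclic A ∧ A.index = p ∧ Z ≤ A ∧ Z ≤ Subgroup.center G ∧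
      Z.index = p ^ 2 ∧ ∀ x : G, x ^ p ∈ Z := by
  have hcomm : ∀ A : Subgroup G, A ≠ ⊤ → ∀ x ∈ A, ∀ y ∈ A, x * y = y * x := by
    intro A hA x hx y hy
    have := hL A hA
    let _ : CommGroup A := IsCyclic.commGroup
    exact congrArg Subtype.val (mul_comm (⟨x, hx⟩ : A) ⟨y, hy⟩)
  have hnil : Group.IsNilpotent G := hG.isNilpotent
  have hnormal : ∀ A : Subgroup G, IsCoatom A → A.Normal :=
    fun A hA => Subgroup.NormalizerCondition.normal_of_coatom _ Group.normalizerCondition_of_isNilpotent hA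
  obtain ⟨n, hn⟩ := hG.exists_card_eq
  have hindex : ∀ A : Subgroup G, IsCoatom A → A.index = p := by
    intro A hA
    obtain ⟨k, hk, hk2⟩ := (Nat.dvd_prime_pow hp.1).mp (hn ▸ A.card_subgroup_dvd_card)
    have hkn : k ≠ n := by
      rintro rfl
      exact hA.1 (Subgroup.eq_top_of_card_eq _ (by rw [hk2, hn]))
    obtain ⟨K, hK, hAK⟩ := Sylow.exists_subgroup_card_pow_succ (p := p) (n := k) (H := A)
      (hn ▸ pow_dvd_pow _ (by omega)) hk2
    have hKt : K = ⊤ := by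
      apply hA.2 K
      refine lt_of_le_of_ne hAK ?_
      rintro rfl
      rw [hk2] at hK
      exact absurd (Nat.pow_right_injective hp.1.two_le hK) (by omega)
    rw [hKt, Subgroup.card_top] at hK
    have := A.card_mul_index
    rw [hK, hk2, pow_succ] at this
    exact Nat.eq_of_mul_eq_mul_left (pow_pos hp.1.pos _) this
  have hco : ∀ g : G, ∃ A : Subgroup G, IsCoatom A ∧ g ∈ A := by
    intro g
    have : Subgroup.zpowers g ≠ ⊤ := fun h =>
      hnc (isCyclic_iff_exists_zpowers_eq_top.mpr ⟨g, h⟩)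
    obtain h | ⟨A, hA, hg⟩ := eq_top_or_exists_le_coatom (Subgroup.zpowers g)
    · exact absurd h this
    · exact ⟨A, hA, hg (Subgroup.mem_zpowers g)⟩
  obtain ⟨A, hA, -⟩ := hco 1
  obtain ⟨b, -, hb⟩ := SetLike.exists_of_lt (lt_top_iff_ne_top.mpr hA.1)
  obtain ⟨B, hB, hbB⟩ := hco b
  have hAB : A ≠ B := by rintro rfl; exact hb hbB
  have hsup : A ⊔ B = ⊤ := hA.sup_eq_top_of_ne hB hAB
  have nA := hnormal A hA
  have nB := hnormal B hB
  refine ⟨A, A ⊓ B, hL A hA.1, hindex A hA, inf_le_left, ?_, ?_, ?_⟩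
  · rintro z ⟨hzA, hzB⟩
    have : A ⊔ B ≤ Subgroup.centralizer {z} := by
      refine sup_le ?_ ?_
      · intro a ha
        rw [Subgroup.mem_centralizer_singleton_iff]
        exact hcomm A hA.1 _ ha _ hzA
      · intro a ha
        rw [Subgroup.mem_centralizer_singleton_iff]
        exact hcomm B hB.1 _ ha _ hzB
    rw [hsup] at this
    rw [Subgroup.mem_center_iff]
    intro g
    exact Subgroup.mem_centralizer_singleton_iff.mp (this (Subgroup.mem_top g))
  · rw [← Subgroup.relIndex_mul_index (inf_le_right : A ⊓ B ≤ B), Subgroup.inf_relIndex_right,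
      ← Subgroup.relIndex_sup_left, hsup, Subgroup.relIndex_top_right, hindex A hA, hindex B hB, sq]
  · intro x
    exact ⟨by simpa [hindex A hA] using A.pow_index_mem x,
      by simpa [hindex B hB] using B.pow_index_mem x⟩

lemma mul_pow_central {G : Type*} [Group G] {x y c : G} (hc : ∀ g, c * g = g * c)
    (hxy : y * x = c * (x * y)) (n : ℕ) :
    y * x ^ n = c ^ n * (x ^ n * y) := by
  have hcn : ∀ n : ℕ, ∀ g, c ^ n * g = g * c ^ n := fun n g => (Commute.pow_left (hc g) n)
  induction n with
  | zero => simp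
  | succ n ih =>
    calc y * x ^ (n + 1) = (y * x ^ n) * x := by rw [pow_succ, mul_assoc]
      _ = c ^ n * (x ^ n * (y * x)) := by rw [ih]; simp only [mul_assoc]
      _ = c ^ n * (x ^ n * c * (x * y)) := by rw [hxy]; simp only [mul_assoc]
      _ = c ^ n * (c * x ^ n * (x * y)) := by rw [hc]
      _ = c ^ (n + 1) * (x ^ (n + 1) * y) := by simp only [pow_succ, mul_assoc]

lemma mul_pow_central2 {G : Type*} [Group G] {x y c : G} (hc : ∀ g, c * g = g * c)
    (hxy : y * x = c * (x * y)) (n : ℕ) :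
    (x * y) ^ n = c ^ (n.choose 2) * (x ^ n * y ^ n) := by
  have hcn : ∀ n : ℕ, ∀ g, c ^ n * g = g * c ^ n := fun n g => (Commute.pow_left (hc g) n)
  induction n with
  | zero => simp
  | succ n ih =>
    have h2 : y * x ^ n = c ^ n * (x ^ n * y) := mul_pow_central hc hxy n
    have h3 : (n + 1).choose 2 = n.choose 2 + n := by
      rw [Nat.choose_succ_succ' n 1, Nat.choose_one_right, add_comm]
    calc (x * y) ^ (n + 1) = x * y * (x * y) ^ n := pow_succ' _ _
      _ = x * y * c ^ (n.choose 2) * (x ^ n * y ^ n) := by rw [ih]; simp only [mul_assoc]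
      _ = c ^ (n.choose 2) * (x * y) * (x ^ n * y ^ n) := by rw [hcn]
      _ = c ^ (n.choose 2) * (x * (y * x ^ n) * y ^ n) := by simp only [mul_assoc]
      _ = c ^ (n.choose 2) * ((x * c ^ n) * (x ^ n * y) * y ^ n) := by
        rw [h2]; simp only [mul_assoc]
      _ = c ^ (n.choose 2) * ((c ^ n * x) * (x ^ n * y) * y ^ n) := by rw [hcn n x]
      _ = c ^ (n.choose 2) * c ^ n * (x * x ^ n * (y * y ^ n)) := by simp only [mul_assoc]
      _ = _ := by rw [← pow_add, ← h3, ← pow_succ', ← pow_succ']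

lemma not_cyclic_of_exp {G : Type*} [Group G] (K : Subgroup G) {n : ℕ} (hn : 0 < n)
    (hK : ∀ x ∈ K, x ^ n = 1) (hcard : n < Nat.card K) : ¬ IsCyclic K := by
  intro h
  obtain ⟨g, hg⟩ := (Subgroup.isCyclic_iff_exists_zpowers_eq_top _).mp h
  have h1 : orderOf g = Nat.card K := by rw [← Nat.card_zpowers, hg]
  have h2 : g ^ n = 1 := hK g (hg ▸ Subgroup.mem_zpowers g)
  have := orderOf_le_of_pow_eq_one hn h2
  omega

lemma elementary_equiv {G : Type*} [Group G] [Finite G] {p : ℕ} [hp : Fact p.Prime]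
    (hcard : Nat.card G = p ^ 2) (hexp : ∀ x : G, x ^ p = 1) :
    Nonempty (G ≃* Multiplicative (ZMod p × ZMod p)) := by
  let _ : CommGroup G := { (inferInstance : Group G) with
    mul_comm := IsPGroup.commutative_of_card_eq_prime_sq hcard }
  let _ : Module (ZMod p) (Additive G) := AddCommGroup.zmodModule (n := p) (fun x => hexp x.toMul)
  have h1 : Module.finrank (ZMod p) (Additive G) = 2 := by
    have := Module.natCard_eq_pow_finrank (K := ZMod p) (V := Additive G)
    rw [Nat.card_zmod, Nat.card_congr Additive.toMul, hcard] at this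
    exact (Nat.pow_right_injective hp.1.two_le this).symm
  have h2 : Module.finrank (ZMod p) (ZMod p × ZMod p) = 2 := by simp
  have e : Additive G ≃ₗ[ZMod p] (ZMod p × ZMod p) := LinearEquiv.ofFinrankEq _ _ (h1.trans h2.symm)
  exact ⟨AddEquiv.toMultiplicativeRight e.toAddEquiv⟩

lemma case_powhom {G : Type*} [Group G] [Finite G] {p : ℕ} [hp : Fact p.Prime]
    (hL : ProperCyclic G) {A Z : Subgroup G} (hA : IsCyclic A)
    (hAi : A.index = p) (hZi : Z.index = p ^ 2) (hZ : ∀ x : G, x ^ p ∈ Z)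
    (hmul : ∀ x y : G, (x * y) ^ p = x ^ p * y ^ p) :
    Nonempty (G ≃* Multiplicative (ZMod p × ZMod p)) := by
  let f : G →* G := { toFun := fun x => x ^ p, map_one' := one_pow p, map_mul' := hmul }
  have hr : f.range ≤ Z := by rintro _ ⟨x, rfl⟩; exact hZ x
  have h1 : p ^ 2 ≤ Nat.card f.ker := by
    have e1 := f.ker.card_mul_index
    rw [Subgroup.index_ker] at e1
    have e2 := Z.card_mul_index
    rw [hZi] at e2
    have e3 : Nat.card f.range ≤ Nat.card Z := Subgroup.card_le_of_le hr
    have e4 : 0 < Nat.card Z := Nat.card_pos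
    by_contra hc
    push Not at hc
    have : Nat.card f.ker * Nat.card f.range < p ^ 2 * Nat.card Z :=
      calc _ ≤ Nat.card f.ker * Nat.card Z := Nat.mul_le_mul_left _ e3
        _ < _ := Nat.mul_lt_mul_of_pos_right hc e4
    rw [e1, ← e2, mul_comm] at this
    exact lt_irrefl _ this
  have hpp : p < p ^ 2 := by have := hp.1.two_le; nlinarith
  have hk : f.ker = ⊤ := by
    by_contra hc
    exact not_cyclic_of_exp f.ker hp.1.pos (fun x hx => hx) (by omega) (hL _ hc)
  have hexp : ∀ x : G, x ^ p = 1 := fun x => by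
    have : x ∈ f.ker := hk ▸ Subgroup.mem_top x
    exact this
  rw [hk, Subgroup.card_top] at h1
  have hAc : Nat.card A ≤ p := by
    by_contra hc
    exact not_cyclic_of_exp A hp.1.pos (fun x _ => hexp x) (by omega) hA
  apply elementary_equiv _ hexp
  apply le_antisymm _ h1
  rw [← A.card_mul_index, hAi, sq]
  exact Nat.mul_le_mul_right _ hAc

lemma q8_equiv {G : Type*} [Group G] [Finite G] (hcard : Nat.card G = 8) {x y z : G}
    (hgen : Subgroup.closure ({x, y} : Set G) = ⊤) (hz : ∀ g, z * g = g * z) (hz2 : z ^ 2 = 1)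
    (hx : x ^ 2 = z) (hy : y ^ 2 = z) (hxy : (x * y) ^ 2 = z) :
    Nonempty (G ≃* QuaternionGroup 2) := by
  have hx4 : x ^ 4 = 1 := by rw [show 4 = 2 * 2 from rfl, pow_mul, hx, hz2]
  have hrel : x * y = y * x⁻¹ := by
    have h1 : x * y * x * y = y * y := by
      rw [← sq y, hy, ← hxy, sq]; simp only [mul_assoc]
    have h2 := mul_right_cancel h1
    rw [eq_mul_inv_iff_mul_eq]; exact h2
  let e0 : ℤ →+ Additive G := zmultiplesHom (Additive G) (Additive.ofMul x)
  let e1 : ZMod (2 * 2) →+ Additive G := ZMod.lift (2 * 2) ⟨e0, by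
    change (2 * 2 : ℤ) • Additive.ofMul x = 0
    rw [← ofMul_zpow]
    have : x ^ (2 * 2 : ℤ) = 1 := by exact_mod_cast hx4
    rw [this]; rfl⟩
  let e : ZMod (2 * 2) → G := fun i => (e1 i).toMul
  have ecast : ∀ k : ℤ, e (k : ZMod (2 * 2)) = x ^ k := by
    intro k
    simp only [e, e1, ZMod.lift_coe]
    rfl
  have eadd : ∀ i j, e (i + j) = e i * e j := by
    intro i j
    simp [e]
  have hconj : ∀ i, e i * y = y * e (-i) := by
    intro i
    obtain ⟨k, rfl⟩ := ZMod.intCast_surjective i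
    rw [← Int.cast_neg, ecast, ecast]
    have h1 : x = y * x⁻¹ * y⁻¹ := by rw [← hrel]; simp
    have h2 : x ^ k = y * (x⁻¹) ^ k * y⁻¹ := by
      conv_lhs => rw [h1]
      exact conj_zpow
    rw [h2]; simp
  have e2 : e 2 = y * y := by
    have := ecast 2
    have h3 : y * y = x ^ (2 : ℤ) := by
      rw [← sq y, hy, ← hx]; norm_cast
    rw [h3]
    exact this
  let F : QuaternionGroup 2 →* G := MonoidHom.mk'
    (fun g => match g with
      | .a i => e i
      | .xa i => y * e i) (by
    rintro (i | i) (j | j)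
    · simp only [QuaternionGroup.a_mul_a]
      exact eadd i j
    · simp only [QuaternionGroup.a_mul_xa]
      rw [← mul_assoc, hconj, mul_assoc, ← eadd, neg_add_eq_sub]
    · simp only [QuaternionGroup.xa_mul_a]
      rw [eadd, mul_assoc]
    · simp only [QuaternionGroup.xa_mul_xa]
      rw [mul_assoc, ← mul_assoc (e i), hconj, mul_assoc, ← eadd, ← mul_assoc, ← e2, ← eadd]
      congr 1
      push_cast
      ring)
  have hsur : Function.Surjective F := by
    rw [← MonoidHom.range_eq_top, eq_top_iff, ← hgen, Subgroup.closure_le]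
    rintro g (rfl | rfl)
    · refine ⟨.a 1, ?_⟩
      change e 1 = g
      have := ecast 1
      simpa using this
    · refine ⟨.xa 0, ?_⟩
      change g * e 0 = g
      have := ecast 0
      simp at this
      simp [this]
  have hbij : Function.Bijective F := by
    rw [Nat.bijective_iff_surjective_and_card]
    refine ⟨hsur, ?_⟩
    rw [hcard, Nat.card_eq_fintype_card, QuaternionGroup.card]
  exact ⟨(MulEquiv.ofBijective F hbij).symm⟩

lemma closure_pair_eq_top {G : Type*} [Group G] (hL : ProperCyclic G) {x y : G}
    (h : x * y ≠ y * x) : Subgroup.closure ({x, y} : Set G) = ⊤ := by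
  by_contra hc
  have := hL _ hc
  let _ : CommGroup (Subgroup.closure ({x, y} : Set G)) := IsCyclic.commGroup
  have hx : x ∈ Subgroup.closure ({x, y} : Set G) := Subgroup.subset_closure (by simp)
  have hy : y ∈ Subgroup.closure ({x, y} : Set G) := Subgroup.subset_closure (by simp)
  exact h (congrArg Subtype.val (mul_comm (⟨x, hx⟩ : Subgroup.closure ({x, y} : Set G)) ⟨y, hy⟩))

lemma case_two {G : Type*} [Group G] [Finite G] (hG : IsPGroup 2 G)
    (hL : ProperCyclic G) {A Z : Subgroup G} (hA : IsCyclic A) (hAi : A.index = 2)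
    (hZc : Z ≤ Subgroup.center G) (hZi : Z.index = 2 ^ 2) (hZ : ∀ x : G, x ^ 2 ∈ Z)
    (hmul : ∀ x y : G, (x * y) ^ 4 = x ^ 4 * y ^ 4) {x y : G} (hxy : x * y ≠ y * x) :
    Nonempty (G ≃* QuaternionGroup 2) := by
  have := Fact.mk Nat.prime_two
  have hZcard := Z.card_mul_index
  rw [hZi] at hZcard
  have hZne : Nat.card Z ≠ 1 := by
    intro h1
    rw [h1, one_mul] at hZcard
    exact hxy (IsPGroup.commutative_of_card_eq_prime_sq hZcard.symm x y)
  have hZ2 : 2 ∣ Nat.card Z := by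
    obtain ⟨k, hk⟩ := (hG.to_subgroup Z).exists_card_eq
    rw [hk]
    apply dvd_pow_self
    rintro rfl
    exact hZne (by simpa using hk)
  obtain ⟨z, hz⟩ := exists_prime_orderOf_dvd_card' 2 hZ2
  let f : G →* G := { toFun := fun x => x ^ 4, map_one' := one_pow 4, map_mul' := hmul }
  have hr : f.range < Z := by
    refine lt_of_le_of_ne ?_ ?_
    · rintro _ ⟨g, rfl⟩
      change g ^ 4 ∈ Z
      rw [show 4 = 2 * 2 from rfl, pow_mul]; exact hZ _
    · intro heq
      let s : Z → Z := fun u => u ^ 2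
      have hs : Function.Surjective s := by
        intro u
        obtain ⟨g, hg⟩ : (u : G) ∈ f.range := heq ▸ u.2
        refine ⟨⟨g ^ 2, hZ g⟩, ?_⟩
        ext
        rw [← hg]
        change (g ^ 2) ^ 2 = g ^ 4
        rw [← pow_mul]
      have hi := Finite.injective_iff_surjective.mpr hs
      have h1 : z = 1 := hi (by
        change z ^ 2 = 1 ^ 2
        rw [one_pow, ← hz, pow_orderOf_eq_one])
      rw [h1, orderOf_one] at hz
      omega
  have hrc : 2 * Nat.card f.range ≤ Nat.card Z := by
    obtain ⟨t, ht⟩ := Subgroup.card_dvd_of_le hr.le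
    have h1 : t ≠ 1 := by
      rintro rfl
      exact hr.ne (Subgroup.eq_of_le_of_card_ge hr.le (by omega))
    have h2 : t ≠ 0 := by
      rintro rfl
      have := Nat.card_pos (α := Z)
      omega
    have : 2 ≤ t := by omega
    rw [ht, mul_comm]
    exact Nat.mul_le_mul_left _ this
  have e1 := f.ker.card_mul_index
  rw [Subgroup.index_ker] at e1
  have hpos : 0 < Nat.card f.range := Nat.card_pos
  have h8 : 8 ≤ Nat.card f.ker := by
    by_contra hc
    push Not at hc
    nlinarith
  have hk : f.ker = ⊤ := by
    by_contra hc
    exact not_cyclic_of_exp f.ker (n := 4) (by norm_num) (fun x hx => hx) (by omega) (hL _ hc)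
  have hexp : ∀ x : G, x ^ 4 = 1 := fun x => by
    have : x ∈ f.ker := hk ▸ Subgroup.mem_top x
    exact this
  have hAc : Nat.card A ≤ 4 := by
    by_contra hc
    exact not_cyclic_of_exp A (n := 4) (by norm_num) (fun x _ => hexp x) (by omega) hA
  rw [hk, Subgroup.card_top] at h8
  have hcard : Nat.card G = 8 := by
    have := A.card_mul_index
    rw [hAi] at this
    omega
  have hZc2 : Nat.card Z = 2 := by omega
  have hZel : ∀ u ∈ Z, u = 1 ∨ u = z := by
    intro u hu
    by_cases hu1 : u = 1
    · exact Or.inl hu1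
    · right
      obtain ⟨w, -, hw⟩ := (Nat.card_eq_two_iff' (1 : Z)).mp hZc2
      have h1 : (⟨u, hu⟩ : Z) = w := hw _ (fun h => hu1 (congrArg Subtype.val h))
      have h2 : z = w := hw _ (fun h => by
        rw [h, orderOf_one] at hz
        omega)
      exact congrArg Subtype.val (h1.trans h2.symm)
  have hzc : ∀ g, (z : G) * g = g * z := fun g => ((Subgroup.mem_center_iff.mp (hZc z.2)) g).symm
  have hz2 : (z : G) ^ 2 = 1 := by
    have : z ^ 2 = 1 := by rw [← hz, pow_orderOf_eq_one]
    exact_mod_cast congrArg Subtype.val this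
  have hz1 : (z : G) ≠ 1 := by
    intro h
    have : z = 1 := Subtype.ext h
    rw [this, orderOf_one] at hz
    omega
  have hsq : ∀ u : G, u ∉ Z → u ^ 2 = z := by
    intro u hu
    rcases hZel _ (hZ u) with h | h
    · exfalso
      let C := Subgroup.closure ({u, (z : G)} : Set G)
      have huC : u ∈ C := Subgroup.subset_closure (by simp)
      have hzC : (z : G) ∈ C := Subgroup.subset_closure (by simp)
      have hcom : ∀ a ∈ C, ∀ b ∈ C, a * b = b * a := by
        have : IsMulCommutative C := Subgroup.isMulCommutative_closure (by
          rintro a (rfl | rfl) b (rfl | rfl)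
          · rfl
          · exact (hzc a).symm
          · exact hzc b
          · rfl)
        intro a ha b hb
        exact setLike_mul_comm ha hb
      have hCt : C ≠ ⊤ := by
        intro hC
        exact hxy (hcom x (hC ▸ Subgroup.mem_top _) y (hC ▸ Subgroup.mem_top _))
      have hCsq : ∀ a ∈ C, a ^ 2 = 1 := by
        intro a ha
        induction ha using Subgroup.closure_induction with
        | mem a ha =>
          rcases ha with rfl | rfl
          · exact h
          · exact hz2
        | one => simp
        | mul a b ha hb h1 h2 =>
          have : Commute a b := hcom a ha b hb
          rw [this.mul_pow, h1, h2, one_mul]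
        | inv a ha h1 => rw [inv_pow, h1, inv_one]
      have hu1 : u ≠ 1 := fun h => hu (h ▸ Z.one_mem)
      have huz : u ≠ z := fun h => hu (h ▸ z.2)
      refine not_cyclic_of_exp C (n := 2) (by norm_num) hCsq ?_ (hL C hCt)
      classical
      have h3 : (((({1, u, (z : G)} : Finset G)) : Set G)).ncard ≤ (C : Set G).ncard := by
        apply Set.ncard_le_ncard _ (Set.toFinite _)
        intro a ha
        simp at ha
        rcases ha with rfl | rfl | rfl
        · exact C.one_mem
        · exact huC
        · exact hzC
      rw [Set.ncard_coe_finset, Finset.card_eq_three.mpr ⟨1, u, z, hu1.symm, hz1.symm, huz, rfl⟩] at h3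
      have h4 : (C : Set G).ncard = Nat.card C := rfl
      omega
    · exact h
  have hcen : ∀ u ∈ Z, ∀ g, u * g = g * u := fun u hu g =>
    ((Subgroup.mem_center_iff.mp (hZc hu)) g).symm
  refine q8_equiv hcard (closure_pair_eq_top hL hxy) hzc hz2 (hsq x ?_) (hsq y ?_) (hsq _ ?_)
  · intro hc
    exact hxy (hcen x hc y)
  · intro hc
    exact hxy (hcen y hc x).symm
  · intro hc
    have := hcen _ hc x
    rw [mul_assoc] at this
    exact hxy (mul_left_cancel this).symm

lemma pgroup_classify {G : Type*} [Group G] [Finite G] {p : ℕ} [hp : Fact p.Prime]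
    (hG : IsPGroup p G) (hL : ProperCyclic G) (hnc : ¬ IsCyclic G) :
    Nonempty (G ≃* Multiplicative (ZMod p × ZMod p)) ∨ Nonempty (G ≃* QuaternionGroup 2) := by
  obtain ⟨A, Z, hA, hAi, -, hZc, hZi, hZ⟩ := pgroup_struct hG hL hnc
  have hcen : ∀ u ∈ Z, ∀ g, u * g = g * u := fun u hu g =>
    ((Subgroup.mem_center_iff.mp (hZc hu)) g).symm
  have hn : Z.Normal := ⟨fun u hu g => by rw [← hcen u hu, mul_inv_cancel_right]; exact hu⟩
  have hcomm : ∀ x y : G, ∃ c, (∀ g, c * g = g * c) ∧ y * x = c * (x * y) ∧ c ^ p = 1 := by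
    intro x y
    have h1 : (y * x) * (x * y)⁻¹ ∈ Z := by
      rw [← QuotientGroup.eq_one_iff]
      have := IsPGroup.commutative_of_card_eq_prime_sq (p := p) (G := G ⧸ Z) hZi
      simp only [QuotientGroup.mk_mul, QuotientGroup.mk_inv]
      rw [this (y : G ⧸ Z) x, mul_inv_cancel]
    have h2 : y * x = (y * x) * (x * y)⁻¹ * (x * y) := (inv_mul_cancel_right _ _).symm
    refine ⟨_, hcen _ h1, h2, ?_⟩
    have h3 := mul_pow_central (hcen _ h1) h2 p
    rw [← hcen _ (hZ x)] at h3
    exact right_eq_mul.mp h3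
  by_cases hodd : p = 2
  · subst hodd
    by_cases hab : ∀ x y : G, x * y = y * x
    · left
      exact case_powhom hL hA hAi hZi hZ (fun x y => Commute.mul_pow (hab x y) 2)
    · right
      push Not at hab
      obtain ⟨x, y, hxy⟩ := hab
      refine case_two hG hL hA hAi hZc hZi hZ (fun x y => ?_) hxy
      obtain ⟨c, hc, h1, h2⟩ := hcomm x y
      rw [mul_pow_central2 hc h1, show Nat.choose 4 2 = 2 * 3 from rfl, pow_mul, h2, one_pow, one_mul]
  · left
    refine case_powhom hL hA hAi hZi hZ (fun x y => ?_)
    obtain ⟨c, hc, h1, h2⟩ := hcomm x y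
    obtain ⟨k, hk⟩ : p ∣ p.choose 2 := hp.1.dvd_choose_self (by norm_num)
      (lt_of_le_of_ne hp.1.two_le (Ne.symm hodd))
    rw [mul_pow_central2 hc h1, hk, pow_mul, h2, one_pow, one_mul]

/-- A finite group `G` with `d(G) = 2` satisfies the rank-independence
property iff `G ≅ C_p × C_p` for a prime `p`, or `G ≅ Q₈`, or `G ≅ C_p ⋊ C_{q^m}` for
distinct primes `p, q` and `m ≥ 1`, with the kernel of the action being the subgroup of
order `q^(m-1)`. -/
theorem stmt_0 (G : Type*) [Group G] [Finite G] (hd : minGen G = 2) :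
    RankIndependenceProperty G ↔
      (∃ p : ℕ, p.Prime ∧ Nonempty (G ≃* Multiplicative (ZMod p × ZMod p))) ∨
      Nonempty (G ≃* QuaternionGroup 2) ∨
      (∃ (p q m : ℕ) (φ : Multiplicative (ZMod (q ^ m)) →* MulAut (Multiplicative (ZMod p))),
        p.Prime ∧ q.Prime ∧ p ≠ q ∧ 0 < m ∧
        Nat.card φ.ker = q ^ (m - 1) ∧
        Nonempty (G ≃* SemidirectProduct (Multiplicative (ZMod p))
          (Multiplicative (ZMod (q ^ m))) φ)) := by
  have hnc := not_cyclic_of_minGen hd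
  rw [rip_iff hd]
  constructor
  · intro hL
    by_cases hZ : IsZGroup G
    · right; right
      obtain ⟨N, H, φ, e, hH, hN, hcop⟩ := isZGroup_iff_exists_mulEquiv.mp hZ
      have hL' := hL.of_equiv e.symm
      have hnc' : ¬ IsCyclic (SemidirectProduct N H φ) := fun h => hnc (e.isCyclic.mpr h)
      obtain ⟨p, q, m, hp, hq, hpq, hm, hNc, hHc, hk⟩ := semi_classify φ hcop hL' hnc'
      subst hNc
      let eN : N ≃* Multiplicative (ZMod (Nat.card N)) := (zmodCyclicMulEquiv hN).symm
      let eH : H ≃* Multiplicative (ZMod (q ^ m)) := hHc ▸ (zmodCyclicMulEquiv hH).symm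
      refine ⟨Nat.card N, q, m,
        MonoidHom.comp (MulAut.congr eN).toMonoidHom (φ.comp eH.symm.toMonoidHom),
        hp, hq, hpq, hm, ?_, ⟨e.trans (SemidirectProduct.congr' eN eH)⟩⟩
      rw [← hk]
      refine Nat.card_congr ((eH.symm.toEquiv).subtypeEquiv fun x => ?_)
      rw [MonoidHom.mem_ker, MonoidHom.mem_ker]
      change MulAut.congr eN (φ (eH.symm x)) = 1 ↔ φ (eH.symm x) = 1
      exact EmbeddingLike.map_eq_one_iff
    · rw [isZGroup_iff] at hZ
      push Not at hZ
      obtain ⟨p, hp, P, hP⟩ := hZ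
      have := Fact.mk hp
      have hPt : (P : Subgroup G) = ⊤ := by
        by_contra hc
        exact hP (hL _ hc)
      have hG : IsPGroup p G := by
        have := P.2
        rw [hPt] at this
        exact this.of_equiv Subgroup.topEquiv
      rcases pgroup_classify hG hL hnc with h | h
      · exact Or.inl ⟨p, hp, h⟩
      · exact Or.inr (Or.inl h)
  · rintro (⟨p, hp, ⟨e⟩⟩ | ⟨⟨e⟩⟩ | ⟨p, q, m, φ, hp, hq, hpq, hm, hk, ⟨e⟩⟩)
    · exact (properCyclic_CpCp hp).of_equiv e
    · exact properCyclic_Q8.of_equiv e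
    · exact (properCyclic_semi φ hp hq hpq hm 
        (by rw [Nat.card_congr Multiplicative.toAdd, Nat.card_zmod])
        (by rw [Nat.card_congr Multiplicative.toAdd, Nat.card_zmod]) hk).of_equiv e
end

section
/- Let G be a finite group satisfying the independence property. Then the Frattini subgroup Frat(G) is non-trivial if and only if either G is a cyclic group of order p^n for some prime p and some integer n ≥ 2, or G is isomorphic to the quaternion group Q_8 of order 8. -/
/-- A generating set `X` for a group is *minimal* if no proper subset of `X`
generates the group. -/
def IsMinimalGenSet {G : Type*} [Group G] (X : Set G) : Prop :=
  Subgroup.closure X = ⊤ ∧ ∀ Y : Set G, Y ⊂ X → Subgroup.closure Y ≠ ⊤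

/-- Two distinct elements `x` and `y` are *independent* if some minimal generating set
contains both of them. -/
def Independent {G : Type*} [Group G] (x y : G) : Prop :=
  x ≠ y ∧ ∃ X : Set G, IsMinimalGenSet X ∧ x ∈ X ∧ y ∈ X

/-- A group satisfies the *independence property* if any two distinct elements are either
independent or one is a power of the other. -/
def IndependenceProperty (G : Type*) [Group G] : Prop :=
  ∀ x y : G, x ≠ y →
    (Independent x y ∨ x ∈ Subgroup.zpowers y ∨ y ∈ Subgroup.zpowers x)

open Subgroup in
/-- The quotient of a finite `p`-group by a maximal subgroup has order `p`. -/
lemma aux_coatom {G : Type*} [Group G] [Finite G] {p : ℕ} [Fact p.Prime] (hG : IsPGroup p G)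
    {M : Subgroup G} (hM : IsCoatom M) :
    (∀ g : G, g ^ p ∈ M) ∧ (∀ g h : G, h⁻¹ * g⁻¹ * h * g ∈ M) := by
  have hnil : Group.IsNilpotent G := hG.isNilpotent
  have hN : M.Normal := Subgroup.NormalizerCondition.normal_of_coatom M
    (Group.normalizerCondition_of_isNilpotent) hM
  have hQ : IsPGroup p (G ⧸ M) := hG.to_quotient M
  have hnt : Nontrivial (G ⧸ M) := QuotientGroup.nontrivial_iff.mpr hM.1
  have hdvd : p ∣ Nat.card (G ⧸ M) := by
    rcases hQ.card_eq_or_dvd with h1 | h1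
    · have := Finite.one_lt_card_iff_nontrivial.mpr hnt
      omega
    · exact h1
  obtain ⟨y, hy⟩ := exists_prime_orderOf_dvd_card' p hdvd
  obtain ⟨y, rfl⟩ := QuotientGroup.mk_surjective y
  have htop : M ⊔ zpowers y = ⊤ := by
    apply hM.2
    refine lt_of_le_of_ne le_sup_left ?_
    intro heq
    have hyM : y ∈ M := by
      rw [heq]
      exact (le_sup_right : zpowers y ≤ _) (mem_zpowers y)
    have : (y : G ⧸ M) = 1 := (QuotientGroup.eq_one_iff y).mpr hyM
    rw [this, orderOf_one] at hy
    exact (Fact.out : p.Prime).one_lt.ne hy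
  have key : ∀ g : G, ∃ k : ℤ, (g : G ⧸ M) = (y : G ⧸ M) ^ k := by
    intro g
    have hg : g ∈ M ⊔ zpowers y := htop ▸ mem_top g
    obtain ⟨m, hm, w, ⟨k, rfl⟩, rfl⟩ := mem_sup_of_normal_left.mp hg
    refine ⟨k, ?_⟩
    have : (m : G ⧸ M) = 1 := (QuotientGroup.eq_one_iff m).mpr hm
    simp [this]
  have hyp : (y : G ⧸ M) ^ p = 1 := by rw [← hy]; exact pow_orderOf_eq_one _
  constructor
  · intro g
    obtain ⟨k, hk⟩ := key g
    rw [← QuotientGroup.eq_one_iff]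
    rw [QuotientGroup.mk_pow, hk, ← zpow_natCast, ← zpow_mul, mul_comm, zpow_mul, zpow_natCast, hyp,
      one_zpow]
  · intro g h
    obtain ⟨k, hk⟩ := key g
    obtain ⟨l, hl⟩ := key h
    rw [← QuotientGroup.eq_one_iff]
    simp only [QuotientGroup.mk_mul, QuotientGroup.mk_inv, hk, hl]
    rw [← zpow_neg, ← zpow_neg, ← zpow_add, ← zpow_add, ← zpow_add]
    convert zpow_zero _ using 2
    ring

lemma aux_mem_frattini {G : Type*} [Group G] {x : G}
    (h : ∀ M : Subgroup G, IsCoatom M → x ∈ M) : x ∈ frattini G := by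
  simp only [frattini, Order.radical, Subgroup.mem_iInf]
  exact h

lemma aux_frattini {G : Type*} [Group G] [Finite G] {p : ℕ} [Fact p.Prime] (hG : IsPGroup p G) :
    (∀ g : G, g ^ p ∈ frattini G) ∧ (∀ g h : G, h⁻¹ * g⁻¹ * h * g ∈ frattini G) :=
  ⟨fun g => aux_mem_frattini fun _ hM => (aux_coatom hG hM).1 g,
   fun g h => aux_mem_frattini fun _ hM => (aux_coatom hG hM).2 g h⟩

/-- Elements of the Frattini subgroup lie in no minimal generating set. -/
lemma aux_not_minimal {G : Type*} [Group G] [Finite G] {z : G} (hz : z ∈ frattini G)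
    {X : Set G} (hX : IsMinimalGenSet X) : z ∉ X := by
  intro hzX
  apply hX.2 (X \ {z})
  · exact ⟨Set.sdiff_subset, fun hh => (hh hzX).2 rfl⟩
  · apply frattini_nongenerating
    rw [eq_top_iff, ← hX.1, Subgroup.closure_le]
    intro w hw
    by_cases hwz : w = z
    · subst hwz
      exact (le_sup_right : frattini G ≤ _) hz
    · exact (le_sup_left : Subgroup.closure (X \ {z}) ≤ _)
        (Subgroup.subset_closure ⟨hw, hwz⟩)

lemma aux_comm_pow {G : Type*} [Group G] {x h c : G} (hc : h * x = x * h * c)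
    (hcen : ∀ g, c * g = g * c) (n : ℕ) : h ^ n * x = x * h ^ n * c ^ n := by
  induction n with
  | zero => simp
  | succ n ih =>
    have hcn : ∀ g, c ^ n * g = g * c ^ n := fun g => ((show Commute c g from hcen g).pow_left n).eq
    calc h ^ (n + 1) * x = h * (h ^ n * x) := by rw [pow_succ']; group
      _ = (h * x) * h ^ n * c ^ n := by rw [ih]; simp only [mul_assoc]
      _ = x * h * (c * h ^ n) * c ^ n := by rw [hc]; simp only [mul_assoc]
      _ = x * h ^ (n + 1) * c ^ (n + 1) := by
        rw [hcen, pow_succ' h, pow_succ' c]; simp only [mul_assoc]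

lemma aux_mul_pow {G : Type*} [Group G] {x h c : G} (hc : h * x = x * h * c)
    (hcen : ∀ g, c * g = g * c) (n : ℕ) :
    (x * h) ^ n = x ^ n * h ^ n * c ^ (n.choose 2) := by
  induction n with
  | zero => simp
  | succ n ih =>
    have hcn : ∀ m g, c ^ m * g = g * c ^ m :=
      fun m g => ((show Commute c g from hcen g).pow_left m).eq
    have hch : (n + 1).choose 2 = n + n.choose 2 := by
      rw [Nat.choose_succ_succ' n 1, Nat.choose_one_right]
    calc (x * h) ^ (n + 1) = x ^ n * h ^ n * (c ^ (n.choose 2) * (x * h)) := by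
          rw [pow_succ, ih]; simp only [mul_assoc]
      _ = x ^ n * (h ^ n * x) * h * c ^ (n.choose 2) := by rw [hcn]; simp only [mul_assoc]
      _ = x ^ n * x * h ^ n * (c ^ n * h) * c ^ (n.choose 2) := by
          rw [aux_comm_pow hc hcen]; simp only [mul_assoc]
      _ = _ := by rw [hcn, hch, pow_add c, pow_succ x n, pow_succ h n]; simp only [mul_assoc]

/-- Recognition of the quaternion group. -/
lemma aux_quat {G : Type*} [Group G] {g h : G} (hg4 : orderOf g = 4) (hh2 : h ^ 2 = g ^ 2)
    (hgh : g * h = h * g⁻¹) (hnot : h ∉ Subgroup.zpowers g)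
    (hall : ∀ k : G, k ∈ Subgroup.zpowers g ∨ h⁻¹ * k ∈ Subgroup.zpowers g) :
    Nonempty (G ≃* QuaternionGroup 2) := by
  have key : ∀ (i : ZMod (2 * 2)) (k : ℤ), (k : ZMod (2 * 2)) = i → g ^ i.val = g ^ k := by
    intro i k hk
    rw [← zpow_natCast, zpow_eq_zpow_iff_modEq, hg4]
    have : ((i.val : ℤ) : ZMod 4) = (k : ZMod 4) := by
      rw [Int.cast_natCast]
      exact (ZMod.natCast_zmod_val (n := 4) i).trans hk.symm
    exact (ZMod.intCast_eq_intCast_iff _ _ 4).mp this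
  have hval : ∀ i : ZMod (2 * 2), (((i.val : ℕ) : ℤ) : ZMod (2 * 2)) = i := by
    intro i
    rw [Int.cast_natCast]
    exact ZMod.natCast_zmod_val (n := 4) i
  have hconj : ∀ k : ℤ, g ^ k * h = h * g ^ (-k) := by
    intro k
    have : SemiconjBy h g⁻¹ g := hgh.symm
    have := this.zpow_right k
    rw [zpow_neg, ← inv_zpow]
    exact this.eq.symm
  let f : QuaternionGroup 2 → G := fun q => match q with
    | .a i => g ^ i.val
    | .xa i => h * g ^ i.val
  have fa : ∀ (i : ZMod (2 * 2)) (k : ℤ), (k : ZMod (2 * 2)) = i → f (.a i) = g ^ k := key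
  have fx : ∀ (i : ZMod (2 * 2)) (k : ℤ), (k : ZMod (2 * 2)) = i → f (.xa i) = h * g ^ k :=
    fun i k hk => congrArg (h * ·) (key i k hk)
  have hh2' : h * h = g ^ (2 : ℤ) := by
    rw [← sq, hh2, ← zpow_natCast]; rfl
  have hmul : ∀ q r, f (q * r) = f q * f r := by
    rintro (i | i) (j | j)
    · rw [QuaternionGroup.a_mul_a, fa _ (i.val + j.val) (by push_cast; simp),
        fa i _ (hval i), fa j _ (hval j), zpow_add]
    · rw [QuaternionGroup.a_mul_xa, fx _ (j.val - i.val) (by push_cast; simp),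
        fa i _ (hval i), fx j _ (hval j), ← mul_assoc, hconj, mul_assoc, ← zpow_add]
      congr 2; ring
    · rw [QuaternionGroup.xa_mul_a, fx _ (i.val + j.val) (by push_cast; simp),
        fx i _ (hval i), fa j _ (hval j), zpow_add, mul_assoc]
    · rw [QuaternionGroup.xa_mul_xa, fa _ (2 + j.val - i.val) (by push_cast; simp),
        fx i _ (hval i), fx j _ (hval j), mul_assoc, ← mul_assoc _ h, hconj, mul_assoc,
        ← zpow_add, ← mul_assoc, hh2', ← zpow_add]
      congr 1; ring
  let F : QuaternionGroup 2 →* G := MonoidHom.mk' f hmul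
  suffices Nonempty (QuaternionGroup 2 ≃* G) from ⟨this.some.symm⟩
  refine ⟨MulEquiv.ofBijective F ⟨?_, ?_⟩⟩
  · rw [injective_iff_map_eq_one]
    rintro (i | i) hi
    · have h1 : g ^ i.val = 1 := hi
      have h2 := orderOf_dvd_of_pow_eq_one h1
      rw [hg4] at h2
      have h3 : i.val < 4 := ZMod.val_lt (n := 4) i
      have h4 : i.val = 0 := Nat.eq_zero_of_dvd_of_lt h2 h3
      have h5 : i = 0 := (ZMod.val_eq_zero i).mp h4
      rw [h5]; rfl
    · exfalso
      have h1 : h * g ^ i.val = 1 := hi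
      apply hnot
      rw [eq_inv_of_mul_eq_one_left h1]
      exact inv_mem (Subgroup.npow_mem_zpowers g _)
  · intro k
    rcases hall k with ⟨n, hn⟩ | ⟨n, hn⟩
    · exact ⟨.a n, (fa _ n rfl).trans hn⟩
    · refine ⟨.xa n, (fx _ n rfl).trans ?_⟩
      rw [show g ^ n = h⁻¹ * k from hn]; group

open Subgroup in
lemma aux_forward (G : Type*) [Group G] [Finite G] (h : IndependenceProperty G)
    (hF : frattini G ≠ ⊥) :
      (IsCyclic G ∧ ∃ p n : ℕ, p.Prime ∧ 2 ≤ n ∧ Nat.card G = p ^ n) ∨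
      Nonempty (G ≃* QuaternionGroup 2) := by
  have hdep : ∀ z ∈ frattini G, ∀ g, z ∈ zpowers g ∨ g ∈ zpowers z := by
    intro z hz g
    by_cases hzg : z = g
    · left; rw [hzg]; exact mem_zpowers g
    · rcases h z g hzg with ⟨_, X, hX, hzX, _⟩ | h1
      · exact absurd hzX (aux_not_minimal hz hX)
      · exact h1
  obtain ⟨⟨z0, hz0⟩, hz0'⟩ := Subgroup.ne_bot_iff_exists_ne_one.mp hF
  have hz01 : z0 ≠ 1 := fun hh => hz0' (Subtype.ext hh)
  obtain ⟨p, hp, hpd⟩ := Nat.exists_prime_and_dvd (fun hh => hz01 (orderOf_eq_one_iff.mp hh))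
  have : Fact p.Prime := ⟨hp⟩
  obtain ⟨m, hm⟩ := hpd
  have hm0 : m ≠ 0 := by
    rintro rfl
    exact (orderOf_pos z0).ne' (by simpa using hm)
  have hzo : orderOf (z0 ^ m) = p := by
    rw [orderOf_pow_of_dvd hm0 ⟨p, by rw [hm, mul_comm]⟩, hm]
    exact Nat.mul_div_cancel _ (Nat.pos_of_ne_zero hm0)
  have hPG : IsPGroup p G := by
    apply (isPGroup_iff_primeFactors_card_subset hp.ne_zero).mpr
    intro q hq
    rw [Nat.mem_primeFactors] at hq
    have : Fact q.Prime := ⟨hq.1⟩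
    obtain ⟨y, hy⟩ := exists_prime_orderOf_dvd_card' q hq.2.1
    have : p = q := by
      rcases hdep _ (pow_mem hz0 m) y with h1 | h1
      · have := orderOf_dvd_of_mem_zpowers h1
        rw [hzo, hy] at this
        exact (Nat.prime_dvd_prime_iff_eq hp hq.1).mp this
      · have := orderOf_dvd_of_mem_zpowers h1
        rw [hzo, hy] at this
        exact ((Nat.prime_dvd_prime_iff_eq hq.1 hp).mp this).symm
    rw [← this]
    exact hp.mem_primeFactors_self
  have hFtop : frattini G ≠ ⊤ := by
    intro hh
    have hbt : (⊥ : Subgroup G) = ⊤ := frattini_nongenerating (by rw [hh]; simp)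
    exact hF (by rw [hh, hbt])
  obtain ⟨hpow, hcomm⟩ := aux_frattini hPG
  by_cases hcyc : IsCyclic G
  · left
    refine ⟨hcyc, ?_⟩
    obtain ⟨n, hn⟩ := IsPGroup.iff_card.mp hPG
    refine ⟨p, n, hp, ?_, hn⟩
    by_contra hlt
    have hn' : n = 0 ∨ n = 1 := by omega
    rcases hn' with rfl | rfl
    · have h1 : Nat.card G = 1 := by simpa using hn
      have := (Nat.card_eq_one_iff_unique.mp h1).1
      exact hz01 (Subsingleton.elim _ _)
    · have : Fact (Nat.card G).Prime := ⟨by rw [hn, pow_one]; exact hp⟩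
      rcases (frattini G).eq_bot_or_eq_top_of_prime_card with h1 | h1
      · exact hF h1
      · exact hFtop h1
  right
  have hsub : ∀ g ∉ frattini G, ∀ f ∈ frattini G, f ∈ zpowers g := by
    intro g hg f hf
    rcases hdep f hf g with h1 | h1
    · exact h1
    · exact absurd ((zpowers_le.mpr hf) h1) hg
  have hgenp : ∀ g ∉ frattini G, ∀ f ∈ frattini G, ∃ i : ℤ, (g ^ p) ^ i = f := by
    intro g hg f hf
    obtain ⟨i, hi⟩ := hsub g hg f hf
    have hi : g ^ i = f := hi
    by_cases hpi : (p : ℤ) ∣ i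
    · obtain ⟨j, rfl⟩ := hpi
      exact ⟨j, by rw [← hi, zpow_mul, zpow_natCast]⟩
    · exfalso
      have hcop : IsCoprime (p : ℤ) i :=
        (Nat.prime_iff_prime_int.mp hp).coprime_iff_not_dvd.mpr hpi
      obtain ⟨a, b, hab⟩ := hcop
      apply hg
      have : g = (g ^ p) ^ a * f ^ b := by
        rw [← hi, ← zpow_natCast, ← zpow_mul, ← zpow_mul, ← zpow_add, mul_comm _ a, mul_comm i,
          hab, zpow_one]
      rw [this]
      exact mul_mem (zpow_mem (hpow g) a) (zpow_mem hf b)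
  have hcomm_out : ∀ f ∈ frattini G, ∀ g ∉ frattini G, f * g = g * f := by
    intro f hf g hg
    obtain ⟨i, rfl⟩ := hsub g hg f hf
    exact ((Commute.refl g).zpow_left i).eq
  obtain ⟨g, hg⟩ : ∃ g, g ∉ frattini G := by
    by_contra! hh
    exact hFtop (eq_top_iff.mpr fun x _ => hh x)
  have hcen : ∀ f ∈ frattini G, ∀ k, f * k = k * f := by
    intro f hf k
    by_cases hk : k ∈ frattini G
    · have h1 : g * k ∉ frattini G := fun hh => hg (((frattini G).mul_mem_cancel_right hk).mp hh)
      have h2 : Commute f (g * k) := hcomm_out f hf _ h1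
      have h3 : Commute f g := hcomm_out f hf g hg
      have h4 := h3.inv_right.mul_right h2
      rw [inv_mul_cancel_left] at h4
      exact h4.eq
    · exact hcomm_out f hf k hk
  obtain ⟨k, hk⟩ : ∃ k, k ∉ zpowers g := by
    by_contra! hh
    exact hcyc ⟨g, hh⟩
  have hout : ∀ k ∉ zpowers g, ∀ i : ℤ, g ^ i * k ∉ frattini G := by
    intro k hk i hh
    exact hk (((zpowers g).mul_mem_cancel_left (zpow_mem (mem_zpowers g) i)).mp
      (hsub g hg _ hh))
  have hkF : k ∉ frattini G := by simpa using hout k hk 0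
  obtain ⟨i, hi⟩ := hgenp g hg _ (hpow k)
  set x := g ^ (-i) with hx
  have hxk : x ^ p * k ^ p = 1 := by
    rw [← hi, hx, ← zpow_natCast, ← zpow_natCast, ← zpow_mul, ← zpow_mul, ← zpow_add,
      show -i * (p : ℤ) + p * i = 0 by ring, zpow_zero]
  set c := k⁻¹ * x⁻¹ * k * x with hc
  have hcF : c ∈ frattini G := hcomm x k
  have hcx : k * x = x * k * c := by rw [hc]; group
  have hcp : c ^ p = 1 := by
    have h1 := aux_comm_pow hcx (hcen c hcF) p
    rw [hcen _ (hpow k)] at h1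
    exact (mul_eq_left.mp h1.symm)
  have hup := aux_mul_pow hcx (hcen c hcF) p
  rw [hxk, one_mul] at hup
  have huF := hout k hk (-i)
  rw [← hx] at huF
  have hp2 : p = 2 := by
    by_contra hne
    have hdv : p ∣ p.choose 2 :=
      hp.dvd_choose_self two_ne_zero (lt_of_le_of_ne hp.two_le (Ne.symm hne))
    obtain ⟨t, ht⟩ := hdv
    rw [ht, pow_mul, hcp, one_pow] at hup
    obtain ⟨j, hj⟩ := hgenp _ huF z0 hz0
    rw [hup, one_zpow] at hj
    exact hz01 hj.symm
  subst hp2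
  simp only [Nat.choose_self, pow_one] at hup
  have hcp' : c ^ (2 : ℤ) = 1 := by rw [← hcp, ← zpow_natCast]; rfl
  have hFc : ∀ f ∈ frattini G, f = 1 ∨ f = c := by
    intro f hf
    obtain ⟨j, hj⟩ := hgenp _ huF f hf
    rw [hup] at hj
    rcases Int.even_or_odd' j with ⟨t, rfl | rfl⟩
    · left
      rw [← hj, zpow_mul]
      rw [hcp', one_zpow]
    · right
      rw [← hj, zpow_add, zpow_mul]
      rw [hcp']
      rw [one_zpow, one_mul, zpow_one]
  have hc1 : c ≠ 1 := by
    intro hh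
    rcases hFc z0 hz0 with h1 | h1
    · exact hz01 h1
    · exact hz01 (h1.trans hh)
  have hsq : ∀ w ∉ frattini G, w ^ 2 = c := by
    intro w hw
    rcases hFc _ (hpow w) with h1 | h1
    · exfalso
      obtain ⟨j, hj⟩ := hgenp w hw c hcF
      rw [h1, one_zpow] at hj
      exact hc1 hj.symm
    · exact h1
  have hcc : c * c = 1 := by rw [← sq]; exact hcp
  have hcen' := hcen c hcF
  have hanti : ∀ w ∉ zpowers g, g * w = w * g * c := by
    intro w hw
    have hwF : w ∉ frattini G := by simpa using hout w hw 0
    have h1 := hsq _ (hout w hw 1)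
    rw [zpow_one] at h1
    have h2 := hsq w hwF
    have h3 := hsq g hg
    have e1 : g⁻¹ = g * c := by
      rw [inv_eq_iff_mul_eq_one, ← mul_assoc, ← sq, h3, hcc]
    have e2 : w⁻¹ = w * c := by
      rw [inv_eq_iff_mul_eq_one, ← mul_assoc, ← sq, h2, hcc]
    have e3 : (g * w)⁻¹ = g * w * c := by
      rw [inv_eq_iff_mul_eq_one, ← mul_assoc, ← sq, h1, hcc]
    rw [mul_inv_rev, e1, e2] at e3
    have e4 : g * w = w * c * (g * c) * c := by
      rw [e3, mul_assoc, hcc, mul_one]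
    rw [e4, mul_assoc _ (g * c), mul_assoc g, hcc, mul_one, mul_assoc w, hcen', ← mul_assoc]
  refine aux_quat (g := g) (h := k) ?_ ?_ ?_ hk ?_
  · have : orderOf g = 2 ^ (1 + 1) := by
      apply orderOf_eq_prime_pow
      · rw [pow_one, hsq g hg]; exact hc1
      · rw [show 2 ^ (1 + 1) = 2 * 2 from rfl, pow_mul, hsq g hg]; exact hcp
    exact this
  · rw [hsq g hg, hsq k hkF]
  · have e1 : g⁻¹ = g * c := by
      rw [inv_eq_iff_mul_eq_one, ← mul_assoc, ← sq, hsq g hg, hcc]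
    rw [hanti k hk, e1, mul_assoc]
  · intro w
    by_cases hw : w ∈ zpowers g
    · exact Or.inl hw
    right
    by_contra hkw
    have h1 := hanti _ hkw
    have h2 := hanti _ hw
    have hk' : k⁻¹ ∉ zpowers g := fun hh => hk (inv_mem_iff.mp hh)
    have h3 := hanti _ hk'
    apply hc1
    have h4 : g * (k⁻¹ * w) = k⁻¹ * w * g := by
      rw [← mul_assoc, h3, mul_assoc (k⁻¹ * g), hcen', mul_assoc k⁻¹, ← mul_assoc g w, h2,
        mul_assoc (w * g), hcc, mul_one, mul_assoc]
    rw [h4] at h1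
    exact (mul_eq_left.mp h1.symm)

/-- Let `G` be a finite group satisfying the independence property.
Then the Frattini subgroup of `G` is non-trivial iff `G` is cyclic of order `p ^ n` for a
prime `p` and some `n ≥ 2`, or `G ≅ Q₈`. -/
theorem stmt_5 (G : Type*) [Group G] [Finite G] (h : IndependenceProperty G) :
    frattini G ≠ ⊥ ↔
      (IsCyclic G ∧ ∃ p n : ℕ, p.Prime ∧ 2 ≤ n ∧ Nat.card G = p ^ n) ∨
      Nonempty (G ≃* QuaternionGroup 2) := by
  refine ⟨aux_forward G h, ?_⟩
  rintro (⟨hcyc, p, n, hp, hn, hcard⟩ | he) hF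
  · have : Fact p.Prime := ⟨hp⟩
    have hPG : IsPGroup p G := IsPGroup.of_card hcard
    obtain ⟨g, hg⟩ := hcyc.exists_generator
    have h1 := (aux_frattini hPG).1 g
    rw [hF, Subgroup.mem_bot] at h1
    have h2 := orderOf_dvd_of_pow_eq_one h1
    rw [orderOf_eq_card_of_forall_mem_zpowers hg, hcard] at h2
    have h3 : p ^ n ∣ p ^ 1 := by simpa using h2
    have := (Nat.pow_dvd_pow_iff_le_right hp.one_lt).mp h3
    omega
  · obtain ⟨e⟩ := he
    have : Fact (Nat.Prime 2) := ⟨Nat.prime_two⟩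
    have hcard : Nat.card G = 2 ^ 3 := by
      rw [Nat.card_congr e.toEquiv, Nat.card_eq_fintype_card, QuaternionGroup.card]
      rfl
    have h1 := (aux_frattini (IsPGroup.of_card hcard)).1 (e.symm (.a 1))
    rw [hF, Subgroup.mem_bot, ← map_pow, map_eq_one_iff e.symm e.symm.injective] at h1
    revert h1
    decide
end

section
/- Let G be a finite group satisfying the independence property, suppose that the Frattini subgroup of G is trivial, and let N be an abelian minimal normal subgroup of G. Then N is cyclic of prime order. -/
theorem stmt_6_dep {G : Type*} [Group G] (N : Subgroup G) (hN : N.Normal)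
    (hmin : ∀ K : Subgroup G, K.Normal → K < N → K = ⊥)
    (hab : ∀ x ∈ N, ∀ y ∈ N, x * y = y * x) (x y : G) (hx : x ∈ N) (hy : y ∈ N)
    (hx1 : x ≠ 1) : ¬ Independent x y := by
  rintro ⟨hxy, X, ⟨hgen, hX⟩, hxX, hyX⟩
  have hss : X \ {y} ⊂ X := by
    refine ⟨Set.diff_subset, fun hh => ?_⟩
    exact (hh hyX).2 rfl
  apply hX _ hss
  set K := Subgroup.closure (X \ {y}) with hK
  have hxK : x ∈ K := Subgroup.subset_closure ⟨hxX, hxy⟩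
  have hmem : ∀ z ∈ X, z ≠ y → z ∈ K := fun z hz hzy => Subgroup.subset_closure ⟨hz, hzy⟩
  have hKN : K ⊔ N = ⊤ := by
    rw [eq_top_iff, ← hgen, Subgroup.closure_le]
    intro z hz
    by_cases hzy : z = y
    · subst hzy
      exact (le_sup_right : N ≤ K ⊔ N) hy
    · exact (le_sup_left : K ≤ K ⊔ N) (hmem z hz hzy)
  have hnorm : (K ⊓ N).Normal := by
    refine ⟨fun m hm g => ?_⟩
    obtain ⟨hmK, hmN⟩ := hm
    refine ⟨?_, hN.conj_mem m hmN g⟩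
    have hg : g ∈ ((K ⊔ N : Subgroup G) : Set G) := by rw [hKN]; trivial
    rw [Subgroup.mul_normal] at hg
    obtain ⟨k, hk, n, hn, rfl⟩ := hg
    have e : k * n * m * (k * n)⁻¹ = k * m * k⁻¹ := by
      have := hab n hn m hmN
      calc k * n * m * (k * n)⁻¹ = k * (n * m) * n⁻¹ * k⁻¹ := by group
        _ = k * m * k⁻¹ := by rw [this]; group
    change k * n * m * (k * n)⁻¹ ∈ K
    rw [e]
    exact K.mul_mem (K.mul_mem hk hmK) (K.inv_mem hk)
  have hyK : y ∈ K := by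
    by_contra hyK
    have hlt : K ⊓ N < N := lt_of_le_of_ne inf_le_right fun he => hyK (by
      rw [← he] at hy; exact hy.1)
    have hb := hmin _ hnorm hlt
    have hxm : x ∈ K ⊓ N := ⟨hxK, hx⟩
    rw [hb] at hxm
    exact hx1 (Subgroup.mem_bot.mp hxm)
  rw [eq_top_iff, ← hgen, Subgroup.closure_le]
  intro z hz
  by_cases hzy : z = y
  · subst hzy; exact hyK
  · exact hmem z hz hzy

theorem stmt_6 (G : Type*) [Group G] [Finite G] (h : IndependenceProperty G)
    (hfrat : frattini G = ⊥) (N : Subgroup G) (hN : N.Normal) (hbot : N ≠ ⊥)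
    (hmin : ∀ K : Subgroup G, K.Normal → K < N → K = ⊥)
    (hab : ∀ x ∈ N, ∀ y ∈ N, x * y = y * x) :
    IsCyclic ↥N ∧ (Nat.card ↥N).Prime := by
  have hcard : Nat.card N ≠ 1 := fun hc => hbot (Subgroup.card_eq_one.mp hc)
  obtain ⟨p, hp, hpd⟩ := Nat.exists_prime_and_dvd hcard
  haveI : Fact p.Prime := ⟨hp⟩
  obtain ⟨⟨x, hxN⟩, hxo⟩ := exists_prime_orderOf_dvd_card' (G := N) p hpd
  rw [Subgroup.orderOf_mk] at hxo
  have hx1 : x ≠ 1 := by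
    rintro rfl
    rw [orderOf_one] at hxo
    exact hp.one_lt.ne hxo
  -- the `p`-torsion of `N`
  let T : Subgroup G :=
    { carrier := {z | z ∈ N ∧ z ^ p = 1}
      one_mem' := ⟨N.one_mem, one_pow p⟩
      mul_mem' := by
        rintro a b ⟨ha, ha'⟩ ⟨hb, hb'⟩
        refine ⟨N.mul_mem ha hb, ?_⟩
        have hc : Commute a b := hab a ha b hb
        rw [hc.mul_pow, ha', hb', one_mul]
      inv_mem' := by
        rintro a ⟨ha, ha'⟩
        exact ⟨N.inv_mem ha, by rw [inv_pow, ha', inv_one]⟩ }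
  have hT : T.Normal := by
    refine ⟨fun m hm g => ⟨hN.conj_mem m hm.1 g, ?_⟩⟩
    rw [conj_pow, hm.2]; simp
  have hxT : x ∈ T := ⟨hxN, by rw [← hxo]; exact pow_orderOf_eq_one x⟩
  have hTN : T = N := by
    by_contra hne
    have hb := hmin T hT (lt_of_le_of_ne (fun z hz => hz.1) hne)
    rw [hb] at hxT
    exact hx1 (Subgroup.mem_bot.mp hxT)
  have hNx : N = Subgroup.zpowers x := by
    apply le_antisymm
    · intro y hy
      by_cases hxy : x = y
      · subst hxy; exact Subgroup.mem_zpowers x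
      rcases h x y hxy with hi | hi | hi
      · exact absurd hi (stmt_6_dep N hN hmin hab x y hxN hy hx1)
      · have hyT : y ∈ T := by rw [hTN]; exact hy
        have hle : Subgroup.zpowers x ≤ Subgroup.zpowers y :=
          Subgroup.zpowers_le.mpr hi
        have hyp : Nat.card (Subgroup.zpowers y) ≤ Nat.card (Subgroup.zpowers x) := by
          rw [Nat.card_zpowers, Nat.card_zpowers, hxo]
          exact orderOf_le_of_pow_eq_one hp.pos hyT.2
        rw [Subgroup.eq_of_le_of_card_ge hle hyp]
        exact Subgroup.mem_zpowers y
      · exact hi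
    · exact Subgroup.zpowers_le.mpr hxN
  have hc : Nat.card N = p := by rw [hNx, Nat.card_zpowers, hxo]
  exact ⟨isCyclic_of_prime_card hc, hc ▸ hp⟩
end

section
/- Let G be a finite group satisfying the independence property, suppose that the Frattini subgroup of G is trivial, and let N be a non-abelian minimal normal subgroup of G. Then N is a simple group. -/
/-- Every nontrivial element has prime order. -/
def EPO (H : Type*) [Group H] : Prop := ∀ g : H, g ≠ 1 → (orderOf g).Prime

theorem EPO.sub {H : Type*} [Group H] (h : EPO H) (R : Subgroup H) : EPO R := by
  intro g hg
  have := h (g : H) (by simpa using hg)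
  simpa using this

theorem pow_inj_aux {H : Type*} [Group H] {a b : H} {j r : ℕ} (hjr : Nat.Coprime j r)
    (ha : a ^ r = 1) (hb : b ^ r = 1) (hab : a ^ j = b ^ j) : a = b := by
  have h : (1 : ℤ) = j * Nat.gcdA j r + r * Nat.gcdB j r := by
    rw [← Nat.gcd_eq_gcd_ab, hjr.gcd_eq_one]; rfl
  have key : ∀ c : H, c ^ r = 1 → c = (c ^ j) ^ (Nat.gcdA j r) := by
    intro c hc
    calc c = c ^ (1 : ℤ) := (zpow_one c).symm
      _ = _ := by
        rw [h, zpow_add, zpow_mul, zpow_mul, zpow_natCast, zpow_natCast, hc, one_zpow, mul_one]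
  rw [key a ha, key b hb, hab]

open Finset in
theorem norm_kill {H V : Type*} [Group H] [Finite H] [CommGroup V] (hE : EPO H) (c : H →* MulAut V)
    (hc : ∀ u : H, u ≠ 1 → ∀ d : V, ∏ i ∈ range (orderOf u), c (u ^ i) d = 1)
    (x y : H) (hx : x ≠ 1) (hy : y ∈ Subgroup.normalizer (Subgroup.zpowers x : Set H))
    (hyx : y ∉ Subgroup.zpowers x) (d : V) : d ^ (orderOf x) = 1 := by
  classical
  have : Fintype H := Fintype.ofFinite H
  set X := Subgroup.zpowers x with hX
  have hy1 : y ≠ 1 := by rintro rfl; exact hyx (one_mem _)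
  set r := orderOf y with hr
  have hrp : r.Prime := hE y hy1
  have hyX : ∀ k : ℕ, y ^ k ∈ X → r ∣ k := by
    intro k hk
    by_contra hnd
    apply hyx
    have hcop : Nat.Coprime k (orderOf y) := ((Nat.Prime.coprime_iff_not_dvd hrp).2 hnd).symm
    obtain ⟨m, hm⟩ := exists_pow_eq_self_of_coprime hcop
    rw [← hm]
    exact pow_mem hk m
  -- powers of y z
  have hpw : ∀ (z : X) (k : ℕ), (y ^ k)⁻¹ * (y * z) ^ k ∈ X := by
    intro z k
    induction k with
    | zero => simp
    | succ k ih =>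
      have e : (y ^ (k+1))⁻¹ * (y * z) ^ (k+1)
          = y⁻¹ * ((y ^ k)⁻¹ * (y * z) ^ k) * y⁻¹⁻¹ * z := by
        rw [pow_succ (y * (z:H)), pow_succ' y]; group
      rw [e]
      exact mul_mem ((Subgroup.mem_normalizer_iff.1 (inv_mem hy) _).1 ih) z.2
  have hord : ∀ z : X, orderOf (y * (z : H)) = r := by
    intro z
    have hne : y * (z : H) ≠ 1 := by
      intro h
      apply hyx
      rw [mul_eq_one_iff_eq_inv.1 h]
      exact inv_mem z.2
    have hp := hE _ hne
    have h1 := hpw z (orderOf (y * (z:H)))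
    rw [pow_orderOf_eq_one, mul_one] at h1
    have h2 := hyX _ (by simpa using inv_mem h1)
    exact ((Nat.prime_dvd_prime_iff_eq hrp hp).1 h2).symm
  have hXsum : ∏ z : X, c (z : H) d = 1 := by
    rw [← hc x hx d, ← Fin.prod_univ_eq_prod_range (fun i => c (x ^ i) d)]
    symm
    exact Fintype.prod_equiv (finEquivZPowers (isOfFinOrder_of_finite x)) _ _
      (fun i => by simp [finEquivZPowers_apply])
  have h1 : ∏ z : X, ∏ j ∈ range r, c ((y * (z:H)) ^ j) d = 1 := by
    apply Finset.prod_eq_one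
    intro z _
    rw [← hord z]
    apply hc
    intro h
    have := hord z
    rw [h, orderOf_one] at this
    exact hrp.one_lt.ne this
  rw [Finset.prod_comm] at h1
  have h0 : (0 : ℕ) ∈ range r := mem_range.2 hrp.pos
  rw [Finset.prod_eq_single_of_mem 0 h0] at h1
  · simp only [pow_zero, map_one, MulAut.one_apply, prod_const, card_univ] at h1
    rwa [Fintype.card_zpowers] at h1
  · intro j hj hj0
    have hjr : Nat.Coprime j r :=
      ((Nat.Prime.coprime_iff_not_dvd hrp).2
        (fun h => by
          have := Nat.le_of_dvd (Nat.pos_of_ne_zero hj0) h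
          have := mem_range.1 hj
          omega)).symm
    let σ : X → X := fun z => ⟨(y ^ j)⁻¹ * (y * z) ^ j, hpw z j⟩
    have hσ : Function.Injective σ := by
      intro z z' hzz
      have h2 : (y * (z:H)) ^ j = (y * (z':H)) ^ j := by
        have := congrArg Subtype.val hzz
        simpa [σ] using this
      have h3 := pow_inj_aux hjr (by rw [← hord z, pow_orderOf_eq_one])
        (by rw [← hord z', pow_orderOf_eq_one]) h2
      exact Subtype.ext (mul_left_cancel h3)
    have hσb : Function.Bijective σ := Finite.injective_iff_bijective.1 hσ
    calc ∏ z : X, c ((y * (z:H)) ^ j) d = ∏ z : X, c (y ^ j) (c (σ z : H) d) := by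
          refine Finset.prod_congr rfl fun z _ => ?_
          rw [← MulAut.mul_apply, ← map_mul]
          simp [σ]
      _ = c (y ^ j) (∏ z : X, c (σ z : H) d) := by rw [map_prod]
      _ = c (y ^ j) (∏ z : X, c (z : H) d) := by
          rw [hσb.prod_comp (fun z : X => c (z : H) d)]
      _ = 1 := by rw [hXsum, map_one]

open Finset in
/-- In an EPO group with a nontrivial normal abelian `p`-subgroup, subgroups of order `q ≠ p` are
self-normalising. -/
theorem self_norm_aux {H : Type*} [Group H] [Finite H] (hE : EPO H) {p : ℕ} (hp : p.Prime)
    (D : Subgroup H) (hDn : D.Normal) (hDp : IsPGroup p D) (hD1 : D ≠ ⊥)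
    (hDc : ∀ a b : D, a * b = b * a) (x : H) (hx : x ≠ 1) (hxp : orderOf x ≠ p) :
    Subgroup.normalizer (Subgroup.zpowers x : Set H) = Subgroup.zpowers x := by
  classical
  apply le_antisymm _ Subgroup.le_normalizer
  intro y hy
  by_contra hyx
  let _ : CommGroup D := { (inferInstance : Group D) with mul_comm := hDc }
  let c : H →* MulAut D := MulAut.conjNormal
  have hpow : ∀ (u : H) (d : D) (n : ℕ),
      ((d : H) * u) ^ n = ((∏ i ∈ range n, c (u ^ i) d : D) : H) * u ^ n := by
    intro u d n
    induction n with
    | zero => simp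
    | succ n ih =>
      rw [pow_succ, ih, Finset.prod_range_succ, Subgroup.coe_mul, MulAut.conjNormal_apply, pow_succ]
      group
  have hDord : ∀ v : H, v ∈ D → v ≠ 1 → orderOf v = p := by
    intro v hv hv1
    obtain ⟨k, hk⟩ := hDp ⟨v, hv⟩
    have hk' : v ^ p ^ k = 1 := by simpa using congrArg Subtype.val hk
    have := (hE v hv1).dvd_of_dvd_pow (orderOf_dvd_of_pow_eq_one hk')
    exact (Nat.prime_dvd_prime_iff_eq (hE v hv1) hp).1 this
  have hc : ∀ u : H, u ≠ 1 → ∀ d : D, ∏ i ∈ range (orderOf u), c (u ^ i) d = 1 := by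
    intro u hu d
    have ho := hE u hu
    have e := hpow u d (orderOf u)
    rw [pow_orderOf_eq_one, mul_one] at e
    by_contra hne
    set v := ∏ i ∈ range (orderOf u), c (u ^ i) d
    have hv1 : (v : H) ≠ 1 := by simpa using hne
    have hdu : (d : H) * u ≠ 1 := by
      intro h; rw [h, one_pow] at e; exact hv1 e.symm
    have ho' := hE _ hdu
    have h1 : orderOf (d * u : H) = p := by
      have h2 := hDord v v.2 hv1
      have h3 : orderOf (v : H) ∣ orderOf (d * u : H) := by
        rw [← e]; exact orderOf_pow_dvd _
      rw [h2] at h3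
      exact ((Nat.prime_dvd_prime_iff_eq hp ho').1 h3).symm
    by_cases hop : orderOf u = p
    · rw [hop, ← h1, pow_orderOf_eq_one] at e
      exact hv1 e.symm
    · have e2 := hpow u d p
      rw [← h1, pow_orderOf_eq_one, h1] at e2
      have h4 : u ^ p ∈ D := by
        rw [← mul_eq_one_iff_inv_eq.1 e2.symm]
        exact inv_mem (Subtype.mem _)
      have hcop : Nat.Coprime p (orderOf u) := (Nat.coprime_primes hp ho).2 (Ne.symm hop)
      obtain ⟨m, hm⟩ := exists_pow_eq_self_of_coprime hcop
      have h5 : u ∈ D := by rw [← hm]; exact pow_mem h4 m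
      exact hop (hDord u h5 hu)
  obtain ⟨d, hd1⟩ := Subgroup.ne_bot_iff_exists_ne_one.1 hD1
  have hk := norm_kill hE c hc x y hx hy hyx d
  have hd1' : (d : H) ≠ 1 := by simpa using hd1
  have h6 : (d : H) ^ orderOf x = 1 := by
    have := congrArg Subtype.val hk
    exact this
  have h7 := orderOf_dvd_of_pow_eq_one h6
  rw [hDord d d.2 hd1'] at h7
  exact hxp ((Nat.prime_dvd_prime_iff_eq hp (hE x hx)).1 h7).symm

/-- Same, with an arbitrary normal `p`-subgroup. -/
theorem self_norm {H : Type*} [Group H] [Finite H] (hE : EPO H) {p : ℕ} (hp : p.Prime)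
    (D : Subgroup H) (hDn : D.Normal) (hDp : IsPGroup p D) (hD1 : D ≠ ⊥)
    (x : H) (hx : x ≠ 1) (hxp : orderOf x ≠ p) :
    Subgroup.normalizer (Subgroup.zpowers x : Set H) = Subgroup.zpowers x := by
  have : Fact p.Prime := ⟨hp⟩
  have : Nontrivial D := (Subgroup.nontrivial_iff_ne_bot D).2 hD1
  have hz := hDp.bot_lt_center
  refine self_norm_aux hE hp ((Subgroup.center D).map D.subtype) inferInstance ?_ ?_ ?_ x hx hxp
  · exact (hDp.to_subgroup _).map _
  · intro h
    rw [Subgroup.map_eq_bot_iff_of_injective _ D.subtype_injective] at h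
    exact hz.ne' h
  · rintro ⟨_, a, ha, rfl⟩ ⟨_, b, hb, rfl⟩
    apply Subtype.ext
    have := (Subgroup.mem_center_iff.1 hb) a
    exact congrArg D.subtype this


theorem pelem_of_pgroup {H : Type*} [Group H] {p : ℕ} {V : Subgroup H}
    (hV : IsPGroup p V) {g : H} (hg : g ∈ V) : ∃ k, g ^ p ^ k = 1 := by
  obtain ⟨k, hk⟩ := hV ⟨g, hg⟩
  exact ⟨k, by simpa using congrArg Subtype.val hk⟩

theorem EPO.orderOf_of_pow {H : Type*} [Group H] (hE : EPO H) {p : ℕ} (hp : p.Prime)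
    {g : H} (h1 : g ≠ 1) (hg : ∃ k, g ^ p ^ k = 1) : orderOf g = p := by
  obtain ⟨k, hk⟩ := hg
  have := (hE g h1).dvd_of_dvd_pow (orderOf_dvd_of_pow_eq_one hk)
  exact (Nat.prime_dvd_prime_iff_eq (hE g h1) hp).1 this

theorem isPGroup_of_primes {H : Type*} [Group H] [Finite H] {p : ℕ} (M : Subgroup H)
    (h : ∀ q, q.Prime → q ∣ Nat.card M → q = p) : IsPGroup p M :=
  IsPGroup.of_card (Nat.eq_prime_pow_of_unique_prime_dvd Nat.card_pos.ne' (fun {q} => h q))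

theorem qsub_self_norm {H : Type*} [Group H] [Finite H] (hE : EPO H) {p : ℕ} (hp : p.Prime)
    (D : Subgroup H) (hDn : D.Normal) (hDp : IsPGroup p D) (hD1 : D ≠ ⊥)
    {q : ℕ} (hq : q.Prime) (hqp : q ≠ p) (V : Subgroup H) (hV : IsPGroup q V) (hV1 : V ≠ ⊥) :
    ∃ w : H, w ≠ 1 ∧ orderOf w = q ∧ V = Subgroup.zpowers w ∧
      Subgroup.normalizer (V : Set H) = V := by
  have : Fact q.Prime := ⟨hq⟩
  have : Nontrivial V := (Subgroup.nontrivial_iff_ne_bot V).2 hV1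
  have hz := hV.bot_lt_center
  obtain ⟨z, hz1⟩ := Subgroup.ne_bot_iff_exists_ne_one.1 hz.ne'
  have hw1 : ((z : V) : H) ≠ 1 := by simpa using hz1
  have hwq : orderOf ((z : V) : H) = q := hE.orderOf_of_pow hq hw1 (pelem_of_pgroup hV (z : V).2)
  have hn := self_norm hE hp D hDn hDp hD1 _ hw1 (by rw [hwq]; exact hqp)
  have hV2 : V = Subgroup.zpowers ((z : V) : H) := by
    apply le_antisymm
    · rw [← hn]
      intro g hg
      apply Subgroup.centralizer_le_normalizer
      rw [Subgroup.mem_centralizer_iff]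
      intro h hh
      obtain ⟨k, rfl⟩ := Subgroup.mem_zpowers_iff.1 hh
      have hc : Commute g ((z : V) : H) := by
        have := Subgroup.mem_center_iff.1 z.2 ⟨g, hg⟩
        exact congrArg Subtype.val this
      exact (hc.zpow_right k).symm.eq
    · rw [Subgroup.zpowers_le]
      exact (z : V).2
  refine ⟨_, hw1, hwq, hV2, ?_⟩
  rw [hV2]
  exact hn

theorem normal_compl {H : Type*} [Group H] [Finite H] (hE : EPO H) {p : ℕ} (hp : p.Prime)
    (D : Subgroup H) (hDn : D.Normal) (hDp : IsPGroup p D) (hD1 : D ≠ ⊥)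
    {q : ℕ} (hq : q.Prime) (hqp : q ≠ p) (hqH : q ∣ Nat.card H) :
    ∃ K : Subgroup H, K.Normal ∧ K.index = q ∧ ¬ q ∣ Nat.card K := by
  have : Fact q.Prime := ⟨hq⟩
  let Q : Sylow q H := default
  obtain ⟨w, hw1, hwq, hQ, hn⟩ := qsub_self_norm hE hp D hDn hDp hD1 hq hqp Q Q.2
    (Q.ne_bot_of_dvd_card hqH)
  have hnc : Subgroup.normalizer ((Q : Subgroup H) : Set H) ≤ Subgroup.centralizer ((Q : Subgroup H) : Set H) := by
    rw [hn, hQ]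
    intro g hg
    rw [Subgroup.mem_centralizer_iff]
    intro h hh
    obtain ⟨k, rfl⟩ := Subgroup.mem_zpowers_iff.1 hh
    obtain ⟨j, rfl⟩ := Subgroup.mem_zpowers_iff.1 hg
    exact ((Commute.refl w).zpow_zpow k j).eq
  refine ⟨(MonoidHom.transferSylow Q hnc).ker, inferInstance, ?_, 
    MonoidHom.not_dvd_card_ker_transferSylow Q hnc⟩
  rw [(MonoidHom.ker_transferSylow_isComplement' Q hnc).symm.index_eq_card, hQ, Nat.card_zpowers, hwq]

/-- Structure of an EPO group with a nontrivial normal `p`-subgroup. -/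
theorem L2 {H : Type*} [Group H] [Finite H] (hE : EPO H) {p : ℕ} (hp : p.Prime)
    (D : Subgroup H) (hDn : D.Normal) (hDp : IsPGroup p D) (hD1 : D ≠ ⊥) :
    ∃ T : Subgroup H, T.Normal ∧ IsPGroup p T ∧ (∀ V : Subgroup H, IsPGroup p V → V ≤ T) ∧
      ∃ n, Nat.card H = Nat.card T * n ∧ (n = 1 ∨ (n.Prime ∧ n ≠ p)) := by
  let T := Subgroup.normalClosure {g : H | ∃ k, g ^ p ^ k = 1}
  have hTn : T.Normal := Subgroup.normalClosure_normal
  have hTK : ∀ q, q.Prime → q ≠ p → ∀ K : Subgroup H, K.Normal → K.index = q → T ≤ K := by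
    intro q hq hqp K hK hi
    apply Subgroup.normalClosure_le_normal
    rintro g ⟨k, hk⟩
    have h1 : g ^ q ∈ K := by rw [← hi]; exact K.pow_index_mem g
    have hcop : Nat.Coprime q (orderOf g) := 
      Nat.Coprime.coprime_dvd_right (orderOf_dvd_of_pow_eq_one hk)
        (((Nat.coprime_primes hq hp).2 hqp).pow_right k)
    obtain ⟨m, hm⟩ := exists_pow_eq_self_of_coprime hcop
    rw [SetLike.mem_coe, ← hm]; exact pow_mem h1 m
  have hTp : IsPGroup p T := by
    apply isPGroup_of_primes
    intro q hq hqT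
    by_contra hqp
    obtain ⟨K, hK, hi, hc⟩ := normal_compl hE hp D hDn hDp hD1 hq hqp
      (hqT.trans T.card_subgroup_dvd_card)
    exact hc (hqT.trans (Subgroup.card_dvd_of_le (hTK q hq hqp K hK hi)))
  have hTV : ∀ V : Subgroup H, IsPGroup p V → V ≤ T := by
    intro V hV g hg
    exact Subgroup.subset_normalClosure (pelem_of_pgroup hV hg)
  refine ⟨T, hTn, hTp, hTV, ?_⟩
  by_cases hall : ∀ q, q.Prime → q ∣ Nat.card H → q = p
  · refine ⟨1, ?_, Or.inl rfl⟩
    have : (⊤ : Subgroup H) ≤ T := hTV ⊤ (isPGroup_of_primes _ (by simpa using hall))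
    rw [top_le_iff.1 this]; simp
  · push Not at hall
    obtain ⟨q, hq, hqH, hqp⟩ := hall
    refine ⟨q, ?_, Or.inr ⟨hq, hqp⟩⟩
    obtain ⟨K, hK, hi, hc⟩ := normal_compl hE hp D hDn hDp hD1 hq hqp hqH
    have hKp : IsPGroup p K := by
      apply isPGroup_of_primes
      intro r hr hrK
      by_contra hrp
      have : Fact r.Prime := ⟨hr⟩
      let R : Sylow r K := default
      have hF := R.normalizer_sup_eq_top
      obtain ⟨w, hw1, hwq, hQ, hn⟩ := qsub_self_norm hE hp D hDn hDp hD1 hr hrp 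
        (R.map K.subtype) (R.2.map _) (by
          intro h
          rw [Subgroup.map_eq_bot_iff_of_injective _ K.subtype_injective] at h
          exact R.ne_bot_of_dvd_card hrK h)
      rw [hn, sup_eq_right.2 (Subgroup.map_subtype_le _)] at hF
      rw [hF, Subgroup.index_top] at hi
      exact hq.one_lt.ne hi
    have : T = K := le_antisymm (hTK q hq hqp K hK hi) (hTV K hKp)
    rw [this, ← hi, Subgroup.card_mul_index]


theorem exists_normalizing {H : Type*} [Group H] [Finite H] {p : ℕ} [Fact p.Prime]
    (P D : Subgroup H) (hP : IsPGroup p P) (hD : D < P) :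
    ∃ g ∈ P, g ∉ D ∧ g ∈ Subgroup.normalizer (D : Set H) := by
  have : Group.IsNilpotent P := hP.isNilpotent
  have h1 : D.subgroupOf P < ⊤ := by
    rw [lt_top_iff_ne_top, Ne, Subgroup.subgroupOf_eq_top]
    exact not_le_of_gt hD
  have h2 := Group.normalizerCondition_of_isNilpotent (G := P) _ h1
  obtain ⟨g, hg, hg'⟩ := SetLike.exists_of_lt h2
  refine ⟨g, g.2, fun h => hg' (Subgroup.mem_subgroupOf.2 h), ?_⟩
  rw [Subgroup.mem_normalizer_iff] at hg ⊢
  intro h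
  constructor
  · intro hh
    have := (hg ⟨h, hD.le hh⟩).1 hh
    exact this
  · intro hh
    have h3 : h ∈ P := by
      have := P.mul_mem (P.mul_mem (P.inv_mem g.2) (hD.le hh)) g.2
      simpa [mul_assoc] using this
    exact (hg ⟨h, h3⟩).2 hh

theorem sylow_TI {H : Type*} [Group H] [Finite H] (hE : EPO H) {p : ℕ} (hp : p.Prime)
    (P P' : Sylow p H) (h : (P : Subgroup H) ⊓ P' ≠ ⊥) : P = P' := by
  have : Fact p.Prime := ⟨hp⟩
  induction hn : Nat.card H - Nat.card ↥((P : Subgroup H) ⊓ P') using Nat.strong_induction_on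
    generalizing P P' with
  | _ n ih =>
  by_contra hne
  set D := (P : Subgroup H) ⊓ P' with hD
  have hDP : D < P := by
    refine lt_of_le_of_ne inf_le_left fun h1 => hne ?_
    have : (P : Subgroup H) ≤ P' := by rw [← h1]; exact inf_le_right
    exact Sylow.ext (P.3 P'.2 this).symm
  have hDP' : D < P' := by
    refine lt_of_le_of_ne inf_le_right fun h1 => hne ?_
    have : (P' : Subgroup H) ≤ P := by rw [← h1]; exact inf_le_left
    exact Sylow.ext (P'.3 P.2 this)
  have hDp : IsPGroup p D := P.2.to_le inf_le_left
  set L := Subgroup.normalizer (D : Set H) with hL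
  have hDL : D ≤ L := Subgroup.le_normalizer
  have hDL1 : D.subgroupOf L ≠ ⊥ := by
    rw [Ne, Subgroup.subgroupOf_eq_bot, disjoint_iff, inf_eq_left.2 hDL]; exact h
  obtain ⟨T, -, hTp, hTV, -⟩ := L2 (hE.sub L) hp (D.subgroupOf L) 
    (by rw [hL]; infer_instance) (hDp.comap_subtype) hDL1
  obtain ⟨P2, hP2⟩ := (hTp.map L.subtype).exists_le_sylow
  have key : ∀ Q : Sylow p H, D < Q → Q = P2 := by
    intro Q hDQ
    obtain ⟨g, hgQ, hgD, hgL⟩ := exists_normalizing (Q : Subgroup H) D Q.2 hDQ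
    have h1 : ∀ x ∈ (Q : Subgroup H), x ∈ L → x ∈ P2 := by
      intro x hx hxL
      apply hP2
      exact ⟨⟨x, hxL⟩, hTV ((Q : Subgroup H).subgroupOf L) Q.2.comap_subtype hx, rfl⟩
    have h2 : D < (Q : Subgroup H) ⊓ P2 := by
      rw [SetLike.lt_iff_le_and_exists]
      exact ⟨fun x hx => ⟨hDQ.le hx, h1 x (hDQ.le hx) (hDL hx)⟩, g, ⟨hgQ, h1 g hgQ hgL⟩, hgD⟩
    have h3 : Nat.card D < Nat.card ↥((Q : Subgroup H) ⊓ P2) := by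
      have := Set.ncard_lt_ncard (SetLike.coe_ssubset_coe.2 h2)
      rw [← Nat.card_coe_set_eq, ← Nat.card_coe_set_eq] at this
      exact this
    have h4 : Nat.card ↥((Q : Subgroup H) ⊓ P2) ≤ Nat.card H := Subgroup.card_le_card_group _
    refine ih _ ?_ Q P2 (fun h5 => ?_) rfl
    · omega
    · rw [h5] at h2; exact not_lt_bot h2
  exact hne ((key P hDP).trans (key P' hDP').symm)

/-- order of a Sylow subgroup -/
noncomputable def sa (p : ℕ) (H : Type*) [Group H] : ℕ := Nat.card (default : Sylow p H)

/-- index of a Sylow subgroup in its normaliser -/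
noncomputable def sn (p : ℕ) (H : Type*) [Group H] : ℕ := 
  Nat.card (Subgroup.normalizer ((default : Sylow p H) : Set H)) / Nat.card (default : Sylow p H)

theorem card_eq_sa {H : Type*} [Group H] [Finite H] {p : ℕ} (hp : p.Prime) (P : Sylow p H) :
    Nat.card P = sa p H := by
  have : Fact p.Prime := ⟨hp⟩
  exact Nat.card_congr (P.equiv default).toEquiv

theorem sa_eq {H : Type*} [Group H] [Finite H] {p : ℕ} (hp : p.Prime) :
    sa p H = p ^ (Nat.card H).factorization p := by
  have : Fact p.Prime := ⟨hp⟩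
  exact Sylow.card_eq_multiplicity _

theorem card_sylow_mul {H : Type*} [Group H] [Finite H] {p : ℕ} (hp : p.Prime) (P : Sylow p H) :
    Nat.card (Sylow p H) * Nat.card (Subgroup.normalizer ((P : Subgroup H) : Set H)) = Nat.card H := by
  have : Fact p.Prime := ⟨hp⟩
  rw [P.card_eq_index_normalizer, mul_comm]
  exact Subgroup.card_mul_index _

theorem card_norm_eq {H : Type*} [Group H] [Finite H] {p : ℕ} (hp : p.Prime) (P : Sylow p H) :
    Nat.card (Subgroup.normalizer ((P : Subgroup H) : Set H)) = sa p H * sn p H := by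
  have : Fact p.Prime := ⟨hp⟩
  have h0 : Nat.card (Subgroup.normalizer ((default : Sylow p H) : Set H)) = sa p H * sn p H := by
    rw [sa, sn]
    symm
    apply Nat.mul_div_cancel'
    exact Subgroup.card_dvd_of_le Subgroup.le_normalizer
  rw [← h0]
  have h1 := card_sylow_mul hp P
  have h2 := card_sylow_mul hp (default : Sylow p H)
  exact Nat.eq_of_mul_eq_mul_left Nat.card_pos (h1.trans h2.symm)

theorem card_sylow_mul' {H : Type*} [Group H] [Finite H] {p : ℕ} (hp : p.Prime) :
    Nat.card (Sylow p H) * (sa p H * sn p H) = Nat.card H := by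
  rw [← card_norm_eq hp (default : Sylow p H), card_sylow_mul hp]

theorem sn_cases {H : Type*} [Group H] [Finite H] (hE : EPO H) {p : ℕ} (hp : p.Prime)
    (hpH : p ∣ Nat.card H) : sn p H = 1 ∨ ((sn p H).Prime ∧ sn p H ≠ p) := by
  have : Fact p.Prime := ⟨hp⟩
  let P : Sylow p H := default
  set L := Subgroup.normalizer ((P : Subgroup H) : Set H) with hL
  have hPL : (P : Subgroup H) ≤ L := Subgroup.le_normalizer
  have hDL1 : (P : Subgroup H).subgroupOf L ≠ ⊥ := by
    rw [Ne, Subgroup.subgroupOf_eq_bot, disjoint_iff, inf_eq_left.2 hPL]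
    exact P.ne_bot_of_dvd_card hpH
  obtain ⟨T, -, hTp, hTV, n, hn, hn'⟩ := L2 (hE.sub L) hp ((P : Subgroup H).subgroupOf L) 
    (by rw [hL]; infer_instance) (P.2.comap_subtype) hDL1
  have h1 : T.map L.subtype = P := by
    apply P.3 (hTp.map _)
    intro x hx
    exact ⟨⟨x, hPL hx⟩, hTV _ P.2.comap_subtype hx, rfl⟩
  have h2 : Nat.card T = sa p H := by
    rw [← card_eq_sa hp P, ← h1]
    exact (Subgroup.card_map_of_injective L.subtype_injective).symm
  have h3 := card_norm_eq hp P
  rw [← hL, hn, h2] at h3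
  have h4 : n = sn p H := Nat.eq_of_mul_eq_mul_left Nat.card_pos h3
  rwa [← h4]


open scoped Pointwise in
theorem transfer_TI {H : Type*} [Group H] [Finite H] (hE : EPO H) {p : ℕ} (hp : p.Prime)
    (P : Sylow p H) (hN : Subgroup.normalizer ((P : Subgroup H) : Set H) = P)
    {A : Type*} [CommGroup A] (ϕ : (P : Subgroup H) →* A) (g : (P : Subgroup H)) :
    MonoidHom.transfer ϕ (g : H) = ϕ g ^ (P : Subgroup H).index := by
  classical
  have : Fact p.Prime := ⟨hp⟩
  let _ : Fintype (Quotient (MulAction.orbitRel (Subgroup.zpowers (g : H)) (H ⧸ (P : Subgroup H)))) :=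
    Fintype.ofFinite _
  let _ : Fintype (H ⧸ (P : Subgroup H)) := Fintype.ofFinite _
  rw [MonoidHom.transfer_eq_prod_quotient_orbitRel_zpowers_quot,
    Subgroup.index_eq_sum_minimalPeriod _ (g : H), ← Finset.prod_pow_eq_pow_sum]
  have key : ∀ (k : ℕ) (x : H) (hx : x⁻¹ * (g : H) ^ k * x ∈ (P : Subgroup H)), 
      ϕ ⟨x⁻¹ * (g : H) ^ k * x, hx⟩ = ϕ g ^ k := by
    intro k x hx
    by_cases h1 : (g : H) ^ k = 1
    · have h2 : g ^ k = 1 := by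
        apply Subtype.ext; simpa using h1
      rw [← map_pow, h2]
      congr 1
      apply Subtype.ext
      simp [h1]
    · have hPP : x⁻¹ • P = P := by
        apply sylow_TI hE hp
        intro hb
        have hm : x⁻¹ * (g : H) ^ k * x ∈ ((x⁻¹ • P : Sylow p H) : Subgroup H) ⊓ P := by
          refine ⟨?_, hx⟩
          change _ ∈ MulAut.conj x⁻¹ • (P : Subgroup H)
          refine (Subgroup.mem_smul_pointwise_iff_exists _ _ _).2 ⟨(g : H) ^ k, pow_mem g.2 k, ?_⟩
          rw [MulAut.smul_def, MulAut.conj_apply, inv_inv]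
        rw [hb, Subgroup.mem_bot] at hm
        apply h1
        have := congrArg (fun t => x * t * x⁻¹) hm
        simpa [mul_assoc] using this
      have hxP : x⁻¹ ∈ (P : Subgroup H) := by
        rw [← hN]
        exact Sylow.smul_eq_iff_mem_normalizer.1 hPP
      have e : (⟨x⁻¹ * (g : H) ^ k * x, hx⟩ : (P : Subgroup H)) = ⟨x⁻¹, hxP⟩ * g ^ k * ⟨x⁻¹, hxP⟩⁻¹ := by
        apply Subtype.ext; simp
      rw [e, map_mul, map_mul, map_inv, map_pow, mul_comm (ϕ _), mul_inv_cancel_right]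
  exact Finset.prod_congr rfl fun q _ => key _ _ _

theorem L5 {H : Type*} [Group H] [Finite H] (hE : EPO H) {p : ℕ} (hp : p.Prime)
    (hpH : p ∣ Nat.card H) (h1 : sn p H = 1) :
    ∃ K : Subgroup H, K.Normal ∧ K ≠ ⊤ ∧ ∃ k, K.index = p ^ k := by
  have : Fact p.Prime := ⟨hp⟩
  let P : Sylow p H := default
  have hN : Subgroup.normalizer ((P : Subgroup H) : Set H) = P := by
    symm
    apply Subgroup.eq_of_le_of_card_ge Subgroup.le_normalizer
    rw [card_norm_eq hp P, h1, mul_one]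
    exact (card_eq_sa hp P).ge
  let f := MonoidHom.transfer (Abelianization.of : (P : Subgroup H) →* Abelianization P)
  have hAp : IsPGroup p (Abelianization P) := P.2.to_quotient _
  refine ⟨f.ker, inferInstance, ?_, ?_⟩
  · intro hk
    have hnt : Nontrivial P := (Subgroup.nontrivial_iff_ne_bot _).2 (P.ne_bot_of_dvd_card hpH)
    have : Group.IsNilpotent P := P.2.isNilpotent
    have hlt := Group.IsSolvable.commutator_lt_top_of_nontrivial P
    apply hlt.ne
    rw [eq_top_iff]
    intro g _
    have h2 := transfer_TI hE hp P hN Abelianization.of g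
    have h3 : f (g : H) = 1 := by
      rw [← MonoidHom.mem_ker, hk]; trivial
    have h4 : (Abelianization.of g) ^ (P : Subgroup H).index = 1 := by rw [← h2]; exact h3
    have h5 : Abelianization.of g = 1 := by
      have hi : ¬ p ∣ (P : Subgroup H).index := P.not_dvd_index
      have := (hAp.powEquiv' hi).injective
      apply this
      simpa using h4
    rw [← Abelianization.ker_of]
    exact h5
  · rw [Subgroup.index_ker]
    exact (hAp.to_subgroup f.range).exists_card_eq


open Classical in
theorem count_p {H : Type*} [Group H] [Fintype H] (hE : EPO H) {p : ℕ} (hp : p.Prime) :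
    (Finset.univ.filter (fun g : H => orderOf g = p)).card
      = Nat.card (Sylow p H) * (sa p H - 1) := by
  have : Fact p.Prime := ⟨hp⟩
  let _ : Fintype (Sylow p H) := Fintype.ofFinite _
  have h1 : Finset.univ.filter (fun g : H => orderOf g = p)
      = (Finset.univ : Finset (Sylow p H)).biUnion 
        (fun P => Finset.univ.filter (fun g : H => g ∈ (P : Subgroup H) ∧ g ≠ 1)) := by
    ext g
    simp only [Finset.mem_filter, Finset.mem_univ, true_and, Finset.mem_biUnion]
    constructor
    · intro hg
      have hz : IsPGroup p (Subgroup.zpowers g) := 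
        IsPGroup.of_card (n := 1) (by rw [Nat.card_zpowers, hg, pow_one])
      obtain ⟨P, hP⟩ := hz.exists_le_sylow
      refine ⟨P, hP (Subgroup.mem_zpowers g), ?_⟩
      rintro rfl
      rw [orderOf_one] at hg
      exact hp.one_lt.ne hg
    · rintro ⟨P, hg, hg1⟩
      exact hE.orderOf_of_pow hp hg1 (pelem_of_pgroup P.2 hg)
  rw [h1, Finset.card_biUnion]
  · rw [Finset.sum_const_nat (m := sa p H - 1)]
    · rw [Finset.card_univ, Nat.card_eq_fintype_card]
    · intro P _
      have h2 : Finset.univ.filter (fun g : H => g ∈ (P : Subgroup H) ∧ g ≠ 1)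
        = (Finset.univ.filter (fun g : H => g ∈ (P : Subgroup H))).erase 1 := by
        ext g; simp [and_comm]
      rw [h2, Finset.card_erase_of_mem (by simp [one_mem]), ← card_eq_sa hp P, 
        Nat.card_eq_fintype_card, Fintype.card_subtype]
  · intro P _ P' _ hne
    rw [Function.onFun, Finset.disjoint_left]
    intro g hg hg'
    simp only [Finset.mem_filter, Finset.mem_univ, true_and] at hg hg'
    apply hne
    apply sylow_TI hE hp
    intro hb
    have : g ∈ (P : Subgroup H) ⊓ P' := ⟨hg.1, hg'.1⟩
    rw [hb, Subgroup.mem_bot] at this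
    exact hg.2 this

theorem count_all {H : Type*} [Group H] [Finite H] (hE : EPO H) :
    Nat.card H = 1 + ∑ p ∈ (Nat.card H).primeFactors, Nat.card (Sylow p H) * (sa p H - 1) := by
  classical
  let _ : Fintype H := Fintype.ofFinite H
  have h1 : (Finset.univ.erase (1 : H)).card = 
      ∑ p ∈ (Nat.card H).primeFactors, ((Finset.univ.erase (1 : H)).filter (fun g => orderOf g = p)).card := by
    apply Finset.card_eq_sum_card_fiberwise
    intro g hg
    have hg1 : g ≠ 1 := by simpa using hg
    simp only [Finset.mem_coe, Nat.mem_primeFactors]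
    exact ⟨hE g hg1, orderOf_dvd_natCard g, Nat.card_pos.ne'⟩
  have h2 : Nat.card H = 1 + (Finset.univ.erase (1 : H)).card := by
    rw [Finset.card_erase_of_mem (Finset.mem_univ _), Finset.card_univ, Nat.card_eq_fintype_card]
    have : 0 < Fintype.card H := Fintype.card_pos
    omega
  conv_lhs => rw [h2, h1]
  congr 1
  apply Finset.sum_congr rfl
  intro p hp
  have hp' := Nat.prime_of_mem_primeFactors hp
  rw [← count_p hE hp']
  congr 1
  ext g
  simp only [Finset.mem_filter, Finset.mem_erase, Finset.mem_univ, and_true, true_and, and_iff_right_iff_imp]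
  rintro hg rfl
  rw [orderOf_one] at hg
  exact hp'.one_lt.ne hg

theorem sa_pos {H : Type*} [Group H] [Finite H] {p : ℕ} : 0 < sa p H := Nat.card_pos

theorem sn_pos {H : Type*} [Group H] [Finite H] {p : ℕ} (hp : p.Prime) : 0 < sn p H := by
  have := card_norm_eq hp (default : Sylow p H)
  have h2 : 0 < Nat.card (Subgroup.normalizer (((default : Sylow p H) : Subgroup H) : Set H)) := Nat.card_pos
  rw [this] at h2
  exact Nat.pos_of_mul_pos_left h2

/-- The contribution of a prime. -/
noncomputable def sF (p : ℕ) (H : Type*) [Group H] : ℚ := (1 - 1 / (sa p H : ℚ)) / (sn p H : ℚ)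

theorem sum_sF {H : Type*} [Group H] [Finite H] (hE : EPO H) :
    ∑ p ∈ (Nat.card H).primeFactors, sF p H = 1 - 1 / (Nat.card H : ℚ) := by
  have hc : (0 : ℚ) < Nat.card H := by exact_mod_cast Nat.card_pos
  have h := count_all hE
  have h' : (Nat.card H : ℚ) = 1 + ∑ p ∈ (Nat.card H).primeFactors, (Nat.card H : ℚ) * sF p H := by
    conv_lhs => rw [h]
    push_cast
    congr 1
    apply Finset.sum_congr rfl
    intro p hp
    have hp' := Nat.prime_of_mem_primeFactors hp
    have e : (Nat.card H : ℚ) = Nat.card (Sylow p H) * (sa p H * sn p H) := by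
      exact_mod_cast (card_sylow_mul' (H := H) hp').symm
    have ha : (0 : ℚ) < sa p H := by exact_mod_cast sa_pos
    have hn : (0 : ℚ) < sn p H := by exact_mod_cast sn_pos hp'
    rw [e, sF, Nat.cast_sub (show 1 ≤ sa p H from sa_pos)]
    field_simp
    push_cast
    ring
  rw [← Finset.mul_sum] at h'
  field_simp
  linarith


theorem TI_elem {H : Type*} [Group H] [Finite H] (hE : EPO H) {p : ℕ} (hp : p.Prime)
    (P P' : Sylow p H) {x : H} (hx : x ≠ 1) (h1 : x ∈ (P : Subgroup H)) (h2 : x ∈ (P' : Subgroup H)) :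
    P = P' := by
  apply sylow_TI hE hp
  intro hb
  have : x ∈ (P : Subgroup H) ⊓ P' := ⟨h1, h2⟩
  rw [hb, Subgroup.mem_bot] at this
  exact hx this

open scoped Pointwise in
theorem mem_norm_of_conj {H : Type*} [Group H] [Finite H] (hE : EPO H) {p : ℕ} (hp : p.Prime)
    (P : Sylow p H) {x g : H} (hx : x ≠ 1) (h1 : x ∈ (P : Subgroup H)) 
    (h2 : g * x * g⁻¹ ∈ (P : Subgroup H)) :
    g ∈ Subgroup.normalizer ((P : Subgroup H) : Set H) := by
  apply Sylow.smul_eq_iff_mem_normalizer.1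
  refine TI_elem hE hp (g • P) P (x := g * x * g⁻¹) (by simpa using hx) ?_ h2
  change _ ∈ MulAut.conj g • (P : Subgroup H)
  exact (Subgroup.mem_smul_pointwise_iff_exists _ _ _).2 ⟨x, h1, rfl⟩

theorem norm_le_norm {H : Type*} [Group H] [Finite H] (hE : EPO H) {p : ℕ} (hp : p.Prime)
    (P : Sylow p H) (V : Subgroup H) (hV : V ≠ ⊥) (hVP : V ≤ P) :
    Subgroup.normalizer (V : Set H) ≤ Subgroup.normalizer ((P : Subgroup H) : Set H) := by
  intro g hg
  obtain ⟨v, hv⟩ := Subgroup.ne_bot_iff_exists_ne_one.1 hV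
  refine mem_norm_of_conj hE hp P (x := v) (by simpa using hv) (hVP v.2) (hVP ?_)
  exact (Subgroup.mem_normalizer_iff.1 hg v).1 v.2

theorem sn_sub {S : Type*} [Group S] [Finite S] (hE : EPO S) (R : Subgroup S) {p : ℕ} (hp : p.Prime)
    (hpR : p ∣ Nat.card R) : sn p R = 1 ∨ sn p R = sn p S := by
  have : Fact p.Prime := ⟨hp⟩
  rcases sn_cases (hE.sub R) hp hpR with h | ⟨h, hne⟩
  · exact Or.inl h
  right
  let P0 : Sylow p R := default
  obtain ⟨P, hP⟩ := (P0.2.map R.subtype).exists_le_sylow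
  have hb : (P0 : Subgroup R).map R.subtype ≠ ⊥ := by
    intro h
    rw [Subgroup.map_eq_bot_iff_of_injective _ R.subtype_injective] at h
    exact P0.ne_bot_of_dvd_card hpR h
  have h1 := norm_le_norm hE hp P _ hb hP
  have h2 : (Subgroup.normalizer ((P0 : Subgroup R) : Set R)).map R.subtype ≤ 
      Subgroup.normalizer ((P : Subgroup S) : Set S) := 
    (Subgroup.le_normalizer_map R.subtype).trans h1
  have h3 := Subgroup.card_dvd_of_le h2
  rw [Subgroup.card_map_of_injective R.subtype_injective, card_norm_eq hp, card_norm_eq hp] at h3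
  have h4 : sn p R ∣ sa p S * sn p S := (Dvd.intro_left _ rfl).trans h3
  rw [h.dvd_mul] at h4
  rcases h4 with h4 | h4
  · rw [sa_eq hp] at h4
    exact absurd ((Nat.prime_dvd_prime_iff_eq h hp).1 (h.dvd_of_dvd_pow h4)) hne
  · rcases sn_cases hE hp (hpR.trans R.card_subgroup_dvd_card) with h5 | ⟨h5, -⟩
    · rw [h5] at h4
      exact absurd (Nat.dvd_one.1 h4) h.one_lt.ne'
    · exact (Nat.prime_dvd_prime_iff_eq h h5).1 h4

theorem dvd_sa {H : Type*} [Group H] [Finite H] {p : ℕ} (hp : p.Prime) (h : p ∣ Nat.card H) :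
    p ∣ sa p H := by
  rw [sa_eq hp]
  apply dvd_pow_self
  exact (hp.factorization_pos_of_dvd Nat.card_pos.ne' h).ne'

theorem le_sa {H : Type*} [Group H] [Finite H] {p : ℕ} (hp : p.Prime) (h : p ∣ Nat.card H) :
    p ≤ sa p H := Nat.le_of_dvd sa_pos (dvd_sa hp h)

theorem sa_mul_sn_dvd {H : Type*} [Group H] [Finite H] {p : ℕ} (hp : p.Prime) :
    sa p H * sn p H ∣ Nat.card H := Dvd.intro_left _ (card_sylow_mul' hp)

theorem sF_lower {H : Type*} [Group H] [Finite H] {p : ℕ} (hp : p.Prime) (h : p ∣ Nat.card H) :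
    1 / (2 * (sn p H : ℚ)) ≤ sF p H := by
  have hn : (0 : ℚ) < sn p H := by exact_mod_cast sn_pos hp
  have ha : (2 : ℚ) ≤ sa p H := by exact_mod_cast hp.two_le.trans (le_sa hp h)
  have h1 : 1 / (sa p H : ℚ) ≤ 1 / 2 := one_div_le_one_div_of_le (by norm_num) ha
  rw [sF, ← div_div]
  gcongr
  linarith

theorem sF_upper {H : Type*} [Group H] [Finite H] {p : ℕ} (hp : p.Prime) :
    sF p H < 1 / (sn p H : ℚ) := by
  have hn : (0 : ℚ) < sn p H := by exact_mod_cast sn_pos hp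
  have ha : (0 : ℚ) < sa p H := by exact_mod_cast sa_pos
  have : 0 < 1 / (sa p H : ℚ) := by positivity
  rw [sF]
  gcongr
  linarith

theorem sF_pos {H : Type*} [Group H] [Finite H] {p : ℕ} (hp : p.Prime) (h : p ∣ Nat.card H) :
    0 < sF p H := by
  have hn : (0 : ℚ) < sn p H := by exact_mod_cast sn_pos hp
  exact lt_of_lt_of_le (by positivity) (sF_lower hp h)

theorem sum_sub_le {H : Type*} [Group H] [Finite H] (hE : EPO H) (s : Finset ℕ) 
    (hs : s ⊆ (Nat.card H).primeFactors) : ∑ p ∈ s, sF p H ≤ 1 - 1 / (Nat.card H : ℚ) := by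
  rw [← sum_sF hE]
  apply Finset.sum_le_sum_of_subset_of_nonneg hs
  intro p hp _
  exact (sF_pos (Nat.prime_of_mem_primeFactors hp) (Nat.dvd_of_mem_primeFactors hp)).le

theorem sn_eq_of_other {H : Type*} [Group H] [Finite H] (hE : EPO H) {p : ℕ} (hp : p.Prime)
    (hpH : p ∣ Nat.card H) (h1 : sn p H = 1) {r : ℕ} (hr : r.Prime) (hrH : r ∣ Nat.card H) (hrp : r ≠ p) :
    sn r H = p := by
  have : Fact r.Prime := ⟨hr⟩
  obtain ⟨K, hK, hKt, k, hk⟩ := L5 hE hp hpH h1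
  have hpk : p ∣ K.index := by
    rw [hk]
    apply dvd_pow_self
    rintro rfl
    exact hKt (Subgroup.index_eq_one.1 (by simpa using hk))
  have hrK : r ∣ Nat.card K := by
    rw [← K.card_mul_index, hr.dvd_mul, hk] at hrH
    rcases hrH with h | h
    · exact h
    · exact absurd ((Nat.prime_dvd_prime_iff_eq hr hp).1 (hr.dvd_of_dvd_pow h)) hrp
  let Q0 : Sylow r K := default
  have hF := Q0.normalizer_sup_eq_top
  obtain ⟨Q, hQ⟩ := (Q0.2.map K.subtype).exists_le_sylow
  have hb : (Q0 : Subgroup K).map K.subtype ≠ ⊥ := by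
    intro h
    rw [Subgroup.map_eq_bot_iff_of_injective _ K.subtype_injective] at h
    exact Q0.ne_bot_of_dvd_card hrK h
  have h2 := norm_le_norm hE hr Q _ hb hQ
  have h3 : Subgroup.normalizer ((Q : Subgroup H) : Set H) ⊔ K = ⊤ := by
    rw [eq_top_iff, ← hF]
    exact sup_le_sup_right h2 K
  have h4 : K.index ∣ Nat.card (Subgroup.normalizer ((Q : Subgroup H) : Set H)) := by
    rw [← Subgroup.relIndex_top_right, ← h3, Subgroup.relIndex_sup_right]
    exact Subgroup.relIndex_dvd_card _ _
  have h5 := hpk.trans h4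
  rw [card_norm_eq hr, hp.dvd_mul] at h5
  rcases h5 with h5 | h5
  · rw [sa_eq hr] at h5
    exact absurd ((Nat.prime_dvd_prime_iff_eq hp hr).1 (hp.dvd_of_dvd_pow h5)).symm hrp
  · rcases sn_cases hE hr hrH with h6 | ⟨h6, -⟩
    · rw [h6] at h5
      exact absurd (Nat.dvd_one.1 h5) hp.one_lt.ne'
    · exact ((Nat.prime_dvd_prime_iff_eq hp h6).1 h5).symm

theorem L7 {H : Type*} [Group H] [Finite H] (hE : EPO H) {p : ℕ} (hp : p.Prime)
    (hpH : p ∣ Nat.card H) (h1 : sn p H = 1) {q : ℕ} (hq : q.Prime) (hqH : q ∣ Nat.card H) (hqp : q ≠ p) :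
    Nat.card (Sylow q H) = 1 ∧ sn q H = p := by
  have hsn : ∀ r, r.Prime → r ∣ Nat.card H → r ≠ p → sn r H = p := fun r hr hrH hrp => 
    sn_eq_of_other hE hp hpH h1 hr hrH hrp
  refine ⟨?_, hsn q hq hqH hqp⟩
  have hH0 : Nat.card H ≠ 0 := Nat.card_pos.ne'
  have hH : (0 : ℚ) < Nat.card H := by exact_mod_cast Nat.card_pos
  have hp0 : (0 : ℚ) < p := by exact_mod_cast hp.pos
  have ha : (0 : ℚ) < sa p H := by exact_mod_cast sa_pos
  have hiH : 0 < 1 / (Nat.card H : ℚ) := by positivity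
  have hFp : sF p H = 1 - 1 / (sa p H : ℚ) := by rw [sF, h1]; simp
  have hmem : ∀ r, r.Prime → r ∣ Nat.card H → r ∈ (Nat.card H).primeFactors := fun r hr h => 
    Nat.mem_primeFactors.2 ⟨hr, h, hH0⟩
  have hlow : ∀ r, r.Prime → r ∣ Nat.card H → r ≠ p → 1 / (2 * (p : ℚ)) ≤ sF r H := by
    intro r hr hrH hrp
    have := sF_lower hr hrH
    rwa [hsn r hr hrH hrp] at this
  have hsap : sa p H = p := by
    have h2 := sum_sub_le hE {p, q} (by
      intro r hr
      simp only [Finset.mem_insert, Finset.mem_singleton] at hr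
      rcases hr with rfl | rfl
      · exact hmem _ hp hpH
      · exact hmem _ hq hqH)
    rw [Finset.sum_pair hqp.symm, hFp] at h2
    have h3 := hlow q hq hqH hqp
    have h4 : 1 / (2 * (p : ℚ)) < 1 / (sa p H : ℚ) := by linarith
    have h5 : (sa p H : ℚ) < 2 * p := lt_of_one_div_lt_one_div (by positivity) h4
    have h6 : sa p H < 2 * p := by exact_mod_cast h5
    obtain ⟨c, hc⟩ := dvd_sa hp hpH
    have hcpos : 0 < c := by
      rcases Nat.eq_zero_or_pos c with h | h
      · rw [h, mul_zero] at hc; exact absurd hc sa_pos.ne'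
      · exact h
    have : c < 2 := by
      by_contra hcon
      push Not at hcon
      rw [hc] at h6
      nlinarith [hp.pos]
    have : c = 1 := by omega
    rw [hc, this, mul_one]
  have hpf : (Nat.card H).primeFactors = {p, q} := by
    ext r
    simp only [Finset.mem_insert, Finset.mem_singleton]
    constructor
    · intro hr
      by_contra hcon
      push Not at hcon
      have hr1 := Nat.prime_of_mem_primeFactors hr
      have hr2 := Nat.dvd_of_mem_primeFactors hr
      have h2 := sum_sub_le hE {p, q, r} (by
        intro r' hr'
        simp only [Finset.mem_insert, Finset.mem_singleton] at hr'
        rcases hr' with rfl | rfl | rfl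
        · exact hmem _ hp hpH
        · exact hmem _ hq hqH
        · exact hr)
      rw [Finset.sum_insert (by simp [hqp.symm, hcon.1.symm]), Finset.sum_pair (Ne.symm hcon.2), hFp, hsap] at h2
      have h3 := hlow q hq hqH hqp
      have h4 := hlow r hr1 hr2 hcon.1
      have h5 : 1 / (p : ℚ) = 1 / (2 * (p : ℚ)) + 1 / (2 * (p : ℚ)) := by field_simp; norm_num
      linarith
    · rintro (rfl | rfl)
      · exact hmem _ hp hpH
      · exact hmem _ hq hqH
  have hcard : Nat.card H = p * sa q H := by
    conv_lhs => rw [← Nat.prod_factorization_pow_eq_self hH0]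
    rw [Finsupp.prod, Nat.support_factorization, hpf, Finset.prod_pair hqp.symm, ← sa_eq hp, ← sa_eq hq, hsap]
  have h2 := card_sylow_mul' (H := H) hq
  rw [hsn q hq hqH hqp] at h2
  have h3 : Nat.card (Sylow q H) * (sa q H * p) = 1 * (sa q H * p) := by
    rw [h2, hcard]; ring
  exact Nat.eq_of_mul_eq_mul_right (Nat.mul_pos sa_pos hp.pos) h3


section
variable {S : Type*} [Group S] [Finite S]

theorem simple_card [IsSimpleGroup S] (hnc : ∃ a b : S, a * b ≠ b * a) {p : ℕ} (hp : p.Prime) (k : ℕ) :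
    Nat.card S ≠ p ^ k := by
  intro h
  have : Fact p.Prime := ⟨hp⟩
  have hP : IsPGroup p S := IsPGroup.of_card h
  have : Group.IsNilpotent S := hP.isNilpotent
  obtain ⟨a, b, hab⟩ := hnc
  exact hab (IsSimpleGroup.comm_iff_isSolvable.2 inferInstance a b)

theorem simple_sn [IsSimpleGroup S] (hnc : ∃ a b : S, a * b ≠ b * a) (hE : EPO S) {p : ℕ} (hp : p.Prime)
    (hpS : p ∣ Nat.card S) : (sn p S).Prime ∧ sn p S ≠ p := by
  rcases sn_cases hE hp hpS with h | h
  · exfalso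
    obtain ⟨K, hK, hKt, k, hk⟩ := L5 hE hp hpS h
    rcases hK.eq_bot_or_eq_top with h1 | h1
    · rw [h1, Subgroup.index_bot] at hk
      exact simple_card hnc hp k hk
    · exact hKt h1
  · exact h

/-- All Sylow normaliser indices agree with those of the ambient group. -/
def FullSub (R : Subgroup S) : Prop := ∀ p ∈ (Nat.card R).primeFactors, sn p R = sn p S

/-- The hypothesis on `S`. -/
def StarProp (S : Type*) [Group S] : Prop :=
  ∀ s t s' : S, (orderOf s).Prime → (orderOf t).Prime →
    orderOf s ≠ orderOf t → s' ∉ Subgroup.zpowers s → 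
    ∃ R : Subgroup S, s ∈ R ∧ s' ∉ R ∧ (∃ t' ∈ R, orderOf t' = orderOf t) ∧ 
      ∀ B : Subgroup S, R ≤ B → B ≠ ⊤ → 
        (∀ α : S ≃* S, R.map α.toMonoidHom = R → B.map α.toMonoidHom = B) → B ≤ R

theorem star2 [IsSimpleGroup S] (hnc : ∃ a b : S, a * b ≠ b * a) (hE : EPO S) (hst : StarProp S)
    {p q : ℕ} (hp : p.Prime) (hq : q.Prime) (hpq : p ≠ q) (hpS : p ∣ Nat.card S) (hqS : q ∣ Nat.card S) :
    ∃ R : Subgroup S, R ≠ ⊤ ∧ p ∣ Nat.card R ∧ q ∣ Nat.card R ∧ (FullSub R ∨ sn q S = p) := by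
  have : Fact p.Prime := ⟨hp⟩
  have : Fact q.Prime := ⟨hq⟩
  obtain ⟨hl, hlp⟩ := simple_sn hnc hE hp hpS
  have : Fact (sn p S).Prime := ⟨hl⟩
  let P : Sylow p S := default
  let B := Subgroup.normalizer ((P : Subgroup S) : Set S)
  have hpP : p ∣ Nat.card P := by rw [card_eq_sa hp P]; exact dvd_sa hp hpS
  obtain ⟨s, hs⟩ := exists_prime_orderOf_dvd_card' p hpP
  have hlB : sn p S ∣ Nat.card B := by
    rw [card_norm_eq hp P]; exact Dvd.intro_left _ rfl
  obtain ⟨s', hs'⟩ := exists_prime_orderOf_dvd_card' (sn p S) hlB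
  obtain ⟨t, ht⟩ := exists_prime_orderOf_dvd_card' q hqS
  have hs0 : orderOf (s : S) = p := by rw [Subgroup.orderOf_coe]; exact hs
  have hs'0 : orderOf (s' : S) = sn p S := by rw [Subgroup.orderOf_coe]; exact hs'
  have hss' : (s' : S) ∉ Subgroup.zpowers (s : S) := by
    intro h
    have := orderOf_dvd_of_mem_zpowers h
    rw [hs0, hs'0] at this
    exact hlp ((Nat.prime_dvd_prime_iff_eq hl hp).1 this)
  obtain ⟨R, hsR, hs'R, ⟨t', ht'R, ht'⟩, hR⟩ := hst s t s' (by rw [hs0]; exact hp) (by rw [ht]; exact hq)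
    (by rw [hs0, ht]; exact hpq) hss'
  have hone : ∀ x : S, orderOf x = p → x ≠ 1 := by
    rintro x hx rfl
    rw [orderOf_one] at hx
    exact hp.one_lt.ne hx
  have hpR : p ∣ Nat.card R := by
    have := Subgroup.orderOf_dvd_natCard R hsR
    rwa [hs0] at this
  have hqR : q ∣ Nat.card R := by
    have := Subgroup.orderOf_dvd_natCard R ht'R
    rwa [ht', ht] at this
  have hRt : R ≠ ⊤ := by rintro rfl; exact hs'R trivial
  refine ⟨R, hRt, hpR, hqR, ?_⟩
  -- the Sylow p-subgroup of R is not normal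
  have hnn : ¬ ∀ x ∈ R, orderOf x = p → x ∈ (P : Subgroup S) := by
    intro hall
    apply hs'R
    refine hR B ?_ ?_ ?_ s'.2
    · intro r hr
      refine mem_norm_of_conj hE hp P (hone _ hs0) s.2 (hall _ ?_ ?_)
      · exact mul_mem (mul_mem hr hsR) (inv_mem hr)
      · exact ((MulAut.conj r).orderOf_eq (s : S)).trans hs0
    · intro hB
      have hPn : (P : Subgroup S).Normal := Subgroup.normalizer_eq_top_iff.1 hB
      rcases hPn.eq_bot_or_eq_top with h | h
      · exact P.ne_bot_of_dvd_card hpS h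
      · obtain ⟨k, hk⟩ := P.2.exists_card_eq
        apply simple_card hnc hp k
        rw [← hk, h, Subgroup.card_top]
    · intro α hα
      have h1 : (P : Subgroup S).map α.toMonoidHom = P := by
        have hmp : IsPGroup p ((P : Subgroup S).map α.toMonoidHom) := P.2.map _
        have hc : Nat.card ((P : Subgroup S).map α.toMonoidHom) = Nat.card P := 
          Subgroup.card_map_of_injective α.injective
        obtain ⟨P1, hP1⟩ := hmp.exists_le_sylow
        have h2 : (P : Subgroup S).map α.toMonoidHom = P1 := by
          apply Subgroup.eq_of_le_of_card_ge hP1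
          rw [hc, card_eq_sa hp P, ← card_eq_sa hp P1]
        have hαs : orderOf (α (s : S)) = p := by rw [α.orderOf_eq, hs0]
        have h3 : α (s : S) ∈ R := by
          rw [← hα]; exact ⟨s, hsR, rfl⟩
        have h4 : P1 = P := TI_elem hE hp P1 P (hone _ hαs) (hP1 ⟨s, s.2, rfl⟩) (hall _ h3 hαs)
        rw [h2, h4]
      have h5 := Subgroup.map_equiv_normalizer_eq (P : Subgroup S) α
      rw [h1] at h5
      exact h5
  have hns : Nat.card (Sylow p R) ≠ 1 := by
    intro h1
    apply hnn
    have hsub : Subsingleton (Sylow p R) := (Nat.card_eq_one_iff_unique.1 h1).1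
    have hmemP0 : ∀ (P0 : Sylow p R) (x : R), orderOf x = p → x ∈ (P0 : Subgroup R) := by
      intro P0 x hx
      have hz : IsPGroup p (Subgroup.zpowers x) := 
        IsPGroup.of_card (n := 1) (by rw [Nat.card_zpowers, hx, pow_one])
      obtain ⟨P1, hP1⟩ := hz.exists_le_sylow
      rw [Subsingleton.elim P0 P1]
      exact hP1 (Subgroup.mem_zpowers x)
    let P0 : Sylow p R := default
    obtain ⟨P1, hP1⟩ := (P0.2.map R.subtype).exists_le_sylow
    have hin : ∀ x ∈ R, orderOf x = p → x ∈ (P1 : Subgroup S) := by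
      intro x hx hxp
      exact hP1 ⟨⟨x, hx⟩, hmemP0 P0 ⟨x, hx⟩ (by rw [← hxp]; exact Subgroup.orderOf_mk x hx), rfl⟩
    have : P1 = P := TI_elem hE hp P1 P (hone _ hs0) (hin _ hsR hs0) s.2
    rwa [this] at hin
  by_contra hcon
  push Not at hcon
  obtain ⟨hnf, hqp⟩ := hcon
  unfold FullSub at hnf
  push Not at hnf
  obtain ⟨r, hr, hrn⟩ := hnf
  have hr1 := Nat.prime_of_mem_primeFactors hr
  have hr2 := Nat.dvd_of_mem_primeFactors hr
  have hr3 : sn r R = 1 := (sn_sub hE R hr1 hr2).resolve_right hrn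
  by_cases hrp : r = p
  · subst hrp
    have h7 := (L7 (hE.sub R) hr1 hr2 hr3 hq hqR hpq.symm).2
    rcases sn_sub hE R hq hqR with h | h
    · rw [h] at h7; exact hr1.one_lt.ne h7
    · exact hqp (h.symm.trans h7)
  · exact hns (L7 (hE.sub R) hr1 hr2 hr3 hp hpR (Ne.symm hrp)).1

end


section
variable {S : Type*} [Group S] [Finite S]

theorem sa_sub_dvd (R : Subgroup S) {p : ℕ} (hp : p.Prime) : sa p R ∣ sa p S := by
  rw [sa_eq hp, sa_eq hp]
  apply pow_dvd_pow
  exact (Nat.factorization_le_iff_dvd Nat.card_pos.ne' Nat.card_pos.ne').2 R.card_subgroup_dvd_card p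

theorem sF_mono (R : Subgroup S) {p : ℕ} (hp : p.Prime) (h : sn p R = sn p S) : sF p R ≤ sF p S := by
  have h1 : (sa p R : ℚ) ≤ sa p S := by 
    exact_mod_cast Nat.le_of_dvd sa_pos (sa_sub_dvd R hp)
  have ha : (0 : ℚ) < sa p R := by exact_mod_cast sa_pos
  have hn : (0 : ℚ) < sn p S := by exact_mod_cast sn_pos hp
  rw [sF, sF, h]
  gcongr

theorem mul_le_card {p : ℕ} (hp : p.Prime) (H : Type*) [Group H] [Finite H] : sa p H * sn p H ≤ Nat.card H :=
  Nat.le_of_dvd Nat.card_pos (sa_mul_sn_dvd hp)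

theorem one_div_add_le {p q : ℕ} (hp : p.Prime) (hq : q.Prime) (h : p ≠ q) : 
    1 / (p : ℚ) + 1 / (q : ℚ) ≤ 5 / 6 := by
  wlog hlt : p < q generalizing p q
  · rw [add_comm]; exact this hq hp h.symm (by omega)
  have h1 := hp.two_le
  have h2 : 3 ≤ q := by omega
  have h3 : 1 / (p : ℚ) ≤ 1 / 2 := one_div_le_one_div_of_le (by norm_num) (by exact_mod_cast h1)
  have h4 : 1 / (q : ℚ) ≤ 1 / 3 := one_div_le_one_div_of_le (by norm_num) (by exact_mod_cast h2)
  linarith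

theorem caseB1 (hE : EPO S) (hsn : ∀ p, p.Prime → p ∣ Nat.card S → (sn p S).Prime ∧ sn p S ≠ p)
    (R : Subgroup S) (hRt : R ≠ ⊤) (hF : FullSub R) 
    (hpi : (Nat.card R).primeFactors = (Nat.card S).primeFactors) : False := by
  have hER := hE.sub R
  have hlt : Nat.card R < Nat.card S := by
    apply lt_of_le_of_ne (Subgroup.card_le_card_group R)
    intro h
    exact hRt (Subgroup.eq_top_of_card_eq R h)
  have hR0 : (0 : ℚ) < Nat.card R := by exact_mod_cast Nat.card_pos
  have hS0 : (0 : ℚ) < Nat.card S := by exact_mod_cast Nat.card_pos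
  have hiS : 0 < 1 / (Nat.card S : ℚ) := by positivity
  have hinv : 1 / (Nat.card S : ℚ) < 1 / (Nat.card R : ℚ) := 
    one_div_lt_one_div_of_lt hR0 (by exact_mod_cast hlt)
  have e1 := sum_sF hE
  have e2 := sum_sF hER
  rw [hpi] at e2
  have hmono : ∀ p ∈ (Nat.card S).primeFactors, sF p R ≤ sF p S := fun p hp => 
    sF_mono R (Nat.prime_of_mem_primeFactors hp) (hF p (by rw [hpi]; exact hp))
  obtain ⟨p, hpS, hpl⟩ : ∃ p ∈ (Nat.card S).primeFactors, sF p R < sF p S := by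
    apply Finset.exists_lt_of_sum_lt
    rw [e1, e2]; linarith
  have hdiff : sF p S - sF p R ≤ 1 / (Nat.card R : ℚ) - 1 / (Nat.card S : ℚ) := by
    have h1 : ∑ r ∈ (Nat.card S).primeFactors, (sF r S - sF r R) 
        = 1 / (Nat.card R : ℚ) - 1 / (Nat.card S : ℚ) := by
      rw [Finset.sum_sub_distrib, e1, e2]; ring
    rw [← h1]
    exact Finset.single_le_sum (f := fun r => sF r S - sF r R) (fun r hr => sub_nonneg.2 (hmono r hr)) hpS
  have hp := Nat.prime_of_mem_primeFactors hpS
  have hpR' : p ∈ (Nat.card R).primeFactors := by rw [hpi]; exact hpS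
  have hpR := Nat.dvd_of_mem_primeFactors hpR'
  have hsnp := hF p hpR'
  have hn0 : (0 : ℚ) < sn p S := by exact_mod_cast sn_pos hp
  have haR : (0 : ℚ) < sa p R := by exact_mod_cast sa_pos
  have haS : (0 : ℚ) < sa p S := by exact_mod_cast sa_pos
  -- the order of the Sylow subgroup at least doubles
  have h2a : 2 * sa p R ≤ sa p S := by
    obtain ⟨c, hc⟩ := sa_sub_dvd R hp
    have : c ≠ 0 := by
      rintro rfl
      rw [mul_zero] at hc; exact sa_pos.ne' hc
    have : c ≠ 1 := by
      rintro rfl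
      rw [mul_one] at hc
      rw [sF, sF, hc, hsnp] at hpl
      exact lt_irrefl _ hpl
    rw [hc, mul_comm]
    exact Nat.mul_le_mul_left _ (by omega)
  have h3 : 1 / (2 * ((sa p R : ℚ) * sn p S)) ≤ sF p S - sF p R := by
    have h4 : 1 / (sa p S : ℚ) ≤ 1 / (2 * (sa p R : ℚ)) := 
      one_div_le_one_div_of_le (by positivity) (by exact_mod_cast h2a)
    rw [sF, sF, hsnp]
    have h5 : 1 / (2 * ((sa p R : ℚ) * sn p S)) = (1 / (2 * (sa p R : ℚ))) / sn p S := by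
      field_simp
    have h6 : 1 / (sa p R : ℚ) = 1 / (2 * (sa p R : ℚ)) + 1 / (2 * (sa p R : ℚ)) := by
      field_simp; norm_num
    rw [h5, ← sub_div]
    gcongr
    linarith
  have h7 : (Nat.card R : ℚ) < 2 * ((sa p R : ℚ) * sn p S) := by
    apply lt_of_one_div_lt_one_div (by positivity)
    linarith
  have h7' : Nat.card R < 2 * (sa p R * sn p R) := by rw [hsnp]; exact_mod_cast h7
  have hcard : Nat.card R = sa p R * sn p R := by
    obtain ⟨c, hc⟩ := sa_mul_sn_dvd (H := R) hp
    have hc0 : c ≠ 0 := by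
      rintro rfl
      rw [mul_zero] at hc; exact Nat.card_pos.ne' hc
    have hc2 : c < 2 := by
      by_contra hcon
      push Not at hcon
      have := Nat.mul_le_mul_left (sa p R * sn p R) hcon
      omega
    have : c = 1 := by omega
    rw [hc, this, mul_one]
  obtain ⟨hl, hlp⟩ := hsn p hp (Nat.dvd_of_mem_primeFactors hpS)
  set l := sn p S with hldef
  rw [hsnp] at hcard
  have hlR : l ∣ Nat.card R := by rw [hcard]; exact Dvd.intro_left _ rfl
  have hsal : sa l R = l := by
    obtain ⟨k, hk⟩ : ∃ k, sa p R = p ^ k := ⟨_, sa_eq hp⟩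
    rw [sa_eq hl, hcard, hk, Nat.factorization_mul (pow_ne_zero _ hp.ne_zero) hl.ne_zero]
    simp [hp.factorization, hl.factorization, Nat.factorization_pow, hlp.symm]
  have hpf : (Nat.card R).primeFactors = {p, l} := by
    obtain ⟨k, hk⟩ : ∃ k, sa p R = p ^ k := ⟨_, sa_eq hp⟩
    ext r
    simp only [Finset.mem_insert, Finset.mem_singleton]
    constructor
    · intro hr
      have hr1 := Nat.prime_of_mem_primeFactors hr
      have hr2 := Nat.dvd_of_mem_primeFactors hr
      rw [hcard, hr1.dvd_mul, hk] at hr2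
      rcases hr2 with h | h
      · exact Or.inl ((Nat.prime_dvd_prime_iff_eq hr1 hp).1 (hr1.dvd_of_dvd_pow h))
      · exact Or.inr ((Nat.prime_dvd_prime_iff_eq hr1 hl).1 h)
    · rintro (rfl | rfl)
      · exact hpR'
      · exact Nat.mem_primeFactors.2 ⟨hl, hlR, Nat.card_pos.ne'⟩
  have hlm : l ∈ (Nat.card R).primeFactors := by rw [hpf]; simp
  have e3 := sum_sF hER
  rw [hpf, Finset.sum_pair hlp.symm, sF, sF, hsal, hsnp, hcard, hF l hlm] at e3
  have hll := (hsn l hl (hlR.trans R.card_subgroup_dvd_card)).1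
  have hll2 : (2 : ℚ) ≤ sn l S := by exact_mod_cast hll.two_le
  have hl2 : (2 : ℚ) ≤ l := by exact_mod_cast hl.two_le
  have e4 : (1 - 1 / (l : ℚ)) / sn l S = 1 - 1 / (l : ℚ) := by
    push_cast at e3
    have : (1 - 1 / (sa p R : ℚ)) / l = 1 / l - 1 / (sa p R * l) := by
      field_simp
    linarith
  have h8 : 0 < 1 - 1 / (l : ℚ) := by
    have : 1 / (l : ℚ) ≤ 1 / 2 := one_div_le_one_div_of_le (by norm_num) hl2
    linarith
  rw [div_eq_iff (by positivity)] at e4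
  nlinarith

theorem part2 [IsSimpleGroup S] (hnc : ∃ a b : S, a * b ≠ b * a) (hE : EPO S) (hst : StarProp S) : False := by
  have hsn : ∀ p, p.Prime → p ∣ Nat.card S → (sn p S).Prime ∧ sn p S ≠ p := 
    fun p hp h => simple_sn hnc hE hp h
  have hsd : ∀ p, p.Prime → sn p S ∣ Nat.card S := fun p hp => 
    (Dvd.intro_left _ rfl).trans (sa_mul_sn_dvd (H := S) hp)
  have hS0 : (0 : ℚ) < Nat.card S := by exact_mod_cast Nat.card_pos
  have hiS : 0 < 1 / (Nat.card S : ℚ) := by positivity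
  by_cases hex : ∃ R : Subgroup S, R ≠ ⊤ ∧ R ≠ ⊥ ∧ FullSub R
  · -- case B
    obtain ⟨R0, ⟨hR0t, hR0b, hR0F⟩, hmax⟩ : ∃ R0 : Subgroup S, (R0 ≠ ⊤ ∧ R0 ≠ ⊥ ∧ FullSub R0) ∧ 
        ∀ R : Subgroup S, (R ≠ ⊤ ∧ R ≠ ⊥ ∧ FullSub R) → Nat.card R ≤ Nat.card R0 := by
      obtain ⟨R0, h1, h2⟩ := Set.exists_max_image {R : Subgroup S | R ≠ ⊤ ∧ R ≠ ⊥ ∧ FullSub R} 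
        (fun R => Nat.card R) (Set.toFinite _) hex
      exact ⟨R0, h1, h2⟩
    have hsub : (Nat.card R0).primeFactors ⊆ (Nat.card S).primeFactors := 
      Nat.primeFactors_mono R0.card_subgroup_dvd_card Nat.card_pos.ne'
    by_cases hpi : (Nat.card R0).primeFactors = (Nat.card S).primeFactors
    · exact caseB1 hE hsn R0 hR0t hR0F hpi
    obtain ⟨q, hqS, hqR⟩ := Finset.exists_of_ssubset (Finset.ssubset_iff_subset_ne.2 ⟨hsub, hpi⟩)
    have hq := Nat.prime_of_mem_primeFactors hqS
    have hqS' := Nat.dvd_of_mem_primeFactors hqS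
    have hR00 : (0 : ℚ) < Nat.card R0 := by exact_mod_cast Nat.card_pos
    have h1 : sF q S < 1 / (Nat.card R0 : ℚ) := by
      have h2 := sum_sub_le hE (insert q (Nat.card R0).primeFactors) 
        (Finset.insert_subset hqS hsub)
      rw [Finset.sum_insert hqR] at h2
      have h3 : ∑ p ∈ (Nat.card R0).primeFactors, sF p R0 ≤ ∑ p ∈ (Nat.card R0).primeFactors, sF p S :=
        Finset.sum_le_sum fun p hp => sF_mono R0 (Nat.prime_of_mem_primeFactors hp) (hR0F p hp)
      rw [sum_sF (hE.sub R0)] at h3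
      linarith
    have hq0 : (0 : ℚ) < sn q S := by exact_mod_cast sn_pos hq
    have h4 : Nat.card R0 < 2 * sn q S := by
      have h5 := sF_lower hq hqS'
      have h6 : (Nat.card R0 : ℚ) < 2 * sn q S := by
        apply lt_of_one_div_lt_one_div (by positivity)
        linarith
      exact_mod_cast h6
    have hR01 : Nat.card R0 ≠ 1 := fun h => hR0b (Subgroup.card_eq_one.1 h)
    obtain ⟨p, hp, hpR⟩ := Nat.exists_prime_and_dvd hR01
    have hpm : p ∈ (Nat.card R0).primeFactors := Nat.mem_primeFactors.2 ⟨hp, hpR, Nat.card_pos.ne'⟩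
    have hpq : p ≠ q := by rintro rfl; exact hqR hpm
    have hpS := hpR.trans R0.card_subgroup_dvd_card
    obtain ⟨R, hRt, hpR', hqR', hR⟩ := star2 hnc hE hst hp hq hpq hpS hqS'
    rcases hR with hR | hR
    · have h7 := hmax R ⟨hRt, by rintro rfl; simp at hpR'; exact hp.one_lt.ne' hpR', hR⟩
      have h8 := mul_le_card hq R
      rw [hR q (Nat.mem_primeFactors.2 ⟨hq, hqR', Nat.card_pos.ne'⟩)] at h8
      have h9 := Nat.mul_le_mul_right (sn q S) (hq.two_le.trans (le_sa hq hqR'))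
      omega
    · have h8 := mul_le_card hp R0
      rw [hR0F p hpm] at h8
      have h9 := Nat.mul_le_mul (le_sa hp hpR) (hsn p hp hpS).1.two_le
      omega
  · -- case A
    push Not at hex
    have hall : ∀ p q, p.Prime → q.Prime → p ≠ q → p ∣ Nat.card S → q ∣ Nat.card S → sn q S = p := by
      intro p q hp hq hpq hpS hqS
      obtain ⟨R, hRt, hpR', hqR', hR⟩ := star2 hnc hE hst hp hq hpq hpS hqS
      rcases hR with hR | hR
      · exact absurd hR (hex R hRt (by rintro rfl; simp at hpR'; exact hp.one_lt.ne' hpR'))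
      · exact hR
    have hS1 : Nat.card S ≠ 1 := by
      have := simple_card hnc Nat.prime_two 0
      simpa using this
    obtain ⟨p, hp, hpS⟩ := Nat.exists_prime_and_dvd hS1
    obtain ⟨hl, hlp⟩ := hsn p hp hpS
    have hlS := hsd p hp
    set q := sn p S with hqd
    have hqp : sn q S = p := hall p q hp hl hlp.symm hpS hlS
    have hpf : (Nat.card S).primeFactors = {p, q} := by
      ext r
      simp only [Finset.mem_insert, Finset.mem_singleton]
      constructor
      · intro hr
        have hr1 := Nat.prime_of_mem_primeFactors hr
        have hr2 := Nat.dvd_of_mem_primeFactors hr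
        by_contra hcon
        push Not at hcon
        exact hcon.2 (hall r p hr1 hp hcon.1 hr2 hpS).symm
      · rintro (rfl | rfl)
        · exact Nat.mem_primeFactors.2 ⟨hp, hpS, Nat.card_pos.ne'⟩
        · exact Nat.mem_primeFactors.2 ⟨hl, hlS, Nat.card_pos.ne'⟩
    have e := sum_sF hE
    rw [hpf, Finset.sum_pair hlp.symm] at e
    have h1 := sF_upper (H := S) hp
    have h2 := sF_upper (H := S) hl
    rw [hqp] at h2
    rw [← hqd] at h1
    have h3 := one_div_add_le hp hl hlp.symm
    have h4 : 6 ≤ Nat.card S := by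
      have h5 := mul_le_card hp S
      have h6 := Nat.mul_le_mul_right q (le_sa hp hpS)
      have h7 : 6 ≤ p * q := by
        rcases lt_or_gt_of_ne hlp with h | h
        · have := hl.two_le
          have : 3 ≤ p := by omega
          nlinarith
        · have := hp.two_le
          have : 3 ≤ q := by omega
          nlinarith
      rw [← hqd] at h5
      omega
    have h5 : 1 / (Nat.card S : ℚ) ≤ 1 / 6 := one_div_le_one_div_of_le (by norm_num) (by exact_mod_cast h4)
    linarith

end


theorem exists_coatom_sep {G : Type*} [Group G] [Finite G] (h : IndependenceProperty G) {x y : G}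
    (h1 : x ∉ Subgroup.zpowers y) (h2 : y ∉ Subgroup.zpowers x) :
    ∃ M : Subgroup G, IsCoatom M ∧ x ∈ M ∧ y ∉ M := by
  have hne : x ≠ y := by rintro rfl; exact h1 (Subgroup.mem_zpowers x)
  rcases h x y hne with ⟨-, X, ⟨hX, hX'⟩, hx, hy⟩ | h | h
  · have hlt : X \ {y} ⊂ X := by
      refine ⟨Set.sdiff_subset, fun hs => ?_⟩
      exact (hs hy).2 rfl
    have hY := hX' _ hlt
    obtain ⟨M, hM, hle⟩ := (eq_top_or_exists_le_coatom (Subgroup.closure (X \ {y}))).resolve_left hY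
    rw [Subgroup.closure_le] at hle
    refine ⟨M, hM, hle ⟨hx, hne⟩, fun hyM => hM.1 ?_⟩
    rw [eq_top_iff, ← hX, Subgroup.closure_le]
    intro z hz
    by_cases hzy : z = y
    · rw [hzy]; exact hyM
    · exact hle ⟨hz, hzy⟩
  · exact absurd h h1
  · exact absurd h h2

/-- The product of two commuting subgroups. -/
def prodSub {G : Type*} [Group G] (A C : Subgroup G) (h : ∀ a ∈ A, ∀ c ∈ C, a * c = c * a) : Subgroup G where
  carrier := {n | ∃ a ∈ A, ∃ c ∈ C, n = a * c}
  mul_mem' := by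
    rintro _ _ ⟨a, ha, c, hc, rfl⟩ ⟨a', ha', c', hc', rfl⟩
    refine ⟨a * a', mul_mem ha ha', c * c', mul_mem hc hc', ?_⟩
    rw [mul_assoc, ← mul_assoc c, ← h a' ha' c hc]
    group
  one_mem' := ⟨1, one_mem _, 1, one_mem _, by simp⟩
  inv_mem' := by
    rintro _ ⟨a, ha, c, hc, rfl⟩
    refine ⟨a⁻¹, inv_mem ha, c⁻¹, inv_mem hc, ?_⟩
    rw [mul_inv_rev, h _ (inv_mem ha) _ (inv_mem hc)]

theorem mem_prodSub {G : Type*} [Group G] {A C : Subgroup G} {h : ∀ a ∈ A, ∀ c ∈ C, a * c = c * a} {n : G} :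
    n ∈ prodSub A C h ↔ ∃ a ∈ A, ∃ c ∈ C, n = a * c := Iff.rfl

/-- A non-abelian minimal normal subgroup `N`, a simple factor `S` and the complement `C`. -/
structure Setup {G : Type*} [Group G] (N S C : Subgroup G) : Prop where
  normN : N.Normal
  SN : S ≤ N
  CN : C ≤ N
  comm : ∀ a ∈ S, ∀ c ∈ C, a * c = c * a
  Cmem : ∀ c ∈ N, (∀ a ∈ S, a * c = c * a) → c ∈ C
  disj : ∀ a ∈ S, a ∈ C → a = 1
  dec : ∀ n ∈ N, ∃ a ∈ S, ∃ c ∈ C, n = a * c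
  conj : ∀ g, (∀ a ∈ S, g * a * g⁻¹ ∈ S) ∨ (∀ a ∈ S, g * a * g⁻¹ ∈ C)
  smin : ∀ K ≤ S, (∀ a ∈ S, ∀ k ∈ K, a * k * a⁻¹ ∈ K) → K = ⊥ ∨ K = S
  nc : ∃ a ∈ S, ∃ b ∈ S, a * b ≠ b * a

namespace Setup
variable {G : Type*} [Group G] {N S C : Subgroup G}

theorem inv_pres (hs : Setup N S C) {g : G} (hg : ∀ a ∈ S, g * a * g⁻¹ ∈ S) : 
    ∀ a ∈ S, g⁻¹ * a * g ∈ S := by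
  rcases hs.conj g⁻¹ with h | h
  · simpa using h
  · exfalso
    obtain ⟨a, ha, b, hb, hab⟩ := hs.nc
    have h1 : a ∈ C := by
      have := h _ (hg a ha)
      simpa [mul_assoc] using this
    rw [hs.disj a ha h1] at hab
    simp at hab

theorem C_pres (hs : Setup N S C) {g : G} (hg : ∀ a ∈ S, g * a * g⁻¹ ∈ S) : 
    ∀ c ∈ C, g * c * g⁻¹ ∈ C := by
  intro c hc
  apply hs.Cmem _ (hs.normN.conj_mem c (hs.CN hc) g)
  intro a ha
  have h1 := hs.comm _ (hs.inv_pres hg a ha) c hc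
  calc a * (g * c * g⁻¹) = g * ((g⁻¹ * a * g) * c) * g⁻¹ := by group
    _ = g * (c * (g⁻¹ * a * g)) * g⁻¹ := by rw [h1]
    _ = _ := by group

theorem uniq (hs : Setup N S C) {a b c d : G} (ha : a ∈ S) (hb : b ∈ S) (hc : c ∈ C) (hd : d ∈ C) 
    (h : a * c = b * d) : a = b ∧ c = d := by
  have h1 : b⁻¹ * a = d * c⁻¹ := by
    rw [inv_mul_eq_iff_eq_mul, ← mul_assoc, ← h]; group
  have h2 : b⁻¹ * a = 1 := hs.disj _ (mul_mem (inv_mem hb) ha) (by rw [h1]; exact mul_mem hd (inv_mem hc))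
  have h3 : a = b := (inv_mul_eq_one.1 h2).symm
  subst h3
  exact ⟨rfl, mul_left_cancel h⟩

theorem glem (hs : Setup N S C) {M : Subgroup G} (hM : IsCoatom M) (B : Subgroup G) (hBS : B ≤ S)
    (hSB : ¬ S ≤ B) (h3 : ∀ n ∈ M, n ∈ N → ∃ b ∈ B, ∃ c ∈ C, n = b * c)
    (h4 : ∀ m ∈ M, (∀ a ∈ S, m * a * m⁻¹ ∈ S) → ∀ b ∈ B, m * b * m⁻¹ ∈ B) : B ≤ M := by
  let gens : Set G := {x | ∃ m ∈ M, ∃ b ∈ B, x = m * b * m⁻¹}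
  let W := Subgroup.closure gens
  have hBW : B ≤ W := fun b hb => Subgroup.subset_closure ⟨1, one_mem _, b, hb, by simp⟩
  have hMW : M ≤ Subgroup.normalizer (W : Set G) := by
    have hcl : ∀ m ∈ M, ∀ w ∈ W, m * w * m⁻¹ ∈ W := by
      intro m hm w hw
      have hle : W ≤ W.comap (MulAut.conj m).toMonoidHom := by
        rw [Subgroup.closure_le]
        rintro _ ⟨m', hm', b, hb, rfl⟩
        exact Subgroup.subset_closure ⟨m * m', mul_mem hm hm', b, hb, by simp [mul_assoc]⟩
      exact hle hw
    intro m hm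
    rw [Subgroup.mem_normalizer_iff]
    intro w
    refine ⟨hcl m hm w, fun hw => ?_⟩
    have := hcl m⁻¹ (inv_mem hm) _ hw
    simpa [mul_assoc] using this
  by_contra hBM
  have hWM : ¬ W ≤ M := fun h => hBM (hBW.trans h)
  have htop : M ⊔ W = ⊤ := hM.2 _ (lt_of_le_of_ne le_sup_left fun h => hWM (h ▸ le_sup_right))
  have hBC : ∀ a ∈ B, ∀ c ∈ C, a * c = c * a := fun a ha => hs.comm a (hBS ha)
  have hWBC : W ≤ prodSub B C hBC := by
    rw [Subgroup.closure_le]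
    rintro _ ⟨m, hm, b, hb, rfl⟩
    rcases hs.conj m with h | h
    · exact ⟨_, h4 m hm h b hb, 1, one_mem _, by simp⟩
    · exact ⟨1, one_mem _, _, h b (hBS hb), by simp⟩
  have hBCN : prodSub B C hBC ≤ N := by
    rintro _ ⟨b, hb, c, hc, rfl⟩
    exact mul_mem (hs.SN (hBS hb)) (hs.CN hc)
  apply hSB
  intro a ha
  have ha' : a ∈ ((M ⊔ W : Subgroup G) : Set G) := by rw [htop]; trivial
  rw [Subgroup.coe_mul_of_left_le_normalizer_right M W hMW] at ha'
  obtain ⟨m, hm, w, hw, hmw⟩ := ha'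
  have hmw' : m * w = a := hmw
  have hmN : m ∈ N := by
    rw [← mul_inv_eq_iff_eq_mul.2 hmw'.symm]
    exact mul_mem (hs.SN ha) (inv_mem (hBCN (hWBC hw)))
  have h5 : a ∈ prodSub B C hBC := by
    rw [← hmw']
    exact mul_mem (h3 m hm hmN) (hWBC hw)
  obtain ⟨b, hb, c, hc, h6⟩ := h5
  have := hs.uniq ha (hBS hb) (one_mem _) hc (by simpa using h6)
  rw [this.1]; exact hb

theorem key (hs : Setup N S C) {M : Subgroup G} (hM : IsCoatom M) 
    {a0 : G} (h0 : a0 ∈ S) (h0M : a0 ∈ M) (h01 : a0 ≠ 1) :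
    ∀ a ∈ S, ∀ c ∈ C, a * c ∈ M → a ∈ M := by
  let R : Subgroup G :=
    { carrier := {a | a ∈ S ∧ ∃ c ∈ C, a * c ∈ M}
      mul_mem' := by
        rintro a a' ⟨ha, c, hc, h⟩ ⟨ha', c', hc', h'⟩
        refine ⟨mul_mem ha ha', c * c', mul_mem hc hc', ?_⟩
        have e : a * a' * (c * c') = (a * c) * (a' * c') := by
          have := hs.comm a' ha' c hc
          calc a * a' * (c * c') = a * (a' * c) * c' := by group
            _ = a * (c * a') * c' := by rw [this]
            _ = _ := by group
        rw [e]; exact mul_mem h h'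
      one_mem' := ⟨one_mem _, 1, one_mem _, by simp [one_mem]⟩
      inv_mem' := by
        rintro a ⟨ha, c, hc, h⟩
        refine ⟨inv_mem ha, c⁻¹, inv_mem hc, ?_⟩
        rw [hs.comm _ (inv_mem ha) _ (inv_mem hc), ← mul_inv_rev]
        exact inv_mem h }
  have hRS : R ≤ S := fun a ha => ha.1
  intro a ha c hc hac
  have haR : a ∈ R := ⟨ha, c, hc, hac⟩
  by_cases hSR : S ≤ R
  · have hK : M ⊓ S = ⊥ ∨ M ⊓ S = S := by
      apply hs.smin _ inf_le_right
      rintro b hb k ⟨hkM, hkS⟩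
      obtain ⟨-, d, hd, hbd⟩ := hSR hb
      refine ⟨?_, S.mul_mem (S.mul_mem hb hkS) (S.inv_mem hb)⟩
      have e : b * k * b⁻¹ = (b * d) * k * (b * d)⁻¹ := by
        have := hs.comm k hkS d hd
        calc b * k * b⁻¹ = b * (k * d) * d⁻¹ * b⁻¹ := by group
          _ = b * (d * k) * d⁻¹ * b⁻¹ := by rw [this]
          _ = _ := by group
      rw [e]
      exact M.mul_mem (M.mul_mem hbd hkM) (M.inv_mem hbd)
    rcases hK with h | h
    · have : a0 ∈ M ⊓ S := ⟨h0M, h0⟩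
      rw [h, Subgroup.mem_bot] at this
      exact absurd this h01
    · exact (inf_eq_right.1 h) ha
  · refine hs.glem hM R hRS hSR ?_ ?_ haR
    · intro n hnM hnN
      obtain ⟨b, hb, d, hd, rfl⟩ := hs.dec n hnN
      exact ⟨b, ⟨hb, d, hd, hnM⟩, d, hd, rfl⟩
    · rintro m hm hmS b ⟨hb, d, hd, hbd⟩
      refine ⟨hmS b hb, _, hs.C_pres hmS d hd, ?_⟩
      have e : m * b * m⁻¹ * (m * d * m⁻¹) = m * (b * d) * m⁻¹ := by group
      rw [e]
      exact mul_mem (mul_mem hm hbd) (inv_mem hm)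

theorem move (hs : Setup N S C) {M : Subgroup G} (hM : IsCoatom M) (hN : ¬ N ≤ M)
    {g a : G} (ha : a ∈ S) (hga : g * a * g⁻¹ ∈ M) : ∃ n : G, n * a * n⁻¹ ∈ S ∧ n * a * n⁻¹ ∈ M := by
  have := hs.normN
  have htop : M ⊔ N = ⊤ := hM.2 _ (lt_of_le_of_ne le_sup_left fun h => hN (h ▸ le_sup_right))
  have hg : g ∈ ((M ⊔ N : Subgroup G) : Set G) := by rw [htop]; trivial
  rw [Subgroup.mul_normal] at hg
  obtain ⟨m, hm, n, hn, rfl⟩ := hg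
  refine ⟨n, ?_, ?_⟩
  · obtain ⟨b, hb, d, hd, rfl⟩ := hs.dec n hn
    have e : b * d * a * (b * d)⁻¹ = b * a * b⁻¹ := by
      have := hs.comm a ha d hd
      calc b * d * a * (b * d)⁻¹ = b * (d * a) * d⁻¹ * b⁻¹ := by group
        _ = b * (a * d) * d⁻¹ * b⁻¹ := by rw [this]
        _ = _ := by group
    rw [e]
    exact mul_mem (mul_mem hb ha) (inv_mem hb)
  · have e : n * a * n⁻¹ = m⁻¹ * ((m * n) * a * (m * n)⁻¹) * m := by group
    rw [e]
    exact mul_mem (mul_mem (inv_mem hm) hga) hm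

theorem mul_pow (hs : Setup N S C) {a c : G} (ha : a ∈ S) (hc : c ∈ C) (k : ℤ) : 
    (a * c) ^ k = a ^ k * c ^ k := 
  Commute.mul_zpow (hs.comm a ha c hc) k

end Setup


namespace Setup
variable {G : Type*} [Group G] {N S C : Subgroup G}

theorem epo_of [Finite G] (h : IndependenceProperty G) (hs : Setup N S C)
    (mv : ∃ g : G, ∀ a ∈ S, g * a * g⁻¹ ∈ C) : EPO ↥S := by
  obtain ⟨g, hg⟩ := mv
  rintro ⟨s, hsS⟩ hs1
  by_contra hnp
  have hs1' : s ≠ 1 := fun e => hs1 (by ext; exact e)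
  rw [Subgroup.orderOf_mk] at hnp
  have ho1 : orderOf s ≠ 1 := fun e => hs1' (orderOf_eq_one_iff.1 e)
  have ho0 : 0 < orderOf s := orderOf_pos s
  obtain ⟨n, hn, hn1, hn2⟩ := (Nat.not_prime_iff_exists_dvd_ne (by omega)).1 hnp
  obtain ⟨m, hm⟩ := hn
  have hm0 : 0 < m := by rcases Nat.eq_zero_or_pos m with h | h; · rw [h] at hm; simp only [mul_zero, zero_mul] at hm; omega
                         · exact h
  have hn0 : 0 < n := by rcases Nat.eq_zero_or_pos n with h | h; · rw [h] at hm; simp only [mul_zero, zero_mul] at hm; omega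
                         · exact h
  have hmlt : m < orderOf s := by
    rw [hm]; nlinarith [show 2 ≤ n by omega]
  have hnlt : n < orderOf s := by
    rcases lt_or_eq_of_le (Nat.le_of_dvd ho0 ⟨m, hm⟩) with h | h
    · exact h
    · exact absurd h hn2
  have hc : g * s * g⁻¹ ∈ C := hg s hsS
  have ha : s ^ m ∈ S := pow_mem hsS m
  have ha1 : s ^ m ≠ 1 := pow_ne_one_of_lt_orderOf hm0.ne' hmlt
  have hsn1 : s ^ n ≠ 1 := pow_ne_one_of_lt_orderOf hn0.ne' hnlt
  have hc1 : g * s * g⁻¹ ≠ 1 := by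
    intro e; exact hs1' (conj_eq_one_iff.1 e)
  obtain ⟨M, hM, hxM, hyM⟩ := exists_coatom_sep h (x := s ^ m * (g * s * g⁻¹)) (y := s ^ m)
    (by
      intro hx
      have hx' : s ^ m * (g * s * g⁻¹) ∈ S := (Subgroup.zpowers_le.2 ha) hx
      exact hc1 (hs.disj _ ((Subgroup.mul_mem_cancel_left _ ha).1 hx') hc))
    (by
      rintro ⟨k, hk⟩
      have hk' : (s ^ m * (g * s * g⁻¹)) ^ k = s ^ m := hk
      rw [hs.mul_pow ha hc] at hk'
      have := hs.uniq (zpow_mem ha k) ha (zpow_mem hc k) (one_mem _) (by simpa using hk')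
      have h2 := this.2
      rw [conj_zpow, conj_eq_one_iff] at h2
      apply ha1
      rw [← this.1, ← zpow_natCast, ← zpow_mul, mul_comm, zpow_mul, h2, one_zpow])
  have hNM : ¬ N ≤ M := fun hle => hyM (hle (hs.SN ha))
  have hxn : g * s ^ n * g⁻¹ ∈ M := by
    have := pow_mem hxM n
    rw [← zpow_natCast, hs.mul_pow ha hc, conj_zpow, zpow_natCast, zpow_natCast, ← pow_mul, mul_comm m n,
      ← hm, pow_orderOf_eq_one, one_mul] at this
    exact this
  obtain ⟨w, hwS, hwM⟩ := hs.move hM hNM (pow_mem hsS n) hxn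
  exact hyM (hs.key hM hwS hwM (fun e => hsn1 (conj_eq_one_iff.1 e)) _ ha _ hc hxM)

/-- Conjugation by an element normalising `S`, as an automorphism of `S`. -/
def conjAut (S : Subgroup G) (m : G) (h1 : ∀ a ∈ S, m * a * m⁻¹ ∈ S) (h2 : ∀ a ∈ S, m⁻¹ * a * m ∈ S) :
    ↥S ≃* ↥S where
  toFun a := ⟨m * a * m⁻¹, h1 a a.2⟩
  invFun a := ⟨m⁻¹ * a * m, h2 a a.2⟩
  left_inv a := by ext; simp [mul_assoc]
  right_inv a := by ext; simp [mul_assoc]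
  map_mul' a b := by ext; simp [mul_assoc]

theorem star_of [Finite G] (h : IndependenceProperty G) (hs : Setup N S C)
    (mv : ∃ g : G, ∀ a ∈ S, g * a * g⁻¹ ∈ C) : StarProp ↥S := by
  obtain ⟨g, hg⟩ := mv
  rintro ⟨s, hsS⟩ ⟨t, htS⟩ ⟨s', hs'S⟩ hp hq hne hs'
  simp only [Subgroup.orderOf_mk] at hp hq hne ⊢
  have hs'2 : s' ∉ Subgroup.zpowers s := by
    rintro ⟨k, hk⟩
    exact hs' ⟨k, by ext; simpa using hk⟩
  have ht1 : t ≠ 1 := by rintro rfl; simp at hq; exact absurd hq Nat.not_prime_one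
  have hc : g * t * g⁻¹ ∈ C := hg t htS
  have hc1 : g * t * g⁻¹ ≠ 1 := fun e => ht1 (conj_eq_one_iff.1 e)
  obtain ⟨M, hM, hxM, hyM⟩ := exists_coatom_sep h (x := s * (g * t * g⁻¹)) (y := s')
    (by
      intro hx
      have hx' : s * (g * t * g⁻¹) ∈ S := (Subgroup.zpowers_le.2 hs'S) hx
      exact hc1 (hs.disj _ ((Subgroup.mul_mem_cancel_left _ hsS).1 hx') hc))
    (by
      rintro ⟨k, hk⟩
      have hk' : (s * (g * t * g⁻¹)) ^ k = s' := hk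
      rw [hs.mul_pow hsS hc] at hk'
      have := hs.uniq (zpow_mem hsS k) hs'S (zpow_mem hc k) (one_mem _) (by simpa using hk')
      exact hs'2 ⟨k, this.1⟩)
  have hNM : ¬ N ≤ M := fun hle => hyM (hle (hs.SN hs'S))
  have hxq : s ^ orderOf t ∈ M := by
    have := pow_mem hxM (orderOf t)
    rw [← zpow_natCast, hs.mul_pow hsS hc, conj_zpow, zpow_natCast, zpow_natCast,
      pow_orderOf_eq_one] at this
    simpa using this
  have hsq1 : s ^ orderOf t ≠ 1 := by
    intro e
    exact hne ((Nat.prime_dvd_prime_iff_eq hp hq).1 (orderOf_dvd_of_pow_eq_one e))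
  have hkey := hs.key hM (pow_mem hsS _) hxq hsq1
  have hsM : s ∈ M := hkey s hsS _ hc hxM
  have hcM : g * t * g⁻¹ ∈ M := (Subgroup.mul_mem_cancel_left _ hsM).1 hxM
  obtain ⟨w, hwS, hwM⟩ := hs.move hM hNM htS hcM
  refine ⟨M.subgroupOf S, hsM, hyM, ⟨⟨_, hwS⟩, hwM, ?_⟩, ?_⟩
  · rw [Subgroup.orderOf_mk]
    exact orderOf_injective (MulAut.conj w).toMonoidHom (MulAut.conj w).injective t
  · intro B hRB hBt hinv
    have hle : B.map S.subtype ≤ M := by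
      apply hs.glem hM
      · rintro _ ⟨b, -, rfl⟩; exact b.2
      · intro hle
        apply hBt
        rw [eq_top_iff]
        rintro ⟨a, ha⟩ -
        obtain ⟨b, hb, hba⟩ := hle ha
        have : b = ⟨a, ha⟩ := by ext; exact hba
        rw [← this]; exact hb
      · intro n hnM hnN
        obtain ⟨a, ha, c, hcc, rfl⟩ := hs.dec n hnN
        have haM := hkey a ha c hcc hnM
        exact ⟨a, ⟨⟨a, ha⟩, hRB haM, rfl⟩, c, hcc, rfl⟩
      · rintro m hm hmS _ ⟨b, hb, rfl⟩
        have h2 := hs.inv_pres hmS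
        have hB := hinv (conjAut S m hmS h2) (by
          ext x
          constructor
          · rintro ⟨y, hy, rfl⟩
            have hy' : (y : G) ∈ M := hy
            exact mul_mem (mul_mem hm hy') (inv_mem hm)
          · intro hx
            have hx' : (x : G) ∈ M := hx
            refine ⟨(conjAut S m hmS h2).symm x, ?_, ?_⟩
            · exact mul_mem (mul_mem (inv_mem hm) hx') hm
            · exact (conjAut S m hmS h2).apply_symm_apply x)
        refine ⟨conjAut S m hmS h2 b, ?_, rfl⟩
        rw [← hB]
        exact ⟨b, hb, rfl⟩
    intro b hb
    exact hle ⟨b, hb, rfl⟩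

theorem simple (hs : Setup N S C) : IsSimpleGroup ↥S := by
  obtain ⟨a, ha, b, hb, hab⟩ := hs.nc
  have : Nontrivial ↥S := ⟨⟨⟨a, ha⟩, 1, fun e => by
    have : a = 1 := congrArg Subtype.val e
    simp [this] at hab⟩⟩
  refine ⟨fun H hH => ?_⟩
  rcases hs.smin (H.map S.subtype) (Subgroup.map_subtype_le H) (by
    rintro x hx _ ⟨k, hk, rfl⟩
    exact ⟨_, hH.conj_mem k hk ⟨x, hx⟩, rfl⟩) with h | h
  · left
    exact (Subgroup.map_eq_bot_iff_of_injective _ S.subtype_injective).1 h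
  · right
    rw [eq_top_iff]
    rintro x -
    have : (x : G) ∈ H.map S.subtype := by rw [h]; exact x.2
    obtain ⟨y, hy, hyx⟩ := this
    have : y = x := by ext; exact hyx
    rw [← this]; exact hy

end Setup

theorem exists_setup {G : Type*} [Group G] [Finite G] (N : Subgroup G) (hN : N.Normal) (hbot : N ≠ ⊥)
    (hmin : ∀ K : Subgroup G, K.Normal → K < N → K = ⊥)
    (hna : ¬ ∀ x ∈ N, ∀ y ∈ N, x * y = y * x) : ∃ S C : Subgroup G, Setup N S C := by
  have hmin' : ∀ K : Subgroup G, K.Normal → K ≤ N → K ≠ ⊥ → K = N := fun K hK hle hne => by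
    by_contra hKN
    exact hne (hmin K hK (lt_of_le_of_ne hle hKN))
  let P : Subgroup G → Prop := fun K => K ≠ ⊥ ∧ K ≤ N ∧ ∀ n ∈ N, ∀ k ∈ K, n * k * n⁻¹ ∈ K
  have hPN : P N := ⟨hbot, le_rfl, fun n _ k hk => hN.conj_mem k hk n⟩
  obtain ⟨S, hS⟩ := (Set.toFinite {K | P K}).exists_minimal ⟨N, hPN⟩
  obtain ⟨⟨hSb, hSN, hSn⟩, hSm⟩ := hS
  have hmS : ∀ K : Subgroup G, K ≤ S → (∀ n ∈ N, ∀ k ∈ K, n * k * n⁻¹ ∈ K) → K = ⊥ ∨ K = S := by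
    intro K hK hn
    by_cases hb : K = ⊥
    · exact Or.inl hb
    · exact Or.inr (le_antisymm hK (hSm ⟨hb, hK.trans hSN, hn⟩ hK))
  let C : Subgroup G := N ⊓ Subgroup.centralizer (S : Set G)
  have hcomm : ∀ a ∈ S, ∀ c ∈ C, a * c = c * a := fun a ha c hc =>
    (Subgroup.mem_centralizer_iff.1 hc.2) a ha
  have hCmem : ∀ c ∈ N, (∀ a ∈ S, a * c = c * a) → c ∈ C := fun c hc h =>
    ⟨hc, Subgroup.mem_centralizer_iff.2 h⟩
  have hconj : ∀ g, (∀ a ∈ S, g * a * g⁻¹ ∈ S) ∨ (∀ a ∈ S, g * a * g⁻¹ ∈ C) := by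
    intro g
    -- the conjugate
    let T : Subgroup G := S.map (MulAut.conj g).toMonoidHom
    have hT : ∀ x, x ∈ T ↔ ∃ a ∈ S, g * a * g⁻¹ = x := fun x => Iff.rfl
    have hTn : ∀ n ∈ N, ∀ k ∈ T, n * k * n⁻¹ ∈ T := by
      intro n hn k hk
      obtain ⟨a, ha, rfl⟩ := (hT k).1 hk
      refine (hT _).2 ⟨(g⁻¹ * n * g) * a * (g⁻¹ * n * g)⁻¹, hSn _ ?_ a ha, by group⟩
      simpa using hN.conj_mem n hn g⁻¹
    have hTN : T ≤ N := by
      intro k hk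
      obtain ⟨a, ha, rfl⟩ := (hT k).1 hk
      exact hN.conj_mem a (hSN ha) g
    rcases hmS (T ⊓ S) inf_le_right (fun n hn k hk => ⟨hTn n hn k hk.1, hSn n hn k hk.2⟩) with h | h
    · right
      intro a ha
      have hgT : g * a * g⁻¹ ∈ T := (hT _).2 ⟨a, ha, rfl⟩
      apply hCmem _ (hTN hgT)
      intro b hb
      have h1 : b * (g * a * g⁻¹) * b⁻¹ * (g * a * g⁻¹)⁻¹ ∈ T ⊓ S := by
        constructor
        · exact T.mul_mem (hTn b (hSN hb) _ hgT) (T.inv_mem hgT)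
        · have := S.mul_mem hb (hSn _ (hTN hgT) _ (S.inv_mem hb))
          have e : b * (g * a * g⁻¹) * b⁻¹ * (g * a * g⁻¹)⁻¹ = b * ((g * a * g⁻¹) * b⁻¹ * (g * a * g⁻¹)⁻¹) := by
            group
          rw [e]; exact this
      rw [h, Subgroup.mem_bot] at h1
      rw [mul_inv_eq_one, mul_inv_eq_iff_eq_mul] at h1
      exact h1
    · left
      have hST : S ≤ T := inf_eq_right.1 h
      have hcard : Nat.card T = Nat.card S :=
        Nat.card_congr (S.equivMapOfInjective _ (MulAut.conj g).injective).symm.toEquiv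
      have hTS : S = T := Subgroup.eq_of_le_of_card_ge hST hcard.le
      intro a ha
      rw [hTS]
      exact (hT _).2 ⟨a, ha, rfl⟩
  have hdec : ∀ n ∈ N, ∃ a ∈ S, ∃ c ∈ C, n = a * c := by
    have hSle : S ≤ Subgroup.normalClosure (S : Set G) := Subgroup.le_normalClosure
    have hNC : Subgroup.normalClosure (S : Set G) = N :=
      hmin' _ Subgroup.normalClosure_normal (Subgroup.normalClosure_le_normal hSN)
        (fun e => hSb (by rw [e] at hSle; exact le_bot_iff.1 hSle))
    have hle : Subgroup.normalClosure (S : Set G) ≤ prodSub S C hcomm := by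
      rw [Subgroup.normalClosure, Subgroup.closure_le]
      intro x hx
      obtain ⟨a, ha, hax⟩ := Group.mem_conjugatesOfSet_iff.1 hx
      obtain ⟨g, rfl⟩ := isConj_iff.1 hax
      rcases hconj g with h | h
      · exact ⟨_, h a ha, 1, one_mem _, by simp⟩
      · exact ⟨1, one_mem _, _, h a ha, by simp⟩
    intro n hn
    rw [← hNC] at hn
    exact hle hn
  have hnc : ∃ a ∈ S, ∃ b ∈ S, a * b ≠ b * a := by
    by_contra hab
    push Not at hab
    apply hna
    let Z : Subgroup G := N ⊓ Subgroup.centralizer (N : Set G)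
    have hZn : Z.Normal := by
      have := hN
      exact inferInstance
    have hSZ : S ≤ Z := by
      intro a ha
      refine ⟨hSN ha, Subgroup.mem_centralizer_iff.2 fun n hn => ?_⟩
      obtain ⟨b, hb, c, hc, rfl⟩ := hdec n hn
      have h1 := hcomm a ha c hc
      have h2 := hab a ha b hb
      rw [mul_assoc, ← h1, ← mul_assoc, ← h2, mul_assoc]
    have hZN : Z = N := hmin' Z hZn inf_le_left (fun e => hSb (le_bot_iff.1 (e ▸ hSZ)))
    intro x hx y hy
    rw [← hZN] at hy
    exact (Subgroup.mem_centralizer_iff.1 hy.2) x hx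
  have hconjS : ∀ a ∈ S, ∀ c ∈ C, ∀ k ∈ S, (a * c) * k * (a * c)⁻¹ = a * k * a⁻¹ := by
    intro a ha c hc k hk
    have := hcomm k hk c hc
    calc a * c * k * (a * c)⁻¹ = a * (c * k) * c⁻¹ * a⁻¹ := by group
      _ = a * (k * c) * c⁻¹ * a⁻¹ := by rw [this]
      _ = _ := by group
  have hsmin : ∀ K ≤ S, (∀ a ∈ S, ∀ k ∈ K, a * k * a⁻¹ ∈ K) → K = ⊥ ∨ K = S := by
    intro K hK hn
    apply hmS K hK
    intro n hnN k hk
    obtain ⟨a, ha, c, hc, rfl⟩ := hdec n hnN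
    rw [hconjS a ha c hc k (hK hk)]
    exact hn a ha k hk
  refine ⟨S, C, hN, hSN, inf_le_left, hcomm, hCmem, ?_, hdec, hconj, hsmin, hnc⟩
  rcases hsmin (S ⊓ C) inf_le_left (by
    rintro a ha k ⟨hk, hkC⟩
    have := hcomm a ha k hkC
    rw [this, mul_inv_cancel_right]
    exact ⟨hk, hkC⟩) with h | h
  · intro a ha hac
    have : a ∈ S ⊓ C := ⟨ha, hac⟩
    rwa [h, Subgroup.mem_bot] at this
  · exfalso
    obtain ⟨a, ha, b, hb, hab⟩ := hnc
    have : b ∈ S ⊓ C := by rw [h]; exact hb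
    exact hab (hcomm a ha b this.2)

theorem main7 (G : Type*) [Group G] [Finite G] (h : IndependenceProperty G)
    (N : Subgroup G) (hN : N.Normal) (hbot : N ≠ ⊥)
    (hmin : ∀ K : Subgroup G, K.Normal → K < N → K = ⊥)
    (hna : ¬ ∀ x ∈ N, ∀ y ∈ N, x * y = y * x) :
    IsSimpleGroup ↥N := by
  obtain ⟨S, C, hs⟩ := exists_setup N hN hbot hmin hna
  have hsimp := hs.simple
  by_cases hpres : ∀ g : G, ∀ a ∈ S, g * a * g⁻¹ ∈ S
  · have hSn : S.Normal := ⟨fun a ha g => hpres g a ha⟩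
    have : S = N := by
      by_contra hne
      have hb := hmin S hSn (lt_of_le_of_ne hs.SN hne)
      obtain ⟨a, ha, b, hb', hab⟩ := hs.nc
      rw [hb, Subgroup.mem_bot] at ha
      simp [ha] at hab
    rw [← this]; exact hsimp
  · exfalso
    push Not at hpres
    obtain ⟨g, a, ha, hga⟩ := hpres
    have mv : ∃ g : G, ∀ a ∈ S, g * a * g⁻¹ ∈ C :=
      ⟨g, (hs.conj g).resolve_left fun h' => hga (h' a ha)⟩
    obtain ⟨a, ha, b, hb, hab⟩ := hs.nc
    exact part2 (S := ↥S) ⟨⟨a, ha⟩, ⟨b, hb⟩, fun e => hab (congrArg Subtype.val e)⟩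
      (hs.epo_of h mv) (hs.star_of h mv)

/-- Let `G` be a finite group satisfying the independence property with
trivial Frattini subgroup, and let `N` be a non-abelian minimal normal subgroup of `G`.
Then `N` is a simple group. -/
theorem stmt_7 (G : Type*) [Group G] [Finite G] (h : IndependenceProperty G)
    (hfrat : frattini G = ⊥) (N : Subgroup G) (hN : N.Normal) (hbot : N ≠ ⊥)
    (hmin : ∀ K : Subgroup G, K.Normal → K < N → K = ⊥)
    (hna : ¬ ∀ x ∈ N, ∀ y ∈ N, x * y = y * x) :
    IsSimpleGroup ↥N := by
  exact main7 G h N hN hbot hmin hna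
end

section
/- Let N_1 and N_2 be two distinct minimal normal subgroups of a finite group X, and let a ∈ N_1 and b ∈ N_2 be such that ab and b are distinct and independent in X. Then there exists a group isomorphism φ from N_1 to N_2 with φ(a) = b; moreover, if N_1 is abelian, then φ can be chosen so that φ(n^x) = φ(n)^x for all n ∈ N_1 and all x ∈ X. -/
/-- If `L ⊔ M = ⊤` with `M` normal and centralizing the normal subgroup `N`, then `L ⊓ N` is normal. -/
theorem aux_inf_normal {X : Type*} [Group X] (L N M : Subgroup X) (hN : N.Normal) (hM : M.Normal)
    (hc : ∀ n ∈ N, ∀ m ∈ M, n * m = m * n) (ht : L ⊔ M = ⊤) : (L ⊓ N).Normal := by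
  constructor
  rintro n ⟨hnL, hnN⟩ x
  have hx : x ∈ L ⊔ M := by rw [ht]; trivial
  obtain ⟨l, hl, m, hm, rfl⟩ := Subgroup.mem_sup_of_normal_right.1 hx
  have e : l * m * n * (l * m)⁻¹ = l * n * l⁻¹ := by
    rw [mul_assoc l m n, ← hc n hnN m hm]; group
  rw [e]
  exact ⟨L.mul_mem (L.mul_mem hl hnL) (L.inv_mem hl), hN.conj_mem n hnN l⟩

/-- A normal subgroup not contained in `L`, minimal normal, meets `L` trivially. -/
theorem aux_inf_bot {X : Type*} [Group X] (L N : Subgroup X)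
    (hm : ∀ K : Subgroup X, K.Normal → K < N → K = ⊥) (hn : (L ⊓ N).Normal)
    (h : ¬ N ≤ L) : L ⊓ N = ⊥ := by
  apply hm _ hn
  refine lt_of_le_of_ne inf_le_right fun e => h ?_
  rw [← e]; exact inf_le_left

/-- Let `N₁` and `N₂` be two distinct minimal normal subgroups of a
finite group `X`, and let `a ∈ N₁`, `b ∈ N₂` be such that `a * b` and `b` are distinct
and independent in `X`. Then there is a group isomorphism `φ : N₁ ≃ N₂` with `φ a = b`;
moreover if `N₁` is abelian then `φ` may be chosen to commute with conjugation by every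
element of `X`. -/
theorem stmt_8 (X : Type*) [Group X] [Finite X] (N₁ N₂ : Subgroup X) (hne : N₁ ≠ N₂)
    (h₁ : N₁.Normal) (h1b : N₁ ≠ ⊥) (h1m : ∀ K : Subgroup X, K.Normal → K < N₁ → K = ⊥)
    (h₂ : N₂.Normal) (h2b : N₂ ≠ ⊥) (h2m : ∀ K : Subgroup X, K.Normal → K < N₂ → K = ⊥)
    (a b : X) (ha : a ∈ N₁) (hb : b ∈ N₂)
    (hind : Independent (a * b) b) :
    ∃ φ : ↥N₁ ≃* ↥N₂, (φ ⟨a, ha⟩ : X) = b ∧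
      ((∀ x ∈ N₁, ∀ y ∈ N₁, x * y = y * x) →
        ∃ ψ : ↥N₁ ≃* ↥N₂, (ψ ⟨a, ha⟩ : X) = b ∧
          ∀ (n x : X) (hn : n ∈ N₁),
            (ψ ⟨x⁻¹ * n * x, by simpa using h₁.conj_mem n hn x⁻¹⟩ : X) =
              x⁻¹ * (ψ ⟨n, hn⟩ : X) * x) := by
  obtain ⟨hab, S, ⟨hS, hmin⟩, habS, hbS⟩ := hind
  obtain ⟨L, hLdef⟩ : ∃ L, L = Subgroup.closure (S \ {b}) := ⟨_, rfl⟩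
  have hLne : L ≠ ⊤ := by
    rw [hLdef]
    refine hmin _ ⟨Set.sdiff_subset, fun h => (h hbS).2 rfl⟩
  have hgen : ∀ K : Subgroup X, L ≤ K → b ∈ K → K = ⊤ := by
    intro K hK hbK
    rw [eq_top_iff, ← hS, Subgroup.closure_le]
    intro s hs
    by_cases e : s = b
    · rw [e]; exact hbK
    · apply hK; rw [hLdef]; exact Subgroup.subset_closure ⟨hs, e⟩
  have habL : a * b ∈ L := by rw [hLdef]; exact Subgroup.subset_closure ⟨habS, hab⟩
  have hbL : b ∉ L := fun h => hLne (hgen L le_rfl h)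
  have haL : a ∉ L := fun h => hbL ((L.mul_mem_cancel_left h).1 habL)
  have t2 : L ⊔ N₂ = ⊤ := hgen _ le_sup_left ((le_sup_right : N₂ ≤ L ⊔ N₂) hb)
  have t1 : L ⊔ N₁ = ⊤ := by
    refine hgen _ le_sup_left ?_
    have h1 : a ∈ L ⊔ N₁ := (le_sup_right : N₁ ≤ L ⊔ N₁) ha
    exact ((L ⊔ N₁).mul_mem_cancel_left h1).1 ((le_sup_left : L ≤ L ⊔ N₁) habL)
  have hdisj : N₁ ⊓ N₂ = ⊥ := by
    by_contra hb'
    have hn : (N₁ ⊓ N₂).Normal := inferInstance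
    have e1 : N₁ ⊓ N₂ = N₁ := by
      by_contra h
      exact hb' (h1m _ hn (lt_of_le_of_ne inf_le_left h))
    have e2 : N₁ ⊓ N₂ = N₂ := by
      by_contra h
      exact hb' (h2m _ hn (lt_of_le_of_ne inf_le_right h))
    exact hne (e1.symm.trans e2)
  have hc : ∀ n ∈ N₁, ∀ m ∈ N₂, n * m = m * n := fun n hn m hm =>
    Subgroup.commute_of_normal_of_disjoint N₁ N₂ h₁ h₂ (disjoint_iff.2 hdisj) n m hn hm
  have i1 : L ⊓ N₁ = ⊥ := aux_inf_bot L N₁ h1m (aux_inf_normal L N₁ N₂ h₁ h₂ hc t2)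
    fun h => haL (h ha)
  have i2 : L ⊓ N₂ = ⊥ := aux_inf_bot L N₂ h2m
    (aux_inf_normal L N₂ N₁ h₂ h₁ (fun n hn m hm => (hc m hm n hn).symm) t1)
    fun h => hbL (h hb)
  have z1 : ∀ n ∈ N₁, n ∈ L → n = 1 := fun n hn hl => by
    have : n ∈ L ⊓ N₁ := ⟨hl, hn⟩
    rwa [i1, Subgroup.mem_bot] at this
  have z2 : ∀ n ∈ N₂, n ∈ L → n = 1 := fun n hn hl => by
    have : n ∈ L ⊓ N₂ := ⟨hl, hn⟩
    rwa [i2, Subgroup.mem_bot] at this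
  have ex : ∀ n : N₁, ∃ m : N₂, (n : X) * m ∈ L := by
    intro n
    have hx : (n : X) ∈ L ⊔ N₂ := by rw [t2]; trivial
    obtain ⟨l, hl, m, hm, e⟩ := Subgroup.mem_sup_of_normal_right.1 hx
    refine ⟨⟨m⁻¹, N₂.inv_mem hm⟩, ?_⟩
    rw [← e]; simpa using hl
  have ex' : ∀ m : N₂, ∃ n : N₁, (n : X) * m ∈ L := by
    intro m
    have hx : (m : X) ∈ L ⊔ N₁ := by rw [t1]; trivial
    obtain ⟨l, hl, n, hn, e⟩ := Subgroup.mem_sup_of_normal_right.1 hx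
    refine ⟨⟨n⁻¹, N₁.inv_mem hn⟩, ?_⟩
    change n⁻¹ * (m : X) ∈ L
    rw [hc n⁻¹ (N₁.inv_mem hn) m m.2, ← e]; simpa using hl
  have un : ∀ (n : X) (m m' : N₂), n * m ∈ L → n * m' ∈ L → m = m' := by
    intro n m m' h h'
    have h3 : (m : X)⁻¹ * m' ∈ L := by
      have := L.mul_mem (L.inv_mem h) h'
      simpa [mul_assoc] using this
    have := z2 _ (N₂.mul_mem (N₂.inv_mem m.2) m'.2) h3
    exact Subtype.ext (inv_mul_eq_one.1 this)
  choose f hf using ex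
  have fmul : ∀ n n' : N₁, f (n * n') = f n * f n' := by
    intro n n'
    refine un _ _ _ (hf _) ?_
    have := L.mul_mem (hf n) (hf n')
    have e : ((n * n' : N₁) : X) * ((f n * f n' : N₂) : X) = n * f n * (n' * f n') := by
      push_cast
      have := hc n' n'.2 (f n) (f n).2
      simp only [mul_assoc]
      rw [← mul_assoc (n' : X) (f n : X), this]
      simp only [mul_assoc]
    rw [e]; exact this
  let F : N₁ →* N₂ := MonoidHom.mk' f fmul
  have hbij : Function.Bijective F := by
    constructor
    · rw [injective_iff_map_eq_one]
      intro n hn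
      have h := hf n
      have hn' : f n = 1 := hn
      rw [hn'] at h
      exact Subtype.ext (z1 n n.2 (by simpa using h))
    · intro m
      obtain ⟨n, hn⟩ := ex' m
      exact ⟨n, un n _ _ (hf n) hn⟩
  let φ : N₁ ≃* N₂ := MulEquiv.ofBijective F hbij
  have hφ : ∀ n, φ n = f n := fun n => rfl
  have hφa : (φ ⟨a, ha⟩ : X) = b := by
    have := un a (φ ⟨a, ha⟩) ⟨b, hb⟩ (hf ⟨a, ha⟩) habL
    rw [this]
  refine ⟨φ, hφa, fun hcomm => ⟨φ, hφa, ?_⟩⟩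
  have hcomm2 : ∀ x y : N₂, x * y = y * x := by
    intro x y
    obtain ⟨x, rfl⟩ := φ.surjective x
    obtain ⟨y, rfl⟩ := φ.surjective y
    rw [← map_mul, ← map_mul]
    congr 1
    exact Subtype.ext (hcomm x x.2 y y.2)
  intro n x hn
  have hm2 : x⁻¹ * (φ ⟨n, hn⟩ : X) * x ∈ N₂ := by
    simpa using h₂.conj_mem _ (φ ⟨n, hn⟩).2 x⁻¹
  have key : (x⁻¹ * n * x) * (x⁻¹ * (φ ⟨n, hn⟩ : X) * x) ∈ L := by
    have hx : x ∈ L ⊔ N₂ := by rw [t2]; trivial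
    obtain ⟨l, hl, m, hm, rfl⟩ := Subgroup.mem_sup_of_normal_right.1 hx
    have hq : l⁻¹ * n * l ∈ N₁ := by simpa using h₁.conj_mem n hn l⁻¹
    have hr : l⁻¹ * (φ ⟨n, hn⟩ : X) * l ∈ N₂ := by
      simpa using h₂.conj_mem _ (φ ⟨n, hn⟩).2 l⁻¹
    have c1 := hc _ hq m hm
    have c2 : l⁻¹ * (φ ⟨n, hn⟩ : X) * l * m = m * (l⁻¹ * (φ ⟨n, hn⟩ : X) * l) :=
      congrArg Subtype.val (hcomm2 ⟨_, hr⟩ ⟨m, hm⟩)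
    have e1 : (l * m)⁻¹ * n * (l * m) = l⁻¹ * n * l := by
      calc (l * m)⁻¹ * n * (l * m) = m⁻¹ * (l⁻¹ * n * l * m) := by group
        _ = _ := by rw [c1]; group
    have e2 : (l * m)⁻¹ * (φ ⟨n, hn⟩ : X) * (l * m) = l⁻¹ * (φ ⟨n, hn⟩ : X) * l := by
      calc (l * m)⁻¹ * (φ ⟨n, hn⟩ : X) * (l * m)
          = m⁻¹ * (l⁻¹ * (φ ⟨n, hn⟩ : X) * l * m) := by group
        _ = _ := by rw [c2]; group
    rw [e1, e2]
    have h := L.mul_mem (L.mul_mem (L.inv_mem hl) (hf ⟨n, hn⟩)) hl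
    have e3 : l⁻¹ * n * l * (l⁻¹ * (φ ⟨n, hn⟩ : X) * l) = l⁻¹ * (n * (φ ⟨n, hn⟩ : X)) * l := by
      group
    rw [e3]; exact h
  have := un (x⁻¹ * n * x) (φ ⟨x⁻¹ * n * x, by simpa using h₁.conj_mem n hn x⁻¹⟩)
    ⟨_, hm2⟩ (hf ⟨x⁻¹ * n * x, by simpa using h₁.conj_mem n hn x⁻¹⟩) key
  rw [this]
end

section
/- Let X be a finite group and let x and y be distinct elements of X such that y belongs to every maximal subgroup of X containing x. Then no minimal generating set for X contains both x and y. -/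
/-- Let `X` be a finite group and let `x` and `y` be distinct elements
of `X` such that `y` belongs to every maximal subgroup of `X` containing `x`. Then no
minimal generating set for `X` contains both `x` and `y`. -/
theorem stmt_12 (X : Type*) [Group X] [Finite X] (x y : X) (hxy : x ≠ y)
    (h : ∀ M : Subgroup X, IsCoatom M → x ∈ M → y ∈ M) :
    ∀ S : Set X, IsMinimalGenSet S → ¬ (x ∈ S ∧ y ∈ S) := by
  rintro S ⟨hgen, hmin⟩ ⟨hxS, hyS⟩
  have hss : S \ {y} ⊂ S :=
    ⟨Set.diff_subset, fun hsub => (hsub hyS).2 rfl⟩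
  rcases eq_top_or_exists_le_coatom (Subgroup.closure (S \ {y})) with htop | ⟨M, hM, hle⟩
  · exact hmin _ hss htop
  · have hsub : S \ {y} ⊆ M := (Subgroup.closure_le M).1 hle
    have hyM : y ∈ M := h M hM (hsub ⟨hxS, hxy⟩)
    apply hM.1
    rw [eq_top_iff, ← hgen, Subgroup.closure_le]
    intro z hz
    by_cases hzy : z = y
    · rw [hzy]
      exact hyM
    · exact hsub ⟨hz, hzy⟩
end
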